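/- arXiv:1806.02838 — 2 statements merged into one kernel-verified Lean document; each statement's English description precedes it below -/
import Mathlib

section
/- There exists a function ℓ : ℕ → ℕ such that for all integers s ≥ 2 and t ≥ ℓ(s) there exist constants c_1, c_2 > 0 with c_1 · n^{2-2/(2s+1)} ≤ ex(n, H_{s,t}) ≤ c_2 · n^{2-2/(2s+1)} for all sufficiently large n; that is, ex(n, H_{s,t}) = Θ(n^{2-2/(2s+1)}). -/
open SimpleGraph Filter

/-- `G` contains a copy of `H` (an injective graph homomorphism from `H` to `G`). -/
def SimpleGraph.Contains {α β : Type*} (G : SimpleGraph α) (H : SimpleGraph β) : Prop :=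
  ∃ f : H →g G, Function.Injective f

/-- The Turán number `ex(n, H)`: the maximum number of edges in an `n`-vertex
graph containing no copy of `H`. -/
noncomputable def exNum {β : Type*} (n : ℕ) (H : SimpleGraph β) : ℕ :=
  sSup {N : ℕ | ∃ G : SimpleGraph (Fin n), ¬ G.Contains H ∧ G.edgeSet.ncard = N}

/-- The graph `H_{s,t}`: two vertex-disjoint copies of `K_{s,t}` together with a perfect
matching joining the two images of every vertex of `K_{s,t}`. -/
def Hgraph (s t : ℕ) : SimpleGraph ((Fin s ⊕ Fin t) × Bool) :=
  SimpleGraph.fromRel fun x y =>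
    (x.2 = y.2 ∧ (completeBipartiteGraph (Fin s) (Fin t)).Adj x.1 y.1) ∨
    (x.2 ≠ y.2 ∧ x.1 = y.1)

section ChoiceFunctions

open Finset
open scoped Classical

variable {ι α β : Type*} [Fintype ι] [DecidableEq ι]

theorem card_pi_rel_mul_le (S : ι → Finset α) {i j : ι} (hij : i ≠ j)
    (r : α → α → Prop) (z : ℕ) (h : ∀ x ∈ S i, #{y ∈ S j | r x y} ≤ z) :
    #{e ∈ Fintype.piFinset S | r (e i) (e j)} * #(S j) ≤ z * #(Fintype.piFinset S) := by
  have key : #({e ∈ Fintype.piFinset S | r (e i) (e j)} ×ˢ S j) ≤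
      #((Fintype.piFinset S).sigma fun e => {y ∈ S j | r (e i) y}) := by
    refine Finset.card_le_card_of_injOn
      (fun p => (⟨Function.update p.1 j p.2, p.1 j⟩ : (_ : ι → α) × α)) ?_ ?_
    · rintro ⟨e, x⟩ hp
      simp only [coe_product, Set.mem_prod, mem_coe, mem_filter, Fintype.mem_piFinset] at hp
      obtain ⟨⟨he, hr⟩, hx⟩ := hp
      simp only [coe_sigma, Set.mem_sigma_iff, mem_coe, Fintype.mem_piFinset, mem_filter]
      refine ⟨fun l => ?_, he j, ?_⟩
      · by_cases hl : l = j
        · subst hl; simpa using hx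
        · simpa [Function.update_of_ne hl] using he l
      · simpa [Function.update_of_ne hij] using hr
    · rintro ⟨e, x⟩ - ⟨e', x'⟩ - hpq
      simp only [Sigma.mk.injEq, heq_eq_eq] at hpq
      obtain ⟨h1, h2⟩ := hpq
      have hx : x = x' := by simpa using congrFun h1 j
      refine Prod.ext (funext fun l => ?_) hx
      by_cases hl : l = j
      · subst hl; exact h2
      · simpa [Function.update_of_ne hl] using congrFun h1 l
  rw [card_product, card_sigma] at key
  refine key.trans ?_
  calc ∑ e ∈ Fintype.piFinset S, #{y ∈ S j | r (e i) y}
      ≤ ∑ e ∈ Fintype.piFinset S, z :=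
        sum_le_sum fun e he => h _ (Fintype.mem_piFinset.1 he i)
    _ = z * #(Fintype.piFinset S) := by simp [mul_comm]

/-- If all sets are large, at least half of the choice functions are injective. -/
theorem card_pi_le_two_mul_injective (S : ι → Finset α)
    (h : ∀ i, 2 * Fintype.card ι ^ 2 ≤ #(S i)) :
    #(Fintype.piFinset S) ≤ 2 * #{e ∈ Fintype.piFinset S | Function.Injective e} := by
  rcases isEmpty_or_nonempty ι with hι | hι
  · rw [filter_true_of_mem fun e _ => Function.injective_of_subsingleton e]
    omega
  have hc : 0 < Fintype.card ι := Fintype.card_pos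
  have hpair : ∀ p : ι × ι, p.1 ≠ p.2 →
      #{e ∈ Fintype.piFinset S | e p.1 = e p.2} * (2 * Fintype.card ι ^ 2) ≤
        #(Fintype.piFinset S) := by
    intro p hp
    refine (Nat.mul_le_mul_left _ (h p.2)).trans ?_
    have := card_pi_rel_mul_le S hp (fun x y => x = y) 1 (fun x _ => by
      rw [Finset.card_le_one]; intro a ha b hb
      simp only [mem_filter] at ha hb; exact ha.2.symm.trans hb.2)
    simpa using this
  have hcover : {e ∈ Fintype.piFinset S | ¬ Function.Injective e} ⊆
      ({p : ι × ι | p.1 ≠ p.2} : Finset (ι × ι)).biUnion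
        fun p => {e ∈ Fintype.piFinset S | e p.1 = e p.2} := by
    intro e he
    simp only [mem_filter, Function.Injective, not_forall] at he
    obtain ⟨he, i, j, hij, hne⟩ := he
    simp only [mem_biUnion, mem_filter, mem_univ, true_and]
    exact ⟨(i, j), hne, he, hij⟩
  have hnon : #{e ∈ Fintype.piFinset S | ¬ Function.Injective e} * (2 * Fintype.card ι ^ 2) ≤
      Fintype.card ι ^ 2 * #(Fintype.piFinset S) := by
    calc _ ≤ (∑ p ∈ ({p : ι × ι | p.1 ≠ p.2} : Finset (ι × ι)),
          #{e ∈ Fintype.piFinset S | e p.1 = e p.2}) * (2 * Fintype.card ι ^ 2) :=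
          Nat.mul_le_mul_right _ ((card_le_card hcover).trans card_biUnion_le)
      _ = ∑ p ∈ ({p : ι × ι | p.1 ≠ p.2} : Finset (ι × ι)),
          #{e ∈ Fintype.piFinset S | e p.1 = e p.2} * (2 * Fintype.card ι ^ 2) := by
          rw [sum_mul]
      _ ≤ ∑ p ∈ ({p : ι × ι | p.1 ≠ p.2} : Finset (ι × ι)), #(Fintype.piFinset S) :=
          sum_le_sum fun p hp => hpair p (by simpa using hp)
      _ ≤ _ := by
          rw [sum_const, smul_eq_mul]
          refine Nat.mul_le_mul_right _ ((card_le_univ _).trans ?_)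
          simp [sq]
  have hsum := card_filter_add_card_filter_not (s := Fintype.piFinset S)
    (fun e => Function.Injective e)
  have hnon' : 2 * #{e ∈ Fintype.piFinset S | ¬ Function.Injective e} ≤
      #(Fintype.piFinset S) := by
    have : 0 < Fintype.card ι ^ 2 := by positivity
    nlinarith
  omega

/-- Greedy choice of distinct representatives. -/
theorem exists_injective_choice (t : ℕ) (S : Fin t → Finset α) (h : ∀ j, t ≤ #(S j)) :
    ∃ d : Fin t → α, Function.Injective d ∧ ∀ j, d j ∈ S j := by
  refine (Finset.all_card_le_biUnion_card_iff_exists_injective S).1 fun A => ?_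
  rcases A.eq_empty_or_nonempty with rfl | ⟨j, hj⟩
  · simp
  · calc #A ≤ t := by simpa using card_le_univ A
      _ ≤ #(S j) := h j
      _ ≤ _ := card_le_card (subset_biUnion_of_mem S hj)

/-- A bipartite graph with bounded degrees and many edges has a large matching. -/
theorem exists_matching_of_card_lt (Q : Finset (α × β)) (T : ℕ)
    (h1 : ∀ c, #{f ∈ Q | f.1 = c} ≤ T) (h2 : ∀ d, #{f ∈ Q | f.2 = d} ≤ T) (t : ℕ)
    (hQ : 2 * t * T < #Q) :
    ∃ f : Fin t → α × β, (∀ j, f j ∈ Q) ∧ Function.Injective (fun j => (f j).1) ∧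
      Function.Injective (fun j => (f j).2) := by
  induction t with
  | zero => exact ⟨Fin.elim0, fun j => j.elim0, fun j => j.elim0, fun j => j.elim0⟩
  | succ t ih =>
    obtain ⟨f, hf, hi1, hi2⟩ := ih (lt_of_le_of_lt (by gcongr; omega) hQ)
    have : ∃ g ∈ Q, (∀ j, g.1 ≠ (f j).1) ∧ ∀ j, g.2 ≠ (f j).2 := by
      by_contra! hcon
      have hsub : Q ⊆ (univ : Finset (Fin t)).biUnion
          (fun j => {g ∈ Q | g.1 = (f j).1} ∪ {g ∈ Q | g.2 = (f j).2}) := by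
        intro g hg
        simp only [mem_biUnion, mem_univ, true_and, mem_union, mem_filter, hg]
        by_cases hx : ∀ j, g.1 ≠ (f j).1
        · obtain ⟨j, hj⟩ := hcon g hg hx
          exact ⟨j, Or.inr hj⟩
        · push Not at hx
          obtain ⟨j, hj⟩ := hx
          exact ⟨j, Or.inl hj⟩
      have := (card_le_card hsub).trans (card_biUnion_le_card_mul _ _ (2 * T) fun j _ =>
        (card_union_le _ _).trans (by linarith [h1 (f j).1, h2 (f j).2]))
      simp only [card_univ, Fintype.card_fin] at this
      nlinarith
    obtain ⟨g, hg, hg1, hg2⟩ := this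
    refine ⟨Fin.cons g f, ?_, ?_, ?_⟩
    · intro j
      refine Fin.cases ?_ (fun j => ?_) j <;> simp [hg, hf]
    · intro i j
      refine Fin.cases ?_ (fun i => ?_) i <;> refine Fin.cases ?_ (fun j => ?_) j
      · simp
      · intro h; exact absurd (by simpa using h) (hg1 j)
      · intro h; exact absurd (by simpa using h.symm) (hg1 i)
      · intro h; simpa using hi1 (by simpa using h)
    · intro i j
      refine Fin.cases ?_ (fun i => ?_) i <;> refine Fin.cases ?_ (fun j => ?_) j
      · simp
      · intro h; exact absurd (by simpa using h) (hg2 j)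
      · intro h; exact absurd (by simpa using h.symm) (hg2 i)
      · intro h; simpa using hi2 (by simpa using h)

end ChoiceFunctions

section SaturatedCount

open Finset
open scoped Classical

variable {V : Type*}

/-- There are no vertices `a, b, c, d` in `G` spanning a copy of `H_{s,t}` with sides
`{a i} ∪ {c j}` and `{b i} ∪ {d j}`. -/
def HFree (G : SimpleGraph V) (s t : ℕ) : Prop :=
  ∀ (a b : Fin s → V) (c d : Fin t → V), Function.Injective a → Function.Injective b →
    Function.Injective c → Function.Injective d → (∀ i j, a i ≠ c j) → (∀ i j, b i ≠ d j) →
    (∀ i, G.Adj (a i) (b i)) → (∀ j, G.Adj (c j) (d j)) → (∀ i j, G.Adj (a i) (d j)) →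
    (∀ i j, G.Adj (b i) (c j)) → False

variable [Fintype V]

/-- The set of common neighbours of two vertices. -/
noncomputable def commonNbrs (G : SimpleGraph V) (a c : V) : Finset V :=
  {x | G.Adj a x ∧ G.Adj c x}

/-- The neighbours shared by all vertices in a tuple. -/
noncomputable def tupleNbrs (G : SimpleGraph V) {s : ℕ} (a : Fin s → V) : Finset V :=
  {x | ∀ i, G.Adj (a i) x}

/-- The neighbours of `c` shared by all vertices in a tuple. -/
noncomputable def tupleNbrsWith (G : SimpleGraph V) {s : ℕ} (a : Fin s → V) (c : V) : Finset V :=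
  {x | G.Adj c x ∧ ∀ i, G.Adj (a i) x}

/-- Vertices with many common neighbours with the tuple `a`, and few with each of its members. -/
noncomputable def satVertices (G : SimpleGraph V) (T z : ℕ) {s : ℕ} (a : Fin s → V) : Finset V :=
  {c | (∀ i, a i ≠ c ∧ #(commonNbrs G (a i) c) ≤ z) ∧ T ≤ #(tupleNbrsWith G a c)}

theorem card_satVertices_adj_le {G : SimpleGraph V} {s t T z : ℕ} (hH : HFree G s t)
    (hT : s + t ≤ T) {a b : Fin s → V} (ha : Function.Injective a) (hb : Function.Injective b)
    (hab : ∀ i, G.Adj (a i) (b i)) :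
    #{c ∈ satVertices G T z a | ∀ i, G.Adj (b i) c} ≤ t := by
  by_contra! hcon
  obtain ⟨C, hC, hCt⟩ := exists_subset_card_eq hcon.le
  let c : Fin t → V := fun j => (C.equivFinOfCardEq hCt).symm j
  have hcinj : Function.Injective c := fun i j h => by simpa [c, Subtype.ext_iff] using h
  have hc : ∀ j, c j ∈ {c ∈ satVertices G T z a | ∀ i, G.Adj (b i) c} := fun j =>
    hC ((C.equivFinOfCardEq hCt).symm j).2
  simp only [satVertices, mem_filter, mem_univ, true_and] at hc
  obtain ⟨d, hd, hdS⟩ := exists_injective_choice t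
    (fun j => tupleNbrsWith G a (c j) \ univ.image b) (fun j => by
      have h1 := le_card_sdiff (univ.image b) (tupleNbrsWith G a (c j))
      have h2 : #(univ.image b) ≤ s := card_image_le.trans (by simp)
      have h3 := (hc j).1.2
      omega)
  simp only [Finset.mem_sdiff, tupleNbrsWith, mem_filter, mem_univ, true_and, mem_image,
    not_exists] at hdS
  exact hH a b c d ha hb hcinj hd (fun i j => ((hc j).1.1 i).1) (fun i j => (hdS j).2 i) hab
    (fun j => (hdS j).1.1) (fun i j => (hdS j).1.2 i) (fun i j => (hc j).2 i)

theorem sum_satVertices_prod_le {G : SimpleGraph V} {s t T z : ℕ} (hH : HFree G s t)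
    (hT : s + t ≤ T) (hT2 : 2 * s ^ 2 ≤ T) {a : Fin s → V} (ha : Function.Injective a)
    (S : V → Fin s → Finset V) (R : Fin s → Finset V)
    (hS : ∀ c ∈ satVertices G T z a, ∀ i, T ≤ #(S c i))
    (hSadj : ∀ c i x, x ∈ S c i → G.Adj (a i) x ∧ G.Adj c x ∧ x ∈ R i) :
    ∑ c ∈ satVertices G T z a, ∏ i, #(S c i) ≤ 2 * t * ∏ i, #(R i) := by
  calc ∑ c ∈ satVertices G T z a, ∏ i, #(S c i)
      ≤ ∑ c ∈ satVertices G T z a,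
          2 * #{e ∈ Fintype.piFinset (S c) | Function.Injective e} := by
        refine sum_le_sum fun c hc => ?_
        rw [← Fintype.card_piFinset]
        exact card_pi_le_two_mul_injective _ fun i => by simpa using hT2.trans (hS c hc i)
    _ = 2 * #((satVertices G T z a).sigma
          fun c => {e ∈ Fintype.piFinset (S c) | Function.Injective e}) := by
        rw [card_sigma, mul_sum]
    _ ≤ 2 * #(({e ∈ Fintype.piFinset R | Function.Injective e ∧
          ∀ i, G.Adj (a i) (e i)}).sigma
          fun b => {c ∈ satVertices G T z a | ∀ i, G.Adj (b i) c}) := by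
        refine Nat.mul_le_mul_left _ (Finset.card_le_card_of_injOn
          (fun p => (⟨p.2, p.1⟩ : (_ : Fin s → V) × V)) ?_ ?_)
        · rintro ⟨c, e⟩ hp
          simp only [coe_sigma, Set.mem_sigma_iff, mem_coe, mem_filter,
            Fintype.mem_piFinset] at hp ⊢
          exact ⟨⟨fun i => (hSadj c i _ (hp.2.1 i)).2.2, hp.2.2,
            fun i => (hSadj c i _ (hp.2.1 i)).1⟩, hp.1,
            fun i => (hSadj c i _ (hp.2.1 i)).2.1.symm⟩
        · rintro ⟨c, e⟩ - ⟨c', e'⟩ - h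
          simp only [Sigma.mk.injEq, heq_eq_eq] at h
          obtain ⟨rfl, rfl⟩ := h
          rfl
    _ ≤ 2 * ∑ b ∈ ({e ∈ Fintype.piFinset R | Function.Injective e ∧
          ∀ i, G.Adj (a i) (e i)}), t := by
        rw [card_sigma]
        refine Nat.mul_le_mul_left _ (sum_le_sum fun b hb => ?_)
        simp only [mem_filter] at hb
        exact card_satVertices_adj_le hH hT ha hb.2.1 hb.2.2
    _ ≤ 2 * t * ∏ i, #(R i) := by
        rw [sum_const, smul_eq_mul, ← Fintype.card_piFinset, mul_assoc]
        refine Nat.mul_le_mul_left _ ?_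
        rw [mul_comm]
        exact Nat.mul_le_mul_left _ (card_le_card (filter_subset _ _))

theorem sum_satVertices_le {G : SimpleGraph V} {s t T z k : ℕ} (hs : 1 ≤ s) (hH : HFree G s t)
    (hT : s + t ≤ T) (hT2 : 2 * s ^ 2 ≤ T) (hk : ∀ v, #{x | G.Adj v x} ≤ k)
    {a : Fin s → V} (ha : Function.Injective a) :
    ∑ c ∈ satVertices G T z a, #(tupleNbrsWith G a c) * ∏ i, #(commonNbrs G (a i) c) ≤
      4 * t * z * k ^ (s - 1) * #(tupleNbrs G a) := by
  obtain ⟨p, rfl⟩ : ∃ p, s = p + 1 := ⟨s - 1, by omega⟩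
  simp only [Nat.add_sub_cancel]
  have hnc : ∀ c i, tupleNbrsWith G a c ⊆ commonNbrs G (a i) c := fun c i x hx => by
    simp only [tupleNbrsWith, commonNbrs, mem_filter, mem_univ, true_and] at hx ⊢
    exact ⟨hx.2 i, hx.1⟩
  have hnt : ∀ c, tupleNbrsWith G a c ⊆ tupleNbrs G a := fun c x hx => by
    simp only [tupleNbrsWith, tupleNbrs, mem_filter, mem_univ, true_and] at hx ⊢
    exact hx.2
  have hg := sum_satVertices_prod_le (z := z) hH hT hT2 ha (fun c i => commonNbrs G (a i) c)
    (fun i => {x | G.Adj (a i) x})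
    (fun c hc i => by
      simp only [satVertices, mem_filter] at hc
      exact hc.2.2.trans (card_le_card (hnc c i)))
    (fun c i x hx => by
      simp only [commonNbrs, mem_filter, mem_univ, true_and] at hx ⊢
      exact ⟨hx.1, hx.2, hx.1⟩)
  have hn := sum_satVertices_prod_le (z := z) hH hT hT2 ha (fun c _ => tupleNbrsWith G a c)
    (fun _ => tupleNbrs G a)
    (fun c hc i => by
      simp only [satVertices, mem_filter] at hc
      exact hc.2.2)
    (fun c i x hx => by
      refine ⟨?_, ?_, hnt c hx⟩ <;>
      simp only [tupleNbrsWith, mem_filter, mem_univ, true_and] at hx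
      exacts [hx.2 i, hx.1])
  have hkp : ∏ i, #({x | G.Adj (a i) x} : Finset V) ≤ k ^ (p + 1) :=
    (prod_le_prod' fun i _ => hk (a i)).trans (by simp)
  simp only [prod_const, card_univ, Fintype.card_fin] at hn
  set B := #(tupleNbrs G a) with hB
  rcases Nat.eq_zero_or_pos B with hB0 | hB0
  · rw [sum_eq_zero]
    · exact Nat.zero_le _
    · intro c _
      have := card_le_card (hnt c)
      rw [← hB, hB0] at this
      simp [Nat.le_zero.1 this]
  have hBk : B ≤ k := (card_le_card fun x hx => by
    simp only [tupleNbrs, mem_filter, mem_univ, true_and] at hx ⊢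
    exact hx 0).trans (hk (a 0))
  have hk0 : 0 < k := hB0.trans_le hBk
  have hpt : ∀ c ∈ satVertices G T z a,
      k * B ^ p * (#(tupleNbrsWith G a c) * ∏ i, #(commonNbrs G (a i) c)) ≤
        z * (k ^ (p + 1) * #(tupleNbrsWith G a c) ^ (p + 1) +
          B ^ (p + 1) * ∏ i, #(commonNbrs G (a i) c)) := by
    intro c hc
    simp only [satVertices, mem_filter] at hc
    have hgz : ∏ i, #(commonNbrs G (a i) c) ≤ z ^ (p + 1) :=
      (prod_le_prod' fun i _ => (hc.2.1 i).2).trans (by simp)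
    set g := ∏ i, #(commonNbrs G (a i) c)
    set n := #(tupleNbrsWith G a c)
    rcases le_total (n * k) (z * B) with h | h
    · calc k * B ^ p * (n * g) = (n * k) * (B ^ p * g) := by ring
        _ ≤ (z * B) * (B ^ p * g) := Nat.mul_le_mul_right _ h
        _ = z * (B ^ (p + 1) * g) := by ring
        _ ≤ _ := Nat.mul_le_mul_left _ (Nat.le_add_left _ _)
    · calc k * B ^ p * (n * g) ≤ k * B ^ p * (n * z ^ (p + 1)) := by gcongr
        _ = z * (n * k) * (z * B) ^ p := by ring
        _ ≤ z * (n * k) * (n * k) ^ p := by gcongr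
        _ = z * (k ^ (p + 1) * n ^ (p + 1)) := by ring
        _ ≤ _ := Nat.mul_le_mul_left _ (Nat.le_add_right _ _)
  have hsum := sum_le_sum hpt
  rw [← mul_sum, ← mul_sum, sum_add_distrib, ← mul_sum, ← mul_sum] at hsum
  have hfin : k * B ^ p *
      ∑ c ∈ satVertices G T z a, #(tupleNbrsWith G a c) * ∏ i, #(commonNbrs G (a i) c) ≤
      k * B ^ p * (4 * t * z * k ^ p * B) := by
    refine hsum.trans ?_
    calc _ ≤ z * (k ^ (p + 1) * (2 * t * B ^ (p + 1)) +
          B ^ (p + 1) * (2 * t * k ^ (p + 1))) := by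
          refine Nat.mul_le_mul_left _ (Nat.add_le_add (Nat.mul_le_mul_left _ hn)
            (Nat.mul_le_mul_left _ (hg.trans (Nat.mul_le_mul_left _ hkp))))
      _ = _ := by ring
  exact Nat.le_of_mul_le_mul_left hfin (by positivity)

theorem sum_card_tupleNbrs (G : SimpleGraph V) (s : ℕ) :
    ∑ a : Fin s → V, #(tupleNbrs G a) = ∑ x : V, #{y | G.Adj x y} ^ s := by
  simp only [tupleNbrs, card_filter]
  rw [sum_comm]
  refine sum_congr rfl fun x _ => ?_
  have h1 : #{y | G.Adj x y} ^ s = #(Fintype.piFinset fun _ : Fin s => {y | G.Adj x y}) := by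
    simp
  rw [← card_filter, ← card_filter, h1]
  congr 1
  ext a
  simp [Fintype.mem_piFinset, G.adj_comm]

theorem sum_card_tupleNbrs_le {G : SimpleGraph V} {s k : ℕ} (hk : ∀ v, #{x | G.Adj v x} ≤ k) :
    ∑ a : Fin s → V, #(tupleNbrs G a) ≤ Fintype.card V * k ^ s := by
  rw [sum_card_tupleNbrs]
  calc _ ≤ ∑ x : V, k ^ s := sum_le_sum fun x _ => Nat.pow_le_pow_left (hk x) s
    _ = _ := by simp

end SaturatedCount

section FourCycles

open Finset
open scoped Classical

variable {V : Type*} [Fintype V]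

/-- Ordered pairs of adjacent vertices. -/
noncomputable def dartSet (G : SimpleGraph V) : Finset (V × V) := {e | G.Adj e.1 e.2}

/-- Distinct vertices with few common neighbours. -/
def LightPair (G : SimpleGraph V) (z : ℕ) (a c : V) : Prop :=
  a ≠ c ∧ #(commonNbrs G a c) ≤ z

/-- The darts `(a, b)` completing the dart `(c, d)` to a four-cycle both of whose diagonals are
light. -/
noncomputable def lightPartners (G : SimpleGraph V) (z : ℕ) (f : V × V) : Finset (V × V) :=
  {e | G.Adj e.1 e.2 ∧ G.Adj e.1 f.2 ∧ G.Adj e.2 f.1 ∧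
    LightPair G z e.1 f.1 ∧ LightPair G z e.2 f.2}

/-- The four-cycles `c d a b` with a condition on the diagonal `(a, c)`. -/
noncomputable def fourCycles (G : SimpleGraph V) (Q : V → V → Prop) :
    Finset ((V × V) × (V × V)) :=
  {x | (G.Adj x.1.1 x.1.2 ∧ G.Adj x.2.1 x.2.2 ∧ G.Adj x.2.1 x.1.2 ∧ G.Adj x.2.2 x.1.1) ∧
    Q x.2.1 x.1.1}

theorem card_fourCycles (G : SimpleGraph V) (Q : V → V → Prop) :
    #(fourCycles G Q) = ∑ p : V × V with Q p.1 p.2, #(commonNbrs G p.1 p.2) ^ 2 := by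
  have h : ∑ p : V × V with Q p.1 p.2, #(commonNbrs G p.1 p.2) ^ 2 =
      #(({p : V × V | Q p.1 p.2} : Finset (V × V)).sigma
        fun p => commonNbrs G p.1 p.2 ×ˢ commonNbrs G p.1 p.2) := by
    simp [card_sigma, sq]
  rw [h]
  refine Finset.card_nbij' (fun x => ⟨(x.2.1, x.1.1), (x.2.2, x.1.2)⟩)
    (fun y => ((y.1.2, y.2.2), (y.1.1, y.2.1))) ?_ ?_ ?_ ?_
  · rintro ⟨⟨c, d⟩, ⟨a, b⟩⟩ hx
    simp only [fourCycles, commonNbrs, coe_filter, mem_univ, true_and, Set.mem_ofPred_eq, coe_sigma,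
      Set.mem_sigma_iff, coe_product, Set.mem_prod] at hx ⊢
    exact ⟨hx.2, ⟨hx.1.2.1, hx.1.2.2.2.symm⟩, ⟨hx.1.2.2.1, hx.1.1⟩⟩
  · rintro ⟨⟨a, c⟩, ⟨b, d⟩⟩ hx
    simp only [fourCycles, commonNbrs, coe_filter, mem_univ, true_and, Set.mem_ofPred_eq, coe_sigma,
      Set.mem_sigma_iff, coe_product, Set.mem_prod] at hx ⊢
    exact ⟨⟨hx.2.2.2, hx.2.1.1, hx.2.2.1, hx.2.1.2.symm⟩, hx.1⟩
  · rintro ⟨⟨c, d⟩, ⟨a, b⟩⟩ _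
    rfl
  · rintro ⟨⟨a, c⟩, ⟨b, d⟩⟩ _
    rfl

theorem card_dartSet (G : SimpleGraph V) : #(dartSet G) = ∑ x : V, #{y | G.Adj x y} := by
  simp only [dartSet, card_filter]
  rw [← Finset.univ_product_univ, sum_product]

theorem sum_card_commonNbrs (G : SimpleGraph V) :
    ∑ p : V × V, #(commonNbrs G p.1 p.2) = ∑ x : V, #{y | G.Adj x y} ^ 2 := by
  simp only [commonNbrs, card_filter]
  rw [sum_comm]
  refine sum_congr rfl fun x _ => ?_
  rw [sq, sum_mul_sum, ← sum_product', Finset.univ_product_univ]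
  refine sum_congr rfl fun p _ => ?_
  rw [G.adj_comm p.1, G.adj_comm p.2]
  by_cases h1 : G.Adj x p.1 <;> by_cases h2 : G.Adj x p.2 <;> simp [h1, h2]

theorem card_dartSet_pow_four_le (G : SimpleGraph V) :
    #(dartSet G) ^ 4 ≤ Fintype.card V ^ 4 * #(fourCycles G fun _ _ => True) := by
  have h1 : #(dartSet G) ^ 2 ≤ Fintype.card V * ∑ x : V, #{y | G.Adj x y} ^ 2 := by
    rw [card_dartSet]
    exact sq_sum_le_card_mul_sum_sq
  have h2 : (∑ p : V × V, #(commonNbrs G p.1 p.2)) ^ 2 ≤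
      Fintype.card V ^ 2 * #(fourCycles G fun _ _ => True) := by
    rw [card_fourCycles]
    refine sq_sum_le_card_mul_sum_sq.trans (le_of_eq ?_)
    simp [sq]
  rw [sum_card_commonNbrs] at h2
  calc #(dartSet G) ^ 4 = (#(dartSet G) ^ 2) ^ 2 := by ring
    _ ≤ (Fintype.card V * ∑ x : V, #{y | G.Adj x y} ^ 2) ^ 2 := Nat.pow_le_pow_left h1 2
    _ = Fintype.card V ^ 2 * (∑ x : V, #{y | G.Adj x y} ^ 2) ^ 2 := by ring
    _ ≤ Fintype.card V ^ 2 * (Fintype.card V ^ 2 * #(fourCycles G fun _ _ => True)) :=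
        Nat.mul_le_mul_left _ h2
    _ = _ := by ring

theorem card_dartSet_pow_le_sum_lightPartners (G : SimpleGraph V) (z : ℕ)
    (hheavy : 4 * Fintype.card V ^ 4 *
      ∑ p : V × V with ¬ LightPair G z p.1 p.2, #(commonNbrs G p.1 p.2) ^ 2 ≤ #(dartSet G) ^ 4) :
    #(dartSet G) ^ 4 ≤ 2 * Fintype.card V ^ 4 * ∑ f ∈ dartSet G, #(lightPartners G z f) := by
  have h0 := card_dartSet_pow_four_le G
  set bad := fourCycles G fun a c => ¬ LightPair G z a c with hbad
  replace hheavy : 4 * Fintype.card V ^ 4 * #bad ≤ #(dartSet G) ^ 4 := by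
    rw [hbad, card_fourCycles]
    convert hheavy
  have hcover : fourCycles G (fun _ _ => True) ⊆
      (((dartSet G).sigma fun f => lightPartners G z f).image fun x => (x.1, x.2)) ∪
        (bad ∪ bad.image fun x => (x.1.swap, x.2.swap)) := by
    rintro ⟨⟨c, d⟩, ⟨a, b⟩⟩ hx
    simp only [fourCycles, mem_filter, mem_univ, true_and, and_true] at hx
    obtain ⟨h1, h2, h3, h4⟩ := hx
    simp only [mem_union, mem_image, hbad, fourCycles, mem_filter, mem_univ, true_and, mem_sigma,
      dartSet, lightPartners]
    by_cases hac : LightPair G z a c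
    · by_cases hbd : LightPair G z b d
      · exact Or.inl ⟨⟨(c, d), (a, b)⟩, ⟨h1, h2, h3, h4, hac, hbd⟩, rfl⟩
      · exact Or.inr (Or.inr ⟨((d, c), (b, a)), ⟨⟨h1.symm, h2.symm, h4, h3⟩, hbd⟩, rfl⟩)
    · exact Or.inr (Or.inl ⟨⟨h1, h2, h3, h4⟩, hac⟩)
  have h1 : #(fourCycles G fun _ _ => True) ≤
      ∑ f ∈ dartSet G, #(lightPartners G z f) + 2 * #bad := by
    refine (card_le_card hcover).trans ((card_union_le _ _).trans ?_)
    refine Nat.add_le_add (card_image_le.trans (card_sigma _ _).le) ?_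
    refine (card_union_le _ _).trans ?_
    have := card_image_le (s := bad) (f := fun x => (x.1.swap, x.2.swap))
    omega
  have h2 := Nat.mul_le_mul_left (Fintype.card V ^ 4) h1
  nlinarith

theorem card_dartSet_pow_le_sum_pow (G : SimpleGraph V) {z s : ℕ} (hs : 1 ≤ s)
    (hheavy : 4 * Fintype.card V ^ 4 *
      ∑ p : V × V with ¬ LightPair G z p.1 p.2, #(commonNbrs G p.1 p.2) ^ 2 ≤ #(dartSet G) ^ 4)
    (hpos : 0 < #(dartSet G)) :
    #(dartSet G) ^ (3 * s + 1) ≤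
      2 ^ s * Fintype.card V ^ (4 * s) * ∑ f ∈ dartSet G, #(lightPartners G z f) ^ s := by
  obtain ⟨p, rfl⟩ : ∃ p, s = p + 1 := ⟨s - 1, by omega⟩
  have h := card_dartSet_pow_le_sum_lightPartners G z hheavy
  have hpm : (∑ f ∈ dartSet G, #(lightPartners G z f)) ^ (p + 1) ≤
      #(dartSet G) ^ p * ∑ f ∈ dartSet G, #(lightPartners G z f) ^ (p + 1) := by
    have := pow_sum_div_card_le_sum_pow (s := dartSet G)
      (f := fun f => (#(lightPartners G z f) : ℝ)) (fun _ _ => by positivity) p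
    rw [div_le_iff₀ (by positivity)] at this
    rw [mul_comm]
    exact_mod_cast this
  have h2 : #(dartSet G) ^ p * #(dartSet G) ^ (3 * (p + 1) + 1) ≤ #(dartSet G) ^ p *
      (2 ^ (p + 1) * Fintype.card V ^ (4 * (p + 1)) *
        ∑ f ∈ dartSet G, #(lightPartners G z f) ^ (p + 1)) := by
    calc #(dartSet G) ^ p * #(dartSet G) ^ (3 * (p + 1) + 1) = (#(dartSet G) ^ 4) ^ (p + 1) := by
          ring
      _ ≤ (2 * Fintype.card V ^ 4 * ∑ f ∈ dartSet G, #(lightPartners G z f)) ^ (p + 1) :=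
          Nat.pow_le_pow_left h _
      _ = 2 ^ (p + 1) * Fintype.card V ^ (4 * (p + 1)) *
          (∑ f ∈ dartSet G, #(lightPartners G z f)) ^ (p + 1) := by
          rw [mul_pow, mul_pow, ← pow_mul]
      _ ≤ 2 ^ (p + 1) * Fintype.card V ^ (4 * (p + 1)) *
          (#(dartSet G) ^ p * ∑ f ∈ dartSet G, #(lightPartners G z f) ^ (p + 1)) :=
          Nat.mul_le_mul_left _ hpm
      _ = _ := by ring
  exact Nat.le_of_mul_le_mul_left h2 (by positivity)

end FourCycles

section Configurations

open Finset
open scoped Classical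

variable {V : Type*} [Fintype V]

/-- A dart together with `s` of its light partners. -/
noncomputable def partnerConfigs (G : SimpleGraph V) (z s : ℕ) :
    Finset ((_ : V × V) × (Fin s → V × V)) :=
  (dartSet G).sigma fun f => Fintype.piFinset fun _ => lightPartners G z f

theorem card_partnerConfigs (G : SimpleGraph V) (z s : ℕ) :
    #(partnerConfigs G z s) = ∑ f ∈ dartSet G, #(lightPartners G z f) ^ s := by
  simp [partnerConfigs, card_sigma]

theorem mem_lightPartners {G : SimpleGraph V} {z : ℕ} {f e : V × V} :
    e ∈ lightPartners G z f ↔ G.Adj e.1 e.2 ∧ G.Adj e.1 f.2 ∧ G.Adj e.2 f.1 ∧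
      LightPair G z e.1 f.1 ∧ LightPair G z e.2 f.2 := by
  simp [lightPartners]

/-- Two darts have the same first or the same second vertex. -/
def SharesEnd (x y : V × V) : Prop := x.1 = y.1 ∨ x.2 = y.2

/-- Two of the chosen partners share an endpoint. -/
def Overlapping {s : ℕ} (e : Fin s → V × V) : Prop :=
  ∃ i j, i ≠ j ∧ SharesEnd (e i) (e j)

theorem card_overlapping_mul_le (G : SimpleGraph V) (z s : ℕ) (f : V × V) :
    #{e ∈ Fintype.piFinset fun _ : Fin s => lightPartners G z f | Overlapping e} *
      #(lightPartners G z f) ≤ s ^ 2 * (2 * z) * #(lightPartners G z f) ^ s := by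
  set W := lightPartners G z f with hW
  have hfib : ∀ x ∈ W, #{y ∈ W | SharesEnd x y} ≤ 2 * z := by
    intro x hx
    rw [hW, mem_lightPartners] at hx
    have hsub : {y ∈ W | SharesEnd x y} ⊆ {y ∈ W | x.1 = y.1} ∪ {y ∈ W | x.2 = y.2} := by
      intro y hy
      rw [mem_filter] at hy
      rcases hy with ⟨hy, h | h⟩ <;> simp [hy, h]
    have h1 : #{y ∈ W | x.1 = y.1} ≤ z := by
      refine (card_le_card_of_injOn Prod.snd ?_ ?_).trans hx.2.2.2.1.2
      · intro y hy
        simp only [hW, mem_lightPartners, coe_filter, Set.mem_ofPred_eq] at hy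
        simp only [commonNbrs, coe_filter, mem_univ, true_and, Set.mem_ofPred_eq]
        exact ⟨hy.2 ▸ hy.1.1, hy.1.2.2.1.symm⟩
      · intro y hy y' hy' h
        simp only [coe_filter, Set.mem_ofPred_eq] at hy hy'
        exact Prod.ext (hy.2.symm.trans hy'.2) h
    have h2 : #{y ∈ W | x.2 = y.2} ≤ z := by
      refine (card_le_card_of_injOn Prod.fst ?_ ?_).trans hx.2.2.2.2.2
      · intro y hy
        simp only [hW, mem_lightPartners, coe_filter, Set.mem_ofPred_eq] at hy
        simp only [commonNbrs, coe_filter, mem_univ, true_and, Set.mem_ofPred_eq]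
        exact ⟨hy.2 ▸ hy.1.1.symm, hy.1.2.1.symm⟩
      · intro y hy y' hy' h
        simp only [coe_filter, Set.mem_ofPred_eq] at hy hy'
        exact Prod.ext h (hy.2.symm.trans hy'.2)
    exact (card_le_card hsub).trans ((card_union_le _ _).trans (by omega))
  have hcover : {e ∈ Fintype.piFinset fun _ : Fin s => W | Overlapping e} ⊆
      ({p : Fin s × Fin s | p.1 ≠ p.2} : Finset _).biUnion fun p =>
        {e ∈ Fintype.piFinset fun _ : Fin s => W | SharesEnd (e p.1) (e p.2)} := by
    intro e he
    rw [mem_filter] at he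
    obtain ⟨he, i, j, hne, hij⟩ := he
    simp only [mem_biUnion, mem_filter, mem_univ, true_and]
    exact ⟨(i, j), hne, he, hij⟩
  calc _ ≤ (∑ p ∈ ({p : Fin s × Fin s | p.1 ≠ p.2} : Finset _),
        #{e ∈ Fintype.piFinset fun _ : Fin s => W | SharesEnd (e p.1) (e p.2)}) * #W :=
        Nat.mul_le_mul_right _ ((card_le_card hcover).trans card_biUnion_le)
    _ ≤ ∑ p ∈ ({p : Fin s × Fin s | p.1 ≠ p.2} : Finset _), 2 * z * #W ^ s := by
        rw [sum_mul]
        refine sum_le_sum fun p hp => ?_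
        have := card_pi_rel_mul_le (fun _ : Fin s => W) (by simpa using hp : p.1 ≠ p.2)
          SharesEnd (2 * z) hfib
        simpa using this
    _ ≤ _ := by
        rw [sum_const, smul_eq_mul, mul_assoc (s ^ 2)]
        refine Nat.mul_le_mul_right _ ((card_le_univ _).trans ?_)
        simp [sq]

theorem card_overlapping_le (G : SimpleGraph V) {z s : ℕ} (hs : 1 ≤ s) (hz : 1 ≤ z) (f : V × V) :
    8 * #{e ∈ Fintype.piFinset fun _ : Fin s => lightPartners G z f | Overlapping e} ≤
      #(lightPartners G z f) ^ s + 8 * (16 * s ^ 2 * z) ^ s := by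
  have h := card_overlapping_mul_le G z s f
  have htot : #{e ∈ Fintype.piFinset fun _ : Fin s => lightPartners G z f | Overlapping e} ≤
      #(lightPartners G z f) ^ s := (card_le_card (filter_subset _ _)).trans (by simp)
  set B := #(lightPartners G z f)
  set D := #{e ∈ Fintype.piFinset fun _ : Fin s => lightPartners G z f | Overlapping e}
  rcases le_total (16 * s ^ 2 * z) B with hB | hB
  · have hpos : 0 < 16 * s ^ 2 * z := by positivity
    have : 8 * D * B ≤ B ^ s * B := by
      calc 8 * D * B = 8 * (D * B) := by ring
        _ ≤ 8 * (s ^ 2 * (2 * z) * B ^ s) := Nat.mul_le_mul_left _ h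
        _ = B ^ s * (16 * s ^ 2 * z) := by ring
        _ ≤ B ^ s * B := Nat.mul_le_mul_left _ hB
    exact (Nat.le_of_mul_le_mul_right this (hpos.trans_le hB)).trans (Nat.le_add_right _ _)
  · have := Nat.pow_le_pow_left hB s
    omega

/-- Tuples `a`, saturated vertices `c`, a common neighbour `d`, and neighbours `b i` of `a i`
and `c`. -/
noncomputable def satConfigs (G : SimpleGraph V) (T z s : ℕ) :
    Finset ((_ : Fin s → V) × (_ : V) × (V × (Fin s → V))) :=
  ({a | Function.Injective a} : Finset (Fin s → V)).sigma fun a =>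
    (satVertices G T z a).sigma fun c =>
      tupleNbrsWith G a c ×ˢ Fintype.piFinset fun i => commonNbrs G (a i) c

theorem card_satConfigs_le {G : SimpleGraph V} {s t T z k : ℕ} (hs : 1 ≤ s) (hH : HFree G s t)
    (hT : s + t ≤ T) (hT2 : 2 * s ^ 2 ≤ T) (hk : ∀ v, #{x | G.Adj v x} ≤ k) :
    #(satConfigs G T z s) ≤ 4 * t * z * k ^ (2 * s - 1) * Fintype.card V := by
  simp only [satConfigs, card_sigma, card_product, Fintype.card_piFinset]
  calc _ ≤ ∑ a ∈ ({a | Function.Injective a} : Finset (Fin s → V)),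
        4 * t * z * k ^ (s - 1) * #(tupleNbrs G a) :=
        sum_le_sum fun a ha => sum_satVertices_le hs hH hT hT2 hk (by simpa using ha)
    _ ≤ ∑ a : Fin s → V, 4 * t * z * k ^ (s - 1) * #(tupleNbrs G a) :=
        sum_le_sum_of_subset (subset_univ _)
    _ ≤ 4 * t * z * k ^ (s - 1) * (Fintype.card V * k ^ s) := by
        rw [← mul_sum]
        exact Nat.mul_le_mul_left _ (sum_card_tupleNbrs_le hk)
    _ = _ := by
        have : 2 * s - 1 = (s - 1) + s := by omega
        rw [this, pow_add]
        ring

theorem card_dart_saturated_le (G : SimpleGraph V) (T z s : ℕ) :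
    #{x ∈ partnerConfigs G z s | Function.Injective (fun i => (x.2 i).1) ∧
      T ≤ #(tupleNbrsWith G (fun i => (x.2 i).1) x.1.1)} ≤ #(satConfigs G T z s) := by
  refine card_le_card_of_injOn (fun x => ⟨fun i => (x.2 i).1, x.1.1, x.1.2, fun i => (x.2 i).2⟩)
    ?_ ?_
  · rintro ⟨⟨c, d⟩, e⟩ hx
    simp only [partnerConfigs, dartSet, coe_filter, mem_sigma, mem_filter, mem_lightPartners,
      mem_univ, true_and, Fintype.mem_piFinset, Set.mem_ofPred_eq] at hx
    obtain ⟨⟨hcd, he⟩, hinj, hT⟩ := hx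
    simp only [satConfigs, satVertices, mem_coe, mem_sigma, mem_filter, mem_univ, true_and,
      mem_product, Fintype.mem_piFinset]
    refine ⟨hinj, ⟨fun i => (he i).2.2.2.1, hT⟩, ?_, fun i => ?_⟩
    · simp only [tupleNbrsWith, mem_filter, mem_univ, true_and]
      exact ⟨hcd, fun i => (he i).2.1⟩
    · simp only [commonNbrs, mem_filter, mem_univ, true_and]
      exact ⟨(he i).1, (he i).2.2.1.symm⟩
  · rintro ⟨⟨c, d⟩, e⟩ - ⟨⟨c', d'⟩, e'⟩ - h
    simp only [Sigma.mk.injEq, heq_eq_eq, Prod.mk.injEq] at h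
    obtain ⟨h1, rfl, rfl, h2⟩ := h
    obtain rfl : e = e' := funext fun i => Prod.ext (congrFun h1 i) (congrFun h2 i)
    rfl

theorem card_dart_saturated_swap_le (G : SimpleGraph V) (T z s : ℕ) :
    #{x ∈ partnerConfigs G z s | Function.Injective (fun i => (x.2 i).2) ∧
      T ≤ #(tupleNbrsWith G (fun i => (x.2 i).2) x.1.2)} ≤ #(satConfigs G T z s) := by
  refine card_le_card_of_injOn (fun x => ⟨fun i => (x.2 i).2, x.1.2, x.1.1, fun i => (x.2 i).1⟩)
    ?_ ?_
  · rintro ⟨⟨c, d⟩, e⟩ hx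
    simp only [partnerConfigs, dartSet, coe_filter, mem_sigma, mem_filter, mem_lightPartners,
      mem_univ, true_and, Fintype.mem_piFinset, Set.mem_ofPred_eq] at hx
    obtain ⟨⟨hcd, he⟩, hinj, hT⟩ := hx
    simp only [satConfigs, satVertices, mem_coe, mem_sigma, mem_filter, mem_univ, true_and,
      mem_product, Fintype.mem_piFinset]
    refine ⟨hinj, ⟨fun i => (he i).2.2.2.2, hT⟩, ?_, fun i => ?_⟩
    · simp only [tupleNbrsWith, mem_filter, mem_univ, true_and]
      exact ⟨hcd.symm, fun i => (he i).2.2.1⟩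
    · simp only [commonNbrs, mem_filter, mem_univ, true_and]
      exact ⟨(he i).1.symm, (he i).2.1.symm⟩
  · rintro ⟨⟨c, d⟩, e⟩ - ⟨⟨c', d'⟩, e'⟩ - h
    simp only [Sigma.mk.injEq, heq_eq_eq, Prod.mk.injEq] at h
    obtain ⟨h1, rfl, rfl, h2⟩ := h
    obtain rfl : e = e' := funext fun i => Prod.ext (congrFun h2 i) (congrFun h1 i)
    rfl

/-- The configurations without overlaps and without saturation. -/
def Sparse (G : SimpleGraph V) (T : ℕ) {s : ℕ} (f : V × V) (e : Fin s → V × V) : Prop :=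
  ¬ Overlapping e ∧ #(tupleNbrsWith G (fun i => (e i).1) f.1) ≤ T ∧
    #(tupleNbrsWith G (fun i => (e i).2) f.2) ≤ T

theorem card_sparse_le {G : SimpleGraph V} {s t : ℕ} (hH : HFree G s t) (T z : ℕ) :
    #{x ∈ partnerConfigs G z s | Sparse G T x.1 x.2} ≤ 2 * t * T * #(dartSet G) ^ s := by
  have hfib : ∀ e ∈ Fintype.piFinset fun _ : Fin s => dartSet G,
      #{f ∈ dartSet G | (∀ i, e i ∈ lightPartners G z f) ∧ Sparse G T f e} ≤ 2 * t * T := by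
    intro e he
    by_contra! hcon
    set Q := {f ∈ dartSet G | (∀ i, e i ∈ lightPartners G z f) ∧ Sparse G T f e} with hQ
    have hmem : ∀ f ∈ Q, G.Adj f.1 f.2 ∧ (∀ i, G.Adj (e i).1 (e i).2 ∧ G.Adj (e i).1 f.2 ∧
        G.Adj (e i).2 f.1 ∧ LightPair G z (e i).1 f.1 ∧ LightPair G z (e i).2 f.2) ∧
        Sparse G T f e := by
      intro f hf
      simpa only [hQ, dartSet, mem_lightPartners, mem_filter, mem_univ, true_and] using hf
    obtain ⟨f, hf, hf1, hf2⟩ := exists_matching_of_card_lt Q T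
      (fun c => by
        rcases ({f ∈ Q | f.1 = c}).eq_empty_or_nonempty with h | ⟨g, hg⟩
        · simp [h]
        simp only [mem_filter] at hg
        obtain ⟨hg, rfl⟩ := hg
        refine (card_le_card_of_injOn Prod.snd ?_ ?_).trans (hmem g hg).2.2.2.1
        · intro f hf
          simp only [coe_filter, Set.mem_ofPred_eq] at hf
          simp only [tupleNbrsWith, coe_filter, mem_univ, true_and, Set.mem_ofPred_eq]
          exact ⟨hf.2 ▸ (hmem f hf.1).1, fun i => ((hmem f hf.1).2.1 i).2.1⟩
        · intro f hf f' hf' h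
          simp only [coe_filter, Set.mem_ofPred_eq] at hf hf'
          exact Prod.ext (hf.2.trans hf'.2.symm) h)
      (fun d => by
        rcases ({f ∈ Q | f.2 = d}).eq_empty_or_nonempty with h | ⟨g, hg⟩
        · simp [h]
        simp only [mem_filter] at hg
        obtain ⟨hg, rfl⟩ := hg
        refine (card_le_card_of_injOn Prod.fst ?_ ?_).trans (hmem g hg).2.2.2.2
        · intro f hf
          simp only [coe_filter, Set.mem_ofPred_eq] at hf
          simp only [tupleNbrsWith, coe_filter, mem_univ, true_and, Set.mem_ofPred_eq]
          exact ⟨hf.2 ▸ (hmem f hf.1).1.symm, fun i => ((hmem f hf.1).2.1 i).2.2.1⟩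
        · intro f hf f' hf' h
          simp only [coe_filter, Set.mem_ofPred_eq] at hf hf'
          exact Prod.ext h (hf.2.trans hf'.2.symm)) t hcon
    have hne : ¬ Overlapping e := by
      have hpos : 0 < #Q := (Nat.zero_le _).trans_lt hcon
      obtain ⟨g, hg⟩ := card_pos.1 hpos
      exact (hmem g hg).2.2.1
    refine hH (fun i => (e i).1) (fun i => (e i).2) (fun j => (f j).1) (fun j => (f j).2)
      (fun i j h => by_contra fun hij => hne ⟨i, j, hij, Or.inl h⟩)
      (fun i j h => by_contra fun hij => hne ⟨i, j, hij, Or.inr h⟩) hf1 hf2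
      (fun i j => ((hmem _ (hf j)).2.1 i).2.2.2.1.1) (fun i j => ((hmem _ (hf j)).2.1 i).2.2.2.2.1)
      (fun i => ?_) (fun j => (hmem _ (hf j)).1) (fun i j => ((hmem _ (hf j)).2.1 i).2.1)
      (fun i j => ((hmem _ (hf j)).2.1 i).2.2.1)
    simpa [dartSet] using Fintype.mem_piFinset.1 he i
  calc _ ≤ #((Fintype.piFinset fun _ : Fin s => dartSet G).sigma fun e =>
        {f ∈ dartSet G | (∀ i, e i ∈ lightPartners G z f) ∧ Sparse G T f e}) := by
        refine card_le_card_of_injOn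
          (fun x => (⟨x.2, x.1⟩ : (_ : Fin s → V × V) × (V × V))) ?_ ?_
        · rintro ⟨f, e⟩ hx
          simp only [partnerConfigs, coe_filter, mem_sigma, Fintype.mem_piFinset,
            Set.mem_ofPred_eq] at hx
          simp only [mem_coe, mem_sigma, Fintype.mem_piFinset, mem_filter]
          refine ⟨fun i => ?_, hx.1.1, hx.1.2, hx.2⟩
          have := hx.1.2 i
          simp only [lightPartners, mem_filter] at this
          simpa [dartSet] using this.2.1
        · rintro ⟨f, e⟩ - ⟨f', e'⟩ - h
          simp only [Sigma.mk.injEq, heq_eq_eq] at h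
          obtain ⟨rfl, rfl⟩ := h
          rfl
    _ ≤ ∑ e ∈ Fintype.piFinset fun _ : Fin s => dartSet G, 2 * t * T := by
        rw [card_sigma]
        exact sum_le_sum hfib
    _ = _ := by simp [mul_comm]

/-- The counting core: a graph with controlled degrees, enough edges, and few heavy codegrees
contains the forbidden configuration. -/
theorem not_HFree_of_counts {G : SimpleGraph V} {s t T z k : ℕ} (hs : 1 ≤ s) (hz : 1 ≤ z)
    (hT : s + t ≤ T) (hT2 : 2 * s ^ 2 ≤ T) (hk : ∀ v, #{x | G.Adj v x} ≤ k)
    (hpos : 0 < #(dartSet G))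
    (hheavy : 4 * Fintype.card V ^ 4 *
      ∑ p : V × V with ¬ LightPair G z p.1 p.2, #(commonNbrs G p.1 p.2) ^ 2 ≤ #(dartSet G) ^ 4)
    (hD : 256 * s ^ 2 * z * Fintype.card V ^ 4 ≤ #(dartSet G) ^ 3)
    (hS : 2 ^ s * (32 * t * z * k ^ (2 * s - 1) * Fintype.card V ^ (4 * s + 1)) ≤
      #(dartSet G) ^ (3 * s + 1))
    (hR : 2 ^ s * (16 * t * T * Fintype.card V ^ (4 * s)) ≤ #(dartSet G) ^ (2 * s + 1)) :
    ¬ HFree G s t := by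
  intro hH
  have hN := card_dartSet_pow_le_sum_pow G hs hheavy hpos
  rw [← card_partnerConfigs] at hN
  set 𝒩 := #(partnerConfigs G z s) with h𝒩
  set m := Fintype.card V with hm
  set E := #(dartSet G) with hE
  have hm0 : 0 < 2 ^ s * m ^ (4 * s) := by
    have : 0 < m := by
      obtain ⟨x, _⟩ := card_pos.1 hpos
      exact Fintype.card_pos_iff.2 ⟨x.1⟩
    positivity
  have hN0 : 0 < 𝒩 := by
    by_contra! h
    rw [Nat.le_zero.1 h] at hN
    have : 0 < E ^ (3 * s + 1) := by positivity
    omega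
  have hDeg : 8 * #{x ∈ partnerConfigs G z s | Overlapping x.2} ≤ 2 * 𝒩 := by
    have h1 : #{x ∈ partnerConfigs G z s | Overlapping x.2} = ∑ f ∈ dartSet G,
        #{e ∈ Fintype.piFinset fun _ : Fin s => lightPartners G z f | Overlapping e} := by
      rw [← card_sigma]
      congr 1
      ext ⟨f, e⟩
      simp [partnerConfigs, and_assoc]
    have h2 : 8 * #{x ∈ partnerConfigs G z s | Overlapping x.2} ≤
        𝒩 + E * (8 * (16 * s ^ 2 * z) ^ s) := by
      rw [h1, mul_sum, h𝒩, card_partnerConfigs]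
      refine (sum_le_sum fun f _ => card_overlapping_le G hs hz f).trans ?_
      rw [sum_add_distrib, sum_const, smul_eq_mul]
    have h3 : (2 ^ s * m ^ (4 * s)) * (E * (8 * (16 * s ^ 2 * z) ^ s)) ≤
        (2 ^ s * m ^ (4 * s)) * 𝒩 := by
      refine le_trans ?_ hN
      calc (2 ^ s * m ^ (4 * s)) * (E * (8 * (16 * s ^ 2 * z) ^ s))
          = E * (8 * (32 * s ^ 2 * z * m ^ 4) ^ s) := by
            rw [pow_mul, show 32 * s ^ 2 * z * m ^ 4 = 2 * m ^ 4 * (16 * s ^ 2 * z) by ring,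
              mul_pow (2 * m ^ 4), mul_pow 2]
            ring
        _ ≤ E * (8 ^ s * (32 * s ^ 2 * z * m ^ 4) ^ s) := by
            gcongr
            exact Nat.le_self_pow (by omega) 8
        _ = E * (256 * s ^ 2 * z * m ^ 4) ^ s := by
            rw [← mul_pow]; ring_nf
        _ ≤ E * (E ^ 3) ^ s := by gcongr
        _ = E ^ (3 * s + 1) := by rw [← pow_mul]; ring
    have := Nat.le_of_mul_le_mul_left h3 hm0
    omega
  have hSat : 8 * #(satConfigs G T z s) ≤ 𝒩 := by
    refine Nat.le_of_mul_le_mul_left ?_ hm0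
    refine le_trans ?_ (hS.trans hN)
    calc 2 ^ s * m ^ (4 * s) * (8 * #(satConfigs G T z s))
        ≤ 2 ^ s * m ^ (4 * s) * (8 * (4 * t * z * k ^ (2 * s - 1) * m)) := by
          gcongr
          exact card_satConfigs_le hs hH hT hT2 hk
      _ = _ := by ring
  have hRest : 8 * #{x ∈ partnerConfigs G z s | Sparse G T x.1 x.2} ≤ 𝒩 := by
    refine Nat.le_of_mul_le_mul_left ?_ hm0
    refine le_trans ?_ hN
    calc 2 ^ s * m ^ (4 * s) * (8 * #{x ∈ partnerConfigs G z s | Sparse G T x.1 x.2})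
        ≤ 2 ^ s * m ^ (4 * s) * (8 * (2 * t * T * E ^ s)) := by
          gcongr
          exact card_sparse_le hH T z
      _ = 2 ^ s * (16 * t * T * m ^ (4 * s)) * E ^ s := by ring
      _ ≤ E ^ (2 * s + 1) * E ^ s := by gcongr
      _ = _ := by ring
  have hcover : partnerConfigs G z s ⊆
      {x ∈ partnerConfigs G z s | Overlapping x.2} ∪
      ({x ∈ partnerConfigs G z s | Function.Injective (fun i => (x.2 i).1) ∧
        T ≤ #(tupleNbrsWith G (fun i => (x.2 i).1) x.1.1)} ∪
      ({x ∈ partnerConfigs G z s | Function.Injective (fun i => (x.2 i).2) ∧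
        T ≤ #(tupleNbrsWith G (fun i => (x.2 i).2) x.1.2)} ∪
      {x ∈ partnerConfigs G z s | Sparse G T x.1 x.2})) := by
    intro x hx
    simp only [mem_union, mem_filter, hx, true_and]
    by_cases ho : Overlapping x.2
    · exact Or.inl ho
    have i1 : Function.Injective fun i => (x.2 i).1 := fun i j h =>
      by_contra fun hij => ho ⟨i, j, hij, Or.inl h⟩
    have i2 : Function.Injective fun i => (x.2 i).2 := fun i j h =>
      by_contra fun hij => ho ⟨i, j, hij, Or.inr h⟩
    rcases le_total T #(tupleNbrsWith G (fun i => (x.2 i).1) x.1.1) with h1 | h1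
    · exact Or.inr (Or.inl ⟨i1, h1⟩)
    rcases le_total T #(tupleNbrsWith G (fun i => (x.2 i).2) x.1.2) with h2 | h2
    · exact Or.inr (Or.inr (Or.inl ⟨i2, h2⟩))
    · exact Or.inr (Or.inr (Or.inr ⟨ho, h1, h2⟩))
  have htot := (card_le_card hcover).trans ((card_union_le _ _).trans (Nat.add_le_add_left
    ((card_union_le _ _).trans (Nat.add_le_add_left (card_union_le _ _) _)) _))
  have hc := card_dart_saturated_le G T z s
  have hd := card_dart_saturated_swap_le G T z s
  omega

end Configurations

section DensityBounds

open Finset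
open scoped Classical

variable {V : Type*} [Fintype V]

theorem card_tupleNbrs_lt_of_HFree {G : SimpleGraph V} {s t : ℕ} (hH : HFree G s t)
    {x : Fin (s + t) → V} (hx : Function.Injective x) : #(tupleNbrs G x) ≤ s + t := by
  by_contra! hcon
  obtain ⟨Y, hY, hYc⟩ := exists_subset_card_eq hcon.le
  let y : Fin (s + t) → V := fun j => (Y.equivFinOfCardEq hYc).symm j
  have hy : Function.Injective y := fun i j h => by simpa [y, Subtype.ext_iff] using h
  have hxy : ∀ i j, G.Adj (x i) (y j) := fun i j => by
    have := hY ((Y.equivFinOfCardEq hYc).symm j).2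
    simp only [tupleNbrs, mem_filter, mem_univ, true_and] at this
    exact this i
  have hne : ∀ (i : Fin s) (j : Fin t), Fin.castAdd t i ≠ Fin.natAdd s j := fun i j h => by
    have := congrArg Fin.val h
    simp at this
    omega
  exact hH (fun i => x (Fin.castAdd t i)) (fun i => y (Fin.castAdd t i))
    (fun j => x (Fin.natAdd s j)) (fun j => y (Fin.natAdd s j))
    (hx.comp (Fin.castAdd_injective s t)) (hy.comp (Fin.castAdd_injective s t))
    (hx.comp (Fin.natAdd_injective t s)) (hy.comp (Fin.natAdd_injective t s))
    (fun i j h => hne i j (hx h)) (fun i j h => hne i j (hy h))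
    (fun i => hxy _ _) (fun j => hxy _ _) (fun i j => hxy _ _) (fun i j => (hxy _ _).symm)

theorem card_not_injective_mul_le (v : ℕ) :
    #{x : Fin v → V | ¬ Function.Injective x} * Fintype.card V ≤ v ^ 2 * Fintype.card V ^ v := by
  have hcover : ({x : Fin v → V | ¬ Function.Injective x} : Finset _) ⊆
      ({p : Fin v × Fin v | p.1 ≠ p.2} : Finset _).biUnion
        fun p => {e ∈ Fintype.piFinset fun _ : Fin v => (univ : Finset V) | e p.1 = e p.2} := by
    intro e he
    simp only [mem_filter, Function.Injective, not_forall] at he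
    obtain ⟨-, i, j, hij, hne⟩ := he
    simp only [mem_biUnion, mem_filter, mem_univ, true_and]
    exact ⟨(i, j), hne, by simp, hij⟩
  calc _ ≤ (∑ p ∈ ({p : Fin v × Fin v | p.1 ≠ p.2} : Finset _),
        #{e ∈ Fintype.piFinset fun _ : Fin v => (univ : Finset V) | e p.1 = e p.2}) *
          Fintype.card V := Nat.mul_le_mul_right _ ((card_le_card hcover).trans card_biUnion_le)
    _ ≤ ∑ p ∈ ({p : Fin v × Fin v | p.1 ≠ p.2} : Finset _), Fintype.card V ^ v := by
        rw [sum_mul]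
        refine sum_le_sum fun p hp => ?_
        have := card_pi_rel_mul_le (fun _ : Fin v => (univ : Finset V))
          (by simpa using hp : p.1 ≠ p.2) (fun x y => x = y) 1 (fun x _ => by
            rw [Finset.card_le_one]; intro a ha b hb
            simp only [mem_filter] at ha hb; exact ha.2.symm.trans hb.2)
        simpa using this
    _ ≤ _ := by
        rw [sum_const, smul_eq_mul]
        refine Nat.mul_le_mul_right _ ((card_le_univ _).trans ?_)
        simp [sq]

/-- A Kővári–Sós–Turán type bound. -/
theorem card_dartSet_pow_le_of_HFree {G : SimpleGraph V} {s t v : ℕ} (hv : v + 1 = s + t)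
    (hH : HFree G s t) :
    #(dartSet G) ^ (v + 1) ≤ ((v + 1) ^ 2 + (v + 1)) * Fintype.card V ^ (2 * v + 1) := by
  rcases Nat.eq_zero_or_pos (Fintype.card V) with h0 | hpos
  · have : IsEmpty V := Fintype.card_eq_zero_iff.1 h0
    simp [dartSet]
  have h1 : #(dartSet G) ^ (v + 1) ≤ Fintype.card V ^ v * ∑ x : V, #{y | G.Adj x y} ^ (v + 1) := by
    have := pow_sum_div_card_le_sum_pow (s := (univ : Finset V))
      (f := fun x => (#{y | G.Adj x y} : ℝ)) (fun _ _ => by positivity) v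
    rw [card_univ, div_le_iff₀ (by positivity)] at this
    rw [mul_comm, card_dartSet]
    exact_mod_cast this
  have h2 : ∑ x : V, #{y | G.Adj x y} ^ (v + 1) ≤
      ((v + 1) ^ 2 + (v + 1)) * Fintype.card V ^ (v + 1) := by
    rw [← sum_card_tupleNbrs, ← sum_filter_not_add_sum_filter univ Function.Injective, add_mul]
    refine Nat.add_le_add ?_ ?_
    · calc _ ≤ ∑ a : Fin (v + 1) → V with ¬ Function.Injective a, Fintype.card V :=
            sum_le_sum fun a _ => card_le_univ _
        _ = #{x : Fin (v + 1) → V | ¬ Function.Injective x} * Fintype.card V := by simp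
        _ ≤ _ := card_not_injective_mul_le _
    · calc _ ≤ ∑ a : Fin (v + 1) → V with Function.Injective a, (v + 1) := by
            rw [hv]
            exact sum_le_sum fun a ha => card_tupleNbrs_lt_of_HFree hH (by simpa using ha)
        _ ≤ ∑ a : Fin (v + 1) → V, (v + 1) := sum_le_sum_of_subset (subset_univ _)
        _ = _ := by simp [mul_comm]
  calc _ ≤ _ := h1
    _ ≤ Fintype.card V ^ v * (((v + 1) ^ 2 + (v + 1)) * Fintype.card V ^ (v + 1)) :=
        Nat.mul_le_mul_left _ h2
    _ = _ := by ring

end DensityBounds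

section SumSquares

open Finset

/-- If the partial sums of `f` grow like a power, then so does the sum of squares. -/
theorem sum_sq_le_of_sum_le_rpow {ι : Type*} {f : ι → ℝ} {M σ τ : ℝ}
    (hτ : τ = 2 * σ - 1) (hτ0 : 0 < τ) (hτ1 : τ ≤ 1) (R : Finset ι) (hf : ∀ a ∈ R, 0 ≤ f a)
    (h : ∀ R' ⊆ R, ∑ a ∈ R', f a ≤ M * (#R' : ℝ) ^ σ) :
    ∑ a ∈ R, f a ^ 2 ≤ M ^ 2 / τ * (#R : ℝ) ^ τ := by
  classical
  induction hn : #R generalizing R with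
  | zero =>
    rw [card_eq_zero] at hn
    subst hn
    simp only [sum_empty]
    positivity
  | succ n ih =>
    have hne : R.Nonempty := card_pos.1 (by omega)
    obtain ⟨x, hx, hmin⟩ := exists_min_image R f hne
    have hc : #(R.erase x) = n := by rw [card_erase_of_mem hx]; omega
    have ih' := ih (R.erase x) (fun a ha => hf a (mem_of_mem_erase ha))
      (fun R' hR' => h R' (hR'.trans (erase_subset _ _))) hc
    have hfx : f x * (n + 1 : ℝ) ≤ M * (n + 1 : ℝ) ^ σ := by
      have h1 := h R subset_rfl
      have h2 : (#R : ℝ) * f x ≤ ∑ a ∈ R, f a := by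
        have := card_nsmul_le_sum R f (f x) hmin
        simpa using this
      rw [hn] at h1 h2
      push_cast at h1 h2
      linarith
    have hn1 : (0 : ℝ) < n + 1 := by positivity
    have hfx2 : f x ^ 2 ≤ M ^ 2 * (n + 1 : ℝ) ^ (τ - 1) := by
      have h1 : (f x * (n + 1 : ℝ)) ^ 2 ≤ (M * (n + 1 : ℝ) ^ σ) ^ 2 := by
        have := hf x hx
        gcongr
      have h2 : ((n + 1 : ℝ) ^ σ) ^ 2 = (n + 1 : ℝ) ^ (τ - 1) * (n + 1 : ℝ) ^ 2 := by
        rw [← Real.rpow_natCast, ← Real.rpow_mul hn1.le, ← Real.rpow_natCast (n + 1 : ℝ) 2,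
          ← Real.rpow_add hn1, hτ]
        congr 1
        push_cast
        ring
      rw [mul_pow, mul_pow, h2, ← mul_assoc] at h1
      exact le_of_mul_le_mul_right h1 (by positivity)
    have hbern : (n : ℝ) ^ τ + τ * (n + 1 : ℝ) ^ (τ - 1) ≤ (n + 1 : ℝ) ^ τ := by
      have hb := rpow_one_add_le_one_add_mul_self (s := -(1 / (n + 1 : ℝ))) (p := τ)
        (by rw [neg_le_neg_iff, div_le_one hn1]; linarith [Nat.cast_nonneg (α := ℝ) n]) hτ0.le hτ1
      have e1 : (1 : ℝ) + -(1 / (n + 1 : ℝ)) = n / (n + 1 : ℝ) := by field_simp; ring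
      rw [e1, Real.div_rpow (by positivity) hn1.le] at hb
      have hp : (0 : ℝ) < (n + 1 : ℝ) ^ τ := by positivity
      rw [div_le_iff₀ hp] at hb
      have e2 : (n + 1 : ℝ) ^ (τ - 1) = (n + 1 : ℝ) ^ τ / (n + 1 : ℝ) := by
        rw [Real.rpow_sub hn1, Real.rpow_one]
      rw [e2]
      have e3 : (1 + τ * -(1 / (n + 1 : ℝ))) * (n + 1 : ℝ) ^ τ =
        (n + 1 : ℝ) ^ τ - τ * ((n + 1 : ℝ) ^ τ / (n + 1 : ℝ)) := by ring
      linarith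
    rw [← add_sum_erase R _ hx]
    push_cast
    calc f x ^ 2 + ∑ a ∈ R.erase x, f a ^ 2
        ≤ M ^ 2 * (n + 1 : ℝ) ^ (τ - 1) + M ^ 2 / τ * (n : ℝ) ^ τ := add_le_add hfx2 ih'
      _ = M ^ 2 / τ * ((n : ℝ) ^ τ + τ * (n + 1 : ℝ) ^ (τ - 1)) := by field_simp; ring
      _ ≤ M ^ 2 / τ * (n + 1 : ℝ) ^ τ := by gcongr

end SumSquares

section ExtremalCleaning

open Finset
open scoped Classical

variable {V : Type*}

/-- The adjacent pairs in `A × B`. -/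
noncomputable def pairsBetween (G : SimpleGraph V) (A B : Finset V) : Finset (V × V) :=
  {e ∈ A ×ˢ B | G.Adj e.1 e.2}

theorem mem_pairsBetween {G : SimpleGraph V} {A B : Finset V} {e : V × V} :
    e ∈ pairsBetween G A B ↔ (e.1 ∈ A ∧ e.2 ∈ B) ∧ G.Adj e.1 e.2 := by
  simp [pairsBetween]

theorem card_pairsBetween (G : SimpleGraph V) (A B : Finset V) :
    #(pairsBetween G A B) = ∑ a ∈ A, #{b ∈ B | G.Adj a b} := by
  simp only [pairsBetween, card_filter]
  rw [sum_product]

theorem card_pairsBetween_le {G : SimpleGraph V} {C σ : ℝ} (hC : 0 ≤ C) (hσ0 : 0 ≤ σ)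
    (hσ1 : σ ≤ 1) (hW : ∀ W : Finset V, (#(pairsBetween G W W) : ℝ) ≤ C * (#W : ℝ) ^ (1 + σ))
    (A B : Finset V) :
    (#(pairsBetween G A B) : ℝ) ≤ 4 * C * (#A : ℝ) ^ σ * (#A + #B) := by
  rcases A.eq_empty_or_nonempty with rfl | hA
  · have : pairsBetween G ∅ B = ∅ := by ext; simp [mem_pairsBetween]
    rw [this]
    simp only [card_empty, Nat.cast_zero]
    positivity
  have hA0 : (0 : ℝ) < #A := by exact_mod_cast card_pos.2 hA
  have hsmall : ∀ B' : Finset V, #B' ≤ #A →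
      (#(pairsBetween G A B') : ℝ) ≤ 4 * C * (#A : ℝ) ^ σ * #A := by
    intro B' hB'
    have h1 : (#(pairsBetween G A B') : ℝ) ≤ #(pairsBetween G (A ∪ B') (A ∪ B')) := by
      refine Nat.cast_le.2 (card_le_card fun e he => ?_)
      rw [mem_pairsBetween] at he ⊢
      exact ⟨⟨mem_union_left _ he.1.1, mem_union_right _ he.1.2⟩, he.2⟩
    have h2 : (#(A ∪ B') : ℝ) ≤ 2 * #A := by
      have := card_union_le A B'
      have h3 : #(A ∪ B') ≤ 2 * #A := by omega
      exact_mod_cast h3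
    calc (#(pairsBetween G A B') : ℝ) ≤ C * (#(A ∪ B') : ℝ) ^ (1 + σ) := h1.trans (hW _)
      _ ≤ C * (2 * #A : ℝ) ^ (1 + σ) := by gcongr
      _ = C * ((2 : ℝ) ^ (1 + σ) * ((#A : ℝ) ^ σ * #A)) := by
          rw [Real.mul_rpow (by norm_num) hA0.le, Real.rpow_add hA0 1 σ, Real.rpow_one,
            mul_comm (#A : ℝ)]
      _ ≤ C * (4 * ((#A : ℝ) ^ σ * #A)) := by
          gcongr
          calc (2 : ℝ) ^ (1 + σ) ≤ 2 ^ (2 : ℝ) :=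
                Real.rpow_le_rpow_of_exponent_le (by norm_num) (by linarith)
            _ = 4 := by norm_num
      _ = _ := by ring
  induction hn : #B using Nat.strong_induction_on generalizing B with
  | _ n ih =>
    subst hn
    rcases le_total #B #A with hBA | hBA
    · refine (hsmall B hBA).trans ?_
      gcongr
      linarith [Nat.cast_nonneg (α := ℝ) #B]
    · obtain ⟨B', hB', hc⟩ := exists_subset_card_eq hBA
      have hApos := card_pos.2 hA
      have hlt : #(B \ B') < #B := by rw [card_sdiff_of_subset hB']; omega
      have h1 := ih _ hlt (B \ B') rfl
      have h2 := hsmall B' hc.le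
      have hcast : (#(B \ B') : ℝ) = #B - #A := by
        rw [card_sdiff_of_subset hB', Nat.cast_sub (card_le_card hB'), hc]
      have h3 : #(pairsBetween G A B) ≤ #(pairsBetween G A B') + #(pairsBetween G A (B \ B')) := by
        refine (card_le_card fun e he => ?_).trans (card_union_le _ _)
        rw [mem_union, mem_pairsBetween, mem_pairsBetween]
        rw [mem_pairsBetween] at he
        by_cases h : e.2 ∈ B'
        · exact Or.inl ⟨⟨he.1.1, h⟩, he.2⟩
        · exact Or.inr ⟨⟨he.1.1, Finset.mem_sdiff.2 ⟨he.1.2, h⟩⟩, he.2⟩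
      have h3' : (#(pairsBetween G A B) : ℝ) ≤
          #(pairsBetween G A B') + #(pairsBetween G A (B \ B')) := by exact_mod_cast h3
      rw [hcast] at h1
      calc _ ≤ _ := h3'
        _ ≤ 4 * C * (#A : ℝ) ^ σ * #A + 4 * C * (#A : ℝ) ^ σ * (#A + (#B - #A)) := add_le_add h2 h1
        _ = _ := by ring

theorem pairsBetween_mono {G G' : SimpleGraph V} (h : G' ≤ G) (A B : Finset V) :
    pairsBetween G' A B ⊆ pairsBetween G A B := fun e he => by
  rw [mem_pairsBetween] at he ⊢
  exact ⟨he.1, h he.2⟩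

variable [Fintype V]

theorem exists_trimmed_subgraph {G : SimpleGraph V} {C σ : ℝ} (hC : 0 < C) (hσ0 : 3 / 5 ≤ σ)
    (hσ1 : σ < 1) (hW : ∀ W : Finset V, (#(pairsBetween G W W) : ℝ) ≤ C * (#W : ℝ) ^ (1 + σ))
    (hE : C * (Fintype.card V : ℝ) ^ (1 + σ) ≤ #(dartSet G)) :
    ∃ G' ≤ G, (∀ v, (#{x | G'.Adj v x} : ℝ) ≤ 128 * C * (Fintype.card V : ℝ) ^ σ) ∧
      C * (Fintype.card V : ℝ) ^ (1 + σ) ≤ 2 * #(dartSet G') := by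
  set m : ℝ := (Fintype.card V : ℝ) with hm
  let L : Finset V := {v | 128 * C * m ^ σ < #{x | G.Adj v x}}
  obtain ⟨G', hG'⟩ : ∃ G' : SimpleGraph V, ∀ u v, G'.Adj u v ↔ G.Adj u v ∧ u ∉ L ∧ v ∉ L :=
    ⟨{ Adj := fun u v => G.Adj u v ∧ u ∉ L ∧ v ∉ L
       symm := ⟨fun u v h => ⟨h.1.symm, h.2.2, h.2.1⟩⟩
       loopless := ⟨fun u h => G.loopless.irrefl u h.1⟩ }, fun u v => Iff.rfl⟩
  have hle : G' ≤ G := fun u v h => ((hG' u v).1 h).1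
  refine ⟨G', hle, fun v => ?_, ?_⟩
  · by_cases hv : v ∈ L
    · have : ({x | G'.Adj v x} : Finset V) = ∅ := by ext x; simp [hG', hv]
      rw [this]
      simp only [card_empty, Nat.cast_zero]
      positivity
    · have h1 : (#{x | G.Adj v x} : ℝ) ≤ 128 * C * m ^ σ := by simpa [L] using hv
      refine le_trans (Nat.cast_le.2 (card_le_card fun x hx => ?_)) h1
      simp only [mem_filter, mem_univ, true_and] at hx ⊢
      exact hle hx
  · have hcover : dartSet G ⊆ dartSet G' ∪
        (pairsBetween G L univ ∪ (pairsBetween G L univ).image Prod.swap) := by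
      rintro ⟨u, v⟩ he
      simp only [dartSet, mem_filter, mem_univ, true_and] at he
      simp only [dartSet, mem_union, mem_filter, mem_univ, true_and, mem_pairsBetween, mem_image,
        and_true]
      by_cases hu : u ∈ L
      · exact Or.inr (Or.inl ⟨hu, he⟩)
      · by_cases hv : v ∈ L
        · exact Or.inr (Or.inr ⟨(v, u), ⟨hv, he.symm⟩, rfl⟩)
        · exact Or.inl ((hG' u v).2 ⟨he, hu, hv⟩)
    have h1 : #(dartSet G) ≤ #(dartSet G') + 2 * #(pairsBetween G L univ) := by
      refine (card_le_card hcover).trans ((card_union_le _ _).trans ?_)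
      refine Nat.add_le_add_left ((card_union_le _ _).trans ?_) _
      have := card_image_le (s := pairsBetween G L univ) (f := Prod.swap)
      omega
    have h1' : (#(dartSet G) : ℝ) ≤ #(dartSet G') + 2 * #(pairsBetween G L univ) := by
      exact_mod_cast h1
    suffices hL : (#(pairsBetween G L univ) : ℝ) ≤ C * m ^ (1 + σ) / 8 by
      have : 0 ≤ C * m ^ (1 + σ) := by positivity
      linarith
    rcases L.eq_empty_or_nonempty with hL0 | hL0
    · have : pairsBetween G L univ = ∅ := by ext; simp [mem_pairsBetween, hL0]
      rw [this]
      simp only [card_empty, Nat.cast_zero]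
      positivity
    have hx0 : (0 : ℝ) < #L := by exact_mod_cast card_pos.2 hL0
    obtain ⟨x, hx⟩ : ∃ x : ℝ, x = #L := ⟨_, rfl⟩
    rw [← hx] at hx0
    have hxm : x ≤ m := by rw [hx, hm]; exact_mod_cast card_le_univ L
    have hm0 : 0 < m := hx0.trans_le hxm
    have h2 : (#(pairsBetween G L univ) : ℝ) ≤ 8 * C * x ^ σ * m := by
      refine (card_pairsBetween_le hC.le (by linarith) hσ1.le hW L univ).trans ?_
      rw [card_univ, ← hx, ← hm]
      calc 4 * C * x ^ σ * (x + m) ≤ 4 * C * x ^ σ * (m + m) := by gcongr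
        _ = _ := by ring
    have h3 : 128 * C * m ^ σ * x ≤ #(pairsBetween G L univ) := by
      rw [card_pairsBetween, Nat.cast_sum]
      have : ∑ a ∈ L, 128 * C * m ^ σ ≤ ∑ a ∈ L, (#{b | G.Adj a b} : ℝ) :=
        sum_le_sum fun a ha => le_of_lt (by simpa [L] using ha)
      rw [sum_const, nsmul_eq_mul, ← hx] at this
      linarith
    have h4 : 16 * (m ^ σ * x) ≤ x ^ σ * m := by
      have : 8 * C * (16 * (m ^ σ * x)) ≤ 8 * C * (x ^ σ * m) := by linarith
      exact le_of_mul_le_mul_left this (by positivity)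
    have e1 : ∀ y : ℝ, 0 < y → y = y ^ σ * y ^ (1 - σ) := fun y hy => by
      rw [← Real.rpow_add hy]; simp
    have h5 : 16 * x ^ (1 - σ) ≤ m ^ (1 - σ) := by
      have h6 : (m ^ σ * x ^ σ) * (16 * x ^ (1 - σ)) ≤ (m ^ σ * x ^ σ) * m ^ (1 - σ) := by
        calc _ = 16 * (m ^ σ * (x ^ σ * x ^ (1 - σ))) := by ring
          _ = 16 * (m ^ σ * x) := by rw [← e1 x hx0]
          _ ≤ x ^ σ * m := h4
          _ = x ^ σ * (m ^ σ * m ^ (1 - σ)) := by rw [← e1 m hm0]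
          _ = _ := by ring
      exact le_of_mul_le_mul_left h6 (by positivity)
    have h7 : 64 * x ^ σ ≤ m ^ σ := by
      have hρ : 3 / 2 ≤ σ / (1 - σ) := by
        rw [le_div_iff₀ (by linarith)]; linarith
      have h8 : (16 * x ^ (1 - σ)) ^ (σ / (1 - σ)) ≤ (m ^ (1 - σ)) ^ (σ / (1 - σ)) :=
        Real.rpow_le_rpow (by positivity) h5 (by linarith)
      have e2 : (1 - σ) * (σ / (1 - σ)) = σ := by
        have : (1 : ℝ) - σ ≠ 0 := (sub_pos.2 hσ1).ne'
        field_simp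
      rw [Real.mul_rpow (by norm_num) (by positivity), ← Real.rpow_mul hx0.le,
        ← Real.rpow_mul hm0.le, e2] at h8
      refine le_trans ?_ h8
      gcongr
      calc (64 : ℝ) = 16 ^ (3 / 2 : ℝ) := by
            rw [show (16 : ℝ) = 4 ^ (2 : ℝ) by norm_num, ← Real.rpow_mul (by norm_num)]
            norm_num
        _ ≤ _ := Real.rpow_le_rpow_of_exponent_le (by norm_num) hρ
    calc _ ≤ 8 * C * x ^ σ * m := h2
      _ = C * m / 8 * (64 * x ^ σ) := by ring
      _ ≤ C * m / 8 * m ^ σ := by gcongr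
      _ = _ := by rw [Real.rpow_add hm0, Real.rpow_one]; ring

end ExtremalCleaning

section HeavyPairs

open Finset
open scoped Classical

variable {V : Type*} [Fintype V]

theorem sum_card_commonNbrs_eq (G : SimpleGraph V) (R : Finset V) (c : V) :
    ∑ a ∈ R, #(commonNbrs G a c) = #(pairsBetween G R {x | G.Adj c x}) := by
  rw [card_pairsBetween]
  refine sum_congr rfl fun a _ => ?_
  congr 1
  ext x
  simp [commonNbrs, and_comm]

theorem sum_heavy_codegree_sq_le {G : SimpleGraph V} {C σ τ : ℝ} (hC : 0 < C)
    (hτ : τ = 2 * σ - 1) (hτ0 : 0 < τ) (hσ1 : σ ≤ 1)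
    (hW : ∀ W : Finset V, (#(pairsBetween G W W) : ℝ) ≤ C * (#W : ℝ) ^ (1 + σ))
    {k z : ℕ} (hk0 : 1 ≤ k) (hk : ∀ v, #{x | G.Adj v x} ≤ k) (hz : 8 * C * (k : ℝ) ^ σ ≤ z)
    (c : V) :
    ∑ a : V with z < #(commonNbrs G a c), (#(commonNbrs G a c) : ℝ) ^ 2 ≤
      (8 * C * k) ^ 2 / τ * (k : ℝ) ^ τ := by
  set R : Finset V := {a | z < #(commonNbrs G a c)} with hR
  have hbound : ∀ R' : Finset V, (#R' : ℝ) ≤ k →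
      ∑ a ∈ R', (#(commonNbrs G a c) : ℝ) ≤ 8 * C * k * (#R' : ℝ) ^ σ := by
    intro R' hR'
    rw [← Nat.cast_sum, sum_card_commonNbrs_eq]
    refine (card_pairsBetween_le hC.le (by linarith) hσ1 hW _ _).trans ?_
    have h1 : (#({x | G.Adj c x} : Finset V) : ℝ) ≤ k := Nat.cast_le.2 (hk c)
    calc 4 * C * (#R' : ℝ) ^ σ * (#R' + #({x | G.Adj c x} : Finset V))
        ≤ 4 * C * (#R' : ℝ) ^ σ * (k + k) := by gcongr
      _ = _ := by ring
  have hRk : #R ≤ k := by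
    by_contra! hcon
    obtain ⟨R', hR', hc⟩ := exists_subset_card_eq hcon.le
    have h1 := hbound R' (by rw [hc])
    have hne : R'.Nonempty := card_pos.1 (by omega)
    have h2 : ∑ a ∈ R', (z : ℝ) < ∑ a ∈ R', (#(commonNbrs G a c) : ℝ) := by
      refine sum_lt_sum_of_nonempty hne fun a ha => ?_
      have := hR' ha
      simp only [hR, mem_filter, mem_univ, true_and] at this
      exact_mod_cast this
    rw [sum_const, nsmul_eq_mul, hc] at h2
    rw [hc] at h1
    have hk' : (0 : ℝ) < k := by exact_mod_cast hk0
    nlinarith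
  have hRk' : (#R : ℝ) ≤ k := by exact_mod_cast hRk
  refine (sum_sq_le_of_sum_le_rpow (M := 8 * C * k) hτ hτ0 (by linarith) R
    (fun _ _ => by positivity) fun R' hR' => hbound R' ?_).trans ?_
  · exact le_trans (Nat.cast_le.2 (card_le_card hR')) hRk'
  · gcongr

theorem sum_not_lightPair_le {G : SimpleGraph V} {C σ τ : ℝ} (hC : 0 < C)
    (hτ : τ = 2 * σ - 1) (hτ0 : 0 < τ) (hσ1 : σ ≤ 1)
    (hW : ∀ W : Finset V, (#(pairsBetween G W W) : ℝ) ≤ C * (#W : ℝ) ^ (1 + σ))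
    {k z : ℕ} (hk0 : 1 ≤ k) (hk : ∀ v, #{x | G.Adj v x} ≤ k) (hz : 8 * C * (k : ℝ) ^ σ ≤ z) :
    ((∑ p : V × V with ¬ LightPair G z p.1 p.2, #(commonNbrs G p.1 p.2) ^ 2 : ℕ) : ℝ) ≤
      Fintype.card V * ((k : ℝ) ^ 2 + (8 * C * k) ^ 2 / τ * (k : ℝ) ^ τ) := by
  push_cast
  rw [sum_filter, ← Finset.univ_product_univ, sum_product_right]
  have hc : ∀ c : V, ∑ a : V, (if ¬ LightPair G z a c then (#(commonNbrs G a c) : ℝ) ^ 2 else 0) ≤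
      (k : ℝ) ^ 2 + (8 * C * k) ^ 2 / τ * (k : ℝ) ^ τ := by
    intro c
    have h1 : ∀ a : V, (if ¬ LightPair G z a c then (#(commonNbrs G a c) : ℝ) ^ 2 else 0) ≤
        (if a = c then (#(commonNbrs G a c) : ℝ) ^ 2 else 0) +
          (if z < #(commonNbrs G a c) then (#(commonNbrs G a c) : ℝ) ^ 2 else 0) := by
      intro a
      by_cases h : LightPair G z a c
      · simp only [h, not_true_eq_false, if_false]
        positivity
      · rw [if_pos h]
        by_cases hac : a = c
        · rw [if_pos hac]
          have : (0 : ℝ) ≤ if z < #(commonNbrs G a c) then (#(commonNbrs G a c) : ℝ) ^ 2 else 0 := by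
            positivity
          linarith
        · have hz' : z < #(commonNbrs G a c) := by
            by_contra! hle
            exact h ⟨hac, hle⟩
          rw [if_neg hac, if_pos hz', zero_add]
    refine (sum_le_sum fun a _ => h1 a).trans ?_
    rw [sum_add_distrib, ← sum_filter (fun a => z < #(commonNbrs G a c))]
    refine add_le_add ?_ (sum_heavy_codegree_sq_le hC hτ hτ0 hσ1 hW hk0 hk hz c)
    rw [sum_ite_eq' univ c, if_pos (mem_univ c)]
    gcongr
    refine (card_le_card fun x hx => ?_).trans (hk c)
    simp only [commonNbrs, mem_filter, mem_univ, true_and] at hx ⊢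
    exact hx.1
  refine (sum_le_sum fun c _ => hc c).trans ?_
  rw [sum_const, card_univ, nsmul_eq_mul]

end HeavyPairs

section ExtremalContradiction

open Finset
open scoped Classical

/-- The threshold below which the edge density makes heavy codegrees negligible. -/
noncomputable def densityThreshold : ℝ := (1 / (4 * 32 * 320 * 128 ^ 3)) ^ 5

theorem densityThreshold_pos : 0 < densityThreshold := by
  unfold densityThreshold; positivity

theorem densityThreshold_le_one : densityThreshold ≤ 1 := by
  unfold densityThreshold
  norm_num

theorem rpow_le_of_le_densityThreshold {P τ : ℝ} (hP : 0 < P) (hP0 : P ≤ densityThreshold)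
    (hτ : 1 / 5 ≤ τ) : P ^ τ ≤ 1 / (4 * 32 * 320 * 128 ^ 3) := by
  have h1 : P ≤ 1 := hP0.trans densityThreshold_le_one
  calc P ^ τ ≤ P ^ (1 / 5 : ℝ) := Real.rpow_le_rpow_of_exponent_ge hP h1 hτ
    _ ≤ densityThreshold ^ (1 / 5 : ℝ) := Real.rpow_le_rpow hP.le hP0 (by norm_num)
    _ = _ := by
        rw [densityThreshold, ← Real.rpow_natCast, ← Real.rpow_mul (by positivity)]
        norm_num

/-- The degree and codegree parameters of a trimmed extremal graph are incompatible with the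
absence of `H_{s,t}`. -/
theorem not_HFree_of_params {V : Type*} [Fintype V] {G : SimpleGraph V} {s t T : ℕ}
    (hs : 2 ≤ s) (hT : s + t ≤ T) (hT2 : 2 * s ^ 2 ≤ T)
    {C σ π : ℝ} (hC : 0 < C) (hσ0 : 3 / 5 ≤ σ) (hσ1 : σ ≤ 1) (hπ : 0 < π)
    (hP : π ^ 2 ≤ densityThreshold) (hm : 0 < Fintype.card V)
    (hCP : C * (Fintype.card V : ℝ) ^ σ = π ^ 2 * Fintype.card V)
    (hW : ∀ W : Finset V, (#(pairsBetween G W W) : ℝ) ≤ C * (#W : ℝ) ^ (1 + σ))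
    (hdeg : ∀ v, (#{x | G.Adj v x} : ℝ) ≤ 128 * π ^ 2 * Fintype.card V)
    (hE : π ^ 2 * (Fintype.card V : ℝ) ^ 2 ≤ 2 * #(dartSet G))
    (hq1 : 8 * 256 * s ^ 2 * 1025 + 4 * 32 * 128 ^ 2 ≤ Fintype.card V * π ^ (2 * s + 1))
    (hq2 : 2 ^ (3 * s + 1) * (2 ^ s * (32 * t * 1025 * 128 ^ (2 * s - 1))) ≤
      Fintype.card V * π ^ (2 * s + 1))
    (hq3 : 2 ^ (2 * s + 1) * (2 ^ s * (16 * t * T)) ≤ Fintype.card V * π ^ (2 * s + 1)) :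
    ¬ HFree G s t := by
  obtain ⟨m, hmd⟩ : ∃ m : ℝ, m = (Fintype.card V : ℝ) := ⟨_, rfl⟩
  obtain ⟨E, hEd⟩ : ∃ E : ℝ, E = (#(dartSet G) : ℝ) := ⟨_, rfl⟩
  rw [← hmd, ← hEd] at hE
  simp only [← hmd] at hCP hdeg hq1 hq2 hq3
  have hm1 : 1 ≤ m := by rw [hmd]; exact_mod_cast hm
  have hm0 : 0 < m := by linarith
  have hπ1 : π ≤ 1 := by
    by_contra! h
    have := hP.trans densityThreshold_le_one
    nlinarith
  have hpow : ∀ j, j ≤ 2 * s + 1 → m * π ^ (2 * s + 1) ≤ m * π ^ j := fun j hj =>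
    mul_le_mul_of_nonneg_left (pow_le_pow_of_le_one hπ.le hπ1 hj) hm0.le
  have hq3' := hpow 3 (by omega)
  have hq4' := hpow 4 (by omega)
  have hq2' := hpow 2 (by omega)
  have hs2 : (0 : ℝ) ≤ 8 * 256 * s ^ 2 * 1025 := by positivity
  have hE0 : 0 < E := by
    have : 0 < π ^ 2 * m ^ 2 := by positivity
    linarith
  set k : ℕ := ⌊128 * π ^ 2 * m⌋₊ with hk
  have hkle : (k : ℝ) ≤ 128 * π ^ 2 * m := Nat.floor_le (by positivity)
  have hk1 : 1 ≤ k := by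
    rw [hk, Nat.one_le_floor_iff]
    nlinarith
  have hkdeg : ∀ v, #{x | G.Adj v x} ≤ k := fun v => Nat.le_floor (hdeg v)
  have hP0 : 0 < π ^ 2 := by positivity
  have hCk : C * (k : ℝ) ^ σ ≤ 128 * (π ^ 2) ^ σ * (π ^ 2 * m) := by
    calc C * (k : ℝ) ^ σ ≤ C * (128 * π ^ 2 * m) ^ σ := by gcongr
      _ = 128 ^ σ * (π ^ 2) ^ σ * (C * m ^ σ) := by
          rw [Real.mul_rpow (by positivity) hm0.le, Real.mul_rpow (by norm_num) hP0.le]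
          ring
      _ ≤ 128 ^ (1 : ℝ) * (π ^ 2) ^ σ * (C * m ^ σ) := by
          gcongr
          norm_num
      _ = _ := by rw [hCP, Real.rpow_one]
  have hPσ : (π ^ 2) ^ σ ≤ π := by
    calc (π ^ 2) ^ σ ≤ (π ^ 2) ^ (1 / 2 : ℝ) :=
          Real.rpow_le_rpow_of_exponent_ge hP0 (hP.trans densityThreshold_le_one) (by linarith)
      _ = π := by
          rw [← Real.sqrt_eq_rpow, Real.sqrt_sq hπ.le]
  set z : ℕ := ⌈8 * C * (k : ℝ) ^ σ⌉₊ with hz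
  have hzge : 8 * C * (k : ℝ) ^ σ ≤ z := Nat.le_ceil _
  have hz1 : 1 ≤ z := by
    rw [hz, Nat.one_le_ceil_iff]
    have : (0 : ℝ) < k := by exact_mod_cast hk1
    positivity
  have hzle : (z : ℝ) ≤ 1025 * (π ^ 3 * m) := by
    have h1 : (z : ℝ) ≤ 8 * C * (k : ℝ) ^ σ + 1 :=
      (Nat.ceil_lt_add_one (by positivity)).le
    have h2 : C * (k : ℝ) ^ σ ≤ 128 * π * (π ^ 2 * m) :=
      hCk.trans (by gcongr)
    have h3 : 1 ≤ π ^ 3 * m := by nlinarith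
    nlinarith
  have hEpow : ∀ j : ℕ, (π ^ 2 * m ^ 2) ^ j ≤ 2 ^ j * E ^ j := fun j =>
    (pow_le_pow_left₀ (by positivity) hE j).trans (mul_pow 2 E j).le
  refine not_HFree_of_counts (T := T) (z := z) (k := k) (by omega) hz1 hT hT2 hkdeg
    (by exact_mod_cast hEd ▸ hE0) ?_ ?_ ?_ ?_
  · have hτ0 : (0 : ℝ) < 2 * σ - 1 := by linarith
    have hheavy := sum_not_lightPair_le hC rfl hτ0 hσ1 hW hk1 hkdeg hzge
    have hk0 : (0 : ℝ) < k := by exact_mod_cast hk1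
    have h1 : (8 * C * k) ^ 2 / (2 * σ - 1) * (k : ℝ) ^ (2 * σ - 1) ≤
        320 * ((C * (k : ℝ) ^ σ) ^ 2 * k) := by
      have e1 : (k : ℝ) ^ (2 * σ - 1) * k = ((k : ℝ) ^ σ) ^ 2 := by
        rw [← Real.rpow_natCast, ← Real.rpow_mul hk0.le]
        nth_rewrite 2 [← Real.rpow_one (k : ℝ)]
        rw [← Real.rpow_add hk0]
        congr 1
        push_cast
        ring
      have h5 : 1 / (2 * σ - 1) ≤ 5 := by
        rw [div_le_iff₀ hτ0]; linarith
      calc _ = 64 * C ^ 2 * ((k : ℝ) ^ (2 * σ - 1) * k) * k * (1 / (2 * σ - 1)) := by ring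
        _ ≤ 64 * C ^ 2 * ((k : ℝ) ^ (2 * σ - 1) * k) * k * 5 := by gcongr
        _ = _ := by rw [e1]; ring
    have h2 : (C * (k : ℝ) ^ σ) ^ 2 * k ≤
        128 ^ 3 * ((1 / (4 * 32 * 320 * 128 ^ 3)) * (π ^ 2) ^ 4) * m ^ 3 := by
      have e2 : ((π ^ 2) ^ σ) ^ 2 = (π ^ 2) ^ (2 * σ - 1) * π ^ 2 := by
        rw [← Real.rpow_natCast, ← Real.rpow_mul hP0.le]
        nth_rewrite 3 [← Real.rpow_one (π ^ 2)]
        rw [← Real.rpow_add hP0]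
        congr 1
        push_cast
        ring
      have h6 := rpow_le_of_le_densityThreshold (τ := 2 * σ - 1) hP0 hP (by linarith)
      calc (C * (k : ℝ) ^ σ) ^ 2 * k
          ≤ (128 * (π ^ 2) ^ σ * (π ^ 2 * m)) ^ 2 * (128 * π ^ 2 * m) := by gcongr
        _ = 128 ^ 3 * (((π ^ 2) ^ σ) ^ 2 * (π ^ 2) ^ 3) * m ^ 3 := by ring
        _ = 128 ^ 3 * ((π ^ 2) ^ (2 * σ - 1) * (π ^ 2) ^ 4) * m ^ 3 := by rw [e2]; ring
        _ ≤ _ := by gcongr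
    have h3 : (k : ℝ) ^ 2 * (4 * 32) ≤ π ^ 8 * m ^ 3 := by
      calc (k : ℝ) ^ 2 * (4 * 32) ≤ (128 * π ^ 2 * m) ^ 2 * (4 * 32) := by gcongr
        _ = π ^ 4 * m ^ 2 * (4 * 32 * 128 ^ 2) := by ring
        _ ≤ π ^ 4 * m ^ 2 * (m * π ^ 4) :=
            mul_le_mul_of_nonneg_left (by linarith) (by positivity)
        _ = _ := by ring
    have h4 := hEpow 4
    have goal : (4 : ℝ) * m ^ 4 * (m * ((k : ℝ) ^ 2 +
        (8 * C * k) ^ 2 / (2 * σ - 1) * (k : ℝ) ^ (2 * σ - 1))) ≤ E ^ 4 := by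
      calc _ ≤ (4 : ℝ) * m ^ 4 * (m * (π ^ 8 * m ^ 3 / (4 * 32) + 320 *
            (128 ^ 3 * ((1 / (4 * 32 * 320 * 128 ^ 3)) * (π ^ 2) ^ 4) * m ^ 3))) :=
            mul_le_mul_of_nonneg_left (mul_le_mul_of_nonneg_left
              (add_le_add ((le_div_iff₀ (by norm_num)).2 h3)
                (h1.trans (mul_le_mul_of_nonneg_left h2 (by norm_num)))) hm0.le) (by positivity)
        _ = (π ^ 2 * m ^ 2) ^ 4 / 16 := by ring
        _ ≤ _ := by linarith
    rw [← hmd] at hheavy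
    have hfin := (mul_le_mul_of_nonneg_left hheavy
      (by positivity : (0 : ℝ) ≤ 4 * m ^ 4)).trans goal
    rw [hEd, hmd] at hfin
    exact_mod_cast hfin
  · have h4 := hEpow 3
    have : (256 : ℝ) * s ^ 2 * z * m ^ 4 ≤ E ^ 3 := by
      calc (256 : ℝ) * s ^ 2 * z * m ^ 4 ≤ 256 * s ^ 2 * (1025 * (π ^ 3 * m)) * m ^ 4 := by gcongr
        _ = (8 * 256 * s ^ 2 * 1025) * (π ^ 3 * m ^ 5) / 8 := by ring
        _ ≤ (m * π ^ 3) * (π ^ 3 * m ^ 5) / 8 :=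
            div_le_div_of_nonneg_right
              (mul_le_mul_of_nonneg_right (by linarith) (by positivity)) (by norm_num)
        _ = (π ^ 2 * m ^ 2) ^ 3 / 8 := by ring
        _ ≤ _ := by linarith
    rw [hEd, hmd] at this
    exact_mod_cast this
  · have h4 := hEpow (3 * s + 1)
    have : (2 : ℝ) ^ s * (32 * t * z * k ^ (2 * s - 1) * m ^ (4 * s + 1)) ≤ E ^ (3 * s + 1) := by
      have h5 : (2 : ℝ) ^ (3 * s + 1) *
          (2 ^ s * (32 * t * z * k ^ (2 * s - 1) * m ^ (4 * s + 1))) ≤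
          2 ^ (3 * s + 1) * E ^ (3 * s + 1) := by
        obtain ⟨p, rfl⟩ : ∃ p, s = p + 1 := ⟨s - 1, by omega⟩
        have e3 : 2 * (p + 1) - 1 = 2 * p + 1 := by omega
        rw [e3] at hq2 ⊢
        calc _ ≤ (2 : ℝ) ^ (3 * (p + 1) + 1) * (2 ^ (p + 1) * (32 * t * (1025 * (π ^ 3 * m)) *
              (128 * π ^ 2 * m) ^ (2 * p + 1) * m ^ (4 * (p + 1) + 1))) := by gcongr
          _ = (2 ^ (3 * (p + 1) + 1) * (2 ^ (p + 1) * (32 * t * 1025 * 128 ^ (2 * p + 1)))) *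
              (π ^ (4 * p + 5) * m ^ (6 * p + 7)) := by
              rw [mul_pow, mul_pow, ← pow_mul]; ring
          _ ≤ (m * π ^ (2 * (p + 1) + 1)) * (π ^ (4 * p + 5) * m ^ (6 * p + 7)) := by gcongr
          _ = (π ^ 2 * m ^ 2) ^ (3 * (p + 1) + 1) := by
              rw [mul_pow, ← pow_mul, ← pow_mul]; ring
          _ ≤ _ := h4
      exact le_of_mul_le_mul_left h5 (by positivity)
    rw [hEd, hmd] at this
    exact_mod_cast this
  · have h4 := hEpow (2 * s + 1)
    have : (2 : ℝ) ^ s * (16 * t * T * m ^ (4 * s)) ≤ E ^ (2 * s + 1) := by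
      have h5 : (2 : ℝ) ^ (2 * s + 1) * (2 ^ s * (16 * t * T * m ^ (4 * s))) ≤
          2 ^ (2 * s + 1) * E ^ (2 * s + 1) := by
        have hq0 : 1 ≤ m * π ^ (2 * s + 1) := by linarith
        calc _ = (2 ^ (2 * s + 1) * (2 ^ s * (16 * t * T))) * m ^ (4 * s) := by ring
          _ ≤ (m * π ^ (2 * s + 1)) * m ^ (4 * s) := by gcongr
          _ ≤ (m * π ^ (2 * s + 1)) * m ^ (4 * s) * (m * π ^ (2 * s + 1)) :=
              le_mul_of_one_le_right (by positivity) hq0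
          _ = (π ^ 2 * m ^ 2) ^ (2 * s + 1) := by
              rw [mul_pow, ← pow_mul, ← pow_mul]; ring
          _ ≤ _ := h4
      exact le_of_mul_le_mul_left h5 (by positivity)
    rw [hEd, hmd] at this
    exact_mod_cast this

end ExtremalContradiction

section UpperBound

open Finset
open scoped Classical

theorem HFree.of_injective_hom {V W : Type*} {G : SimpleGraph V} {G' : SimpleGraph W} {s t : ℕ}
    (f : G' →g G) (hf : Function.Injective f) (hG : HFree G s t) : HFree G' s t :=
  fun a b c d ha hb hc hd hac hbd h1 h2 h3 h4 =>
    hG (f ∘ a) (f ∘ b) (f ∘ c) (f ∘ d) (hf.comp ha) (hf.comp hb) (hf.comp hc) (hf.comp hd)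
      (fun i j => hf.ne (hac i j)) (fun i j => hf.ne (hbd i j)) (fun i => f.map_rel (h1 i))
      (fun j => f.map_rel (h2 j)) (fun i j => f.map_rel (h3 i j)) fun i j => f.map_rel (h4 i j)

theorem HFree.mono {V : Type*} {G G' : SimpleGraph V} {s t : ℕ} (h : G' ≤ G) (hG : HFree G s t) :
    HFree G' s t :=
  hG.of_injective_hom (SimpleGraph.Hom.ofLE h) Function.injective_id

/-- A graph which maximises `e(W) / |W| ^ (1 + σ)` among its induced subgraphs, with a large
maximum, contains `H_{s,t}`. -/
theorem exists_const_not_HFree (s t : ℕ) (hs : 2 ≤ s) {σ : ℝ}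
    (hσ : σ * (2 * s + 1) = 2 * s - 1) :
    ∃ C₀ : ℝ, 1 ≤ C₀ ∧ ∀ (V : Type) [Fintype V] (G : SimpleGraph V) (C : ℝ), C₀ ≤ C →
      0 < Fintype.card V →
      (∀ W : Finset V, (#(pairsBetween G W W) : ℝ) ≤ C * (#W : ℝ) ^ (1 + σ)) →
      C * (Fintype.card V : ℝ) ^ (1 + σ) ≤ #(dartSet G) → ¬ HFree G s t := by
  obtain ⟨v, hv⟩ : ∃ v, v + 1 = s + t := ⟨s + t - 1, by omega⟩
  obtain ⟨T, hTd⟩ : ∃ T, T = 2 * s ^ 2 + s + t := ⟨_, rfl⟩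
  have hp0 := densityThreshold_pos
  obtain ⟨A, hA⟩ : ∃ A : ℝ, A = 8 * 256 * s ^ 2 * 1025 + 4 * 32 * 128 ^ 2 := ⟨_, rfl⟩
  obtain ⟨B, hB⟩ : ∃ B : ℝ,
    B = 2 ^ (3 * s + 1) * (2 ^ s * (32 * t * 1025 * 128 ^ (2 * s - 1))) := ⟨_, rfl⟩
  obtain ⟨D, hD⟩ : ∃ D : ℝ, D = 2 ^ (2 * s + 1) * (2 ^ s * (16 * t * T)) := ⟨_, rfl⟩
  obtain ⟨K, hK⟩ : ∃ K : ℝ, K = 2 ^ (v + 1) * ((v + 1) ^ 2 + (v + 1)) := ⟨_, rfl⟩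
  have hA0 : 0 ≤ A := by rw [hA]; positivity
  have hB0 : 0 ≤ B := by rw [hB]; positivity
  have hD0 : 0 ≤ D := by rw [hD]; positivity
  have hK0 : 0 ≤ K / densityThreshold ^ (v + 1) := by rw [hK]; positivity
  refine ⟨1 + A + B + D + K / densityThreshold ^ (v + 1), by linarith, ?_⟩
  intro V _ G C hC hm hW hE hH
  have hC1 : 1 ≤ C := by linarith
  have hC0 : 0 < C := by linarith
  have hs0 : (2 : ℝ) ≤ s := by exact_mod_cast hs
  have hσ0 : 3 / 5 ≤ σ := by nlinarith
  have hσ1 : σ < 1 := by nlinarith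
  obtain ⟨G', hG', hdeg, hE'⟩ := exists_trimmed_subgraph hC0 hσ0 hσ1 hW hE
  obtain ⟨m, hmd⟩ : ∃ m : ℝ, m = (Fintype.card V : ℝ) := ⟨_, rfl⟩
  have hm1 : 1 ≤ m := by rw [hmd]; exact_mod_cast hm
  have hm0 : 0 < m := by linarith
  have hCm : C ≤ m := by
    have h1 : (#(dartSet G) : ℝ) ≤ m ^ 2 := by
      have := Finset.card_le_univ (dartSet G)
      rw [Fintype.card_prod, ← sq] at this
      rw [hmd]; exact_mod_cast this
    rw [← hmd] at hE
    have h2 : m ^ (1 : ℝ) ≤ m ^ (1 + σ) := Real.rpow_le_rpow_of_exponent_le hm1 (by linarith)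
    rw [Real.rpow_one] at h2
    nlinarith
  obtain ⟨P, hP⟩ : ∃ P : ℝ, P = C * m ^ (σ - 1) := ⟨_, rfl⟩
  have hP0 : 0 < P := by rw [hP]; positivity
  have hPm : C * m ^ σ = P * m := by
    rw [hP, mul_assoc]
    nth_rewrite 3 [← Real.rpow_one m]
    rw [← Real.rpow_add hm0]
    ring_nf
  have hPm2 : C * m ^ (1 + σ) = P * m ^ 2 := by
    rw [add_comm, Real.rpow_add hm0, ← mul_assoc, hPm, Real.rpow_one]; ring
  have hPpow : m ^ 2 * P ^ (2 * s + 1) = C ^ (2 * s + 1) := by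
    have : (m ^ (σ - 1)) ^ (2 * s + 1) * m ^ 2 = 1 := by
      rw [← Real.rpow_natCast, ← Real.rpow_natCast, ← Real.rpow_mul hm0.le, ← Real.rpow_add hm0]
      rw [show (σ - 1) * ((2 * s + 1 : ℕ) : ℝ) + ((2 : ℕ) : ℝ) = 0 by push_cast; linarith]
      exact Real.rpow_zero m
    rw [hP, mul_pow]
    linear_combination C ^ (2 * s + 1) * this
  rw [← hmd, hPm2] at hE'
  have hq : C ≤ m * √P ^ (2 * s + 1) := by
    have h1 : (m * √P ^ (2 * s + 1)) ^ 2 = C ^ (2 * s + 1) := by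
      rw [mul_pow, ← pow_mul, mul_comm (2 * s + 1) 2, pow_mul, Real.sq_sqrt hP0.le, hPpow]
    have h2 : C ^ 2 ≤ C ^ (2 * s + 1) := pow_le_pow_right₀ hC1 (by omega)
    exact (pow_le_pow_iff_left₀ hC0.le (by positivity) two_ne_zero).1 (h2.trans h1.ge)
  have hPle : P ≤ densityThreshold := by
    by_contra! hlt
    have hkst := card_dartSet_pow_le_of_HFree hv (hH.mono hG')
    have hkst' : (#(dartSet G') : ℝ) ^ (v + 1) ≤ ((v + 1) ^ 2 + (v + 1)) * m ^ (2 * v + 1) := by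
      rw [hmd]; exact_mod_cast hkst
    have h1 : P ^ (v + 1) * m * m ^ (2 * v + 1) ≤ K * m ^ (2 * v + 1) := by
      calc P ^ (v + 1) * m * m ^ (2 * v + 1) = (P * m ^ 2) ^ (v + 1) := by
            rw [mul_pow, ← pow_mul]; ring
        _ ≤ (2 * #(dartSet G')) ^ (v + 1) := pow_le_pow_left₀ (by positivity) hE' _
        _ = 2 ^ (v + 1) * (#(dartSet G') : ℝ) ^ (v + 1) := mul_pow _ _ _
        _ ≤ 2 ^ (v + 1) * (((v + 1) ^ 2 + (v + 1)) * m ^ (2 * v + 1)) := by gcongr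
        _ = _ := by rw [hK]; ring
    have h2 := le_of_mul_le_mul_right h1 (by positivity)
    have h3 : densityThreshold ^ (v + 1) * m ≤ K :=
      (mul_le_mul_of_nonneg_right (pow_le_pow_left₀ hp0.le hlt.le _) hm0.le).trans h2
    have h4 : m ≤ K / densityThreshold ^ (v + 1) := by
      rw [le_div_iff₀ (by positivity)]; linarith
    linarith
  refine not_HFree_of_params (T := T) (π := √P) hs (by omega) (by omega) hC0 hσ0 hσ1.le
    (Real.sqrt_pos.2 hP0) ?_ hm ?_ (fun W => ?_) ?_ ?_ ?_ ?_ ?_ (hH.mono hG')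
  · rwa [Real.sq_sqrt hP0.le]
  · rw [Real.sq_sqrt hP0.le, ← hmd, hPm]
  · exact le_trans (by exact_mod_cast card_le_card (pairsBetween_mono hG' W W)) (hW W)
  · intro v
    rw [Real.sq_sqrt hP0.le]
    refine (hdeg v).trans (le_of_eq ?_)
    rw [← hmd, mul_assoc, hPm, mul_assoc]
  · rwa [Real.sq_sqrt hP0.le, ← hmd]
  · rw [← hmd, ← hA]; linarith
  · rw [← hmd, ← hB]; linarith
  · rw [← hmd, ← hD]; linarith

theorem mem_dartSet {V : Type*} [Fintype V] {G : SimpleGraph V} {e : V × V} :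
    e ∈ dartSet G ↔ G.Adj e.1 e.2 := by
  simp [dartSet]

theorem dartSet_eq_pairsBetween {V : Type*} [Fintype V] (G : SimpleGraph V) :
    dartSet G = pairsBetween G univ univ := by
  ext e
  rw [mem_dartSet, mem_pairsBetween]
  simp

theorem card_pairsBetween_comap {V W : Type*} (G : SimpleGraph V) (f : W ↪ V) (A : Finset W) :
    #(pairsBetween (G.comap f) A A) = #(pairsBetween G (A.map f) (A.map f)) := by
  rw [← card_map (f.prodMap f)]
  congr 1
  ext ⟨x, y⟩
  simp only [Finset.mem_map, mem_pairsBetween, Prod.exists,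
    Function.Embedding.coe_prodMap, Prod.map_apply, Prod.mk.injEq]
  constructor
  · rintro ⟨a, b, ⟨⟨ha, hb⟩, h⟩, rfl, rfl⟩
    exact ⟨⟨⟨a, ha, rfl⟩, ⟨b, hb, rfl⟩⟩, h⟩
  · rintro ⟨⟨⟨a, ha, rfl⟩, ⟨b, hb, rfl⟩⟩, h⟩
    exact ⟨a, b, ⟨⟨ha, hb⟩, h⟩, rfl, rfl⟩

theorem exists_const_card_dartSet_le (s t : ℕ) (hs : 2 ≤ s) {σ : ℝ}
    (hσ : σ * (2 * s + 1) = 2 * s - 1) :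
    ∃ C₀ : ℝ, 1 ≤ C₀ ∧ ∀ (V : Type) [Fintype V] (G : SimpleGraph V), HFree G s t →
      (#(dartSet G) : ℝ) ≤ C₀ * (Fintype.card V : ℝ) ^ (1 + σ) := by
  obtain ⟨C₀, hC₀, hmain⟩ := exists_const_not_HFree s t hs hσ
  refine ⟨C₀, hC₀, fun V _ G hG => ?_⟩
  by_contra! hlt
  have hθ : 0 < 1 + σ := by
    have : (2 : ℝ) ≤ s := by exact_mod_cast hs
    nlinarith
  have hV : Nonempty V := by
    by_contra hV
    rw [not_nonempty_iff] at hV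
    simp [dartSet, Real.zero_rpow hθ.ne'] at hlt
  have hne : ({U | U.Nonempty} : Finset (Finset V)).Nonempty := ⟨univ, by simp⟩
  obtain ⟨U, hU, hmax⟩ := exists_max_image _
    (fun U : Finset V => (#(pairsBetween G U U) : ℝ) / (#U : ℝ) ^ (1 + σ)) hne
  have hU : U.Nonempty := by simpa using hU
  have hpos : ∀ W : Finset V, W.Nonempty → 0 < (#W : ℝ) ^ (1 + σ) := fun W hW =>
    Real.rpow_pos_of_pos (by exact_mod_cast hW.card_pos) _
  obtain ⟨C, hC⟩ : ∃ C : ℝ, C = (#(pairsBetween G U U) : ℝ) / (#U : ℝ) ^ (1 + σ) := ⟨_, rfl⟩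
  have hW : ∀ W : Finset V, (#(pairsBetween G W W) : ℝ) ≤ C * (#W : ℝ) ^ (1 + σ) := by
    intro W
    rcases W.eq_empty_or_nonempty with rfl | hW
    · have : pairsBetween G (∅ : Finset V) ∅ = ∅ := by
        ext e; simp [mem_pairsBetween]
      simp [this, Real.zero_rpow hθ.ne']
    · rw [← div_le_iff₀ (hpos W hW), hC]
      exact hmax W (by simpa using hW)
  have hCge : C₀ ≤ C := by
    have h1 := hW univ
    rw [← dartSet_eq_pairsBetween, card_univ] at h1
    have h2 := hpos univ univ_nonempty
    rw [card_univ] at h2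
    exact (lt_of_mul_lt_mul_right (hlt.trans_le h1) h2.le).le
  have hinj : Function.Injective (Subtype.val : U → V) := Subtype.val_injective
  let f : U ↪ V := ⟨Subtype.val, hinj⟩
  refine hmain U (G.comap f) C hCge (by simpa using hU.card_pos) (fun W => ?_) ?_
    (hG.of_injective_hom ⟨f, fun h => h⟩ hinj)
  · rw [card_pairsBetween_comap, ← card_map f]
    exact hW _
  · rw [dartSet_eq_pairsBetween, card_pairsBetween_comap]
    have : (univ : Finset U).map f = U := by ext x; simp [f]
    rw [this, Fintype.card_coe, hC, div_mul_cancel₀ _ (hpos U hU).ne']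

theorem card_bool_coloring_ne {V : Type*} [Fintype V] {u v : V} (h : u ≠ v) :
    2 * #{χ : V → Bool | χ u ≠ χ v} = Fintype.card (V → Bool) := by
  have h1 : #{χ : V → Bool | χ u ≠ χ v} = #{χ : V → Bool | ¬ χ u ≠ χ v} := by
    refine card_nbij' (fun χ => Function.update χ u (!χ u)) (fun χ => Function.update χ u (!χ u))
      ?_ ?_ ?_ ?_
    · intro χ; simp [Function.update_of_ne h.symm]
      cases χ u <;> cases χ v <;> simp
    · intro χ; simp [Function.update_of_ne h.symm]
    · intro χ _; simp
    · intro χ _; simp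
  have h2 := card_filter_add_card_filter_not (s := (univ : Finset (V → Bool)))
    (fun χ => χ u ≠ χ v)
  rw [card_univ] at h2
  omega

theorem exists_bool_coloring {V : Type*} [Fintype V] (G : SimpleGraph V) :
    ∃ χ : V → Bool, #(dartSet G) ≤ 2 * #{e ∈ dartSet G | χ e.1 ≠ χ e.2} := by
  by_contra! h
  have h1 : ∑ χ : V → Bool, 2 * #{e ∈ dartSet G | χ e.1 ≠ χ e.2} <
      ∑ _χ : V → Bool, #(dartSet G) := sum_lt_sum_of_nonempty univ_nonempty fun χ _ => h χ
  have h2 : ∑ χ : V → Bool, 2 * #{e ∈ dartSet G | χ e.1 ≠ χ e.2} =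
      ∑ e ∈ dartSet G, 2 * #{χ : V → Bool | χ e.1 ≠ χ e.2} := by
    rw [← mul_sum, ← mul_sum]
    congr 1
    exact sum_card_bipartiteAbove_eq_sum_card_bipartiteBelow
      (fun (χ : V → Bool) (e : V × V) => χ e.1 ≠ χ e.2)
  rw [h2, sum_congr rfl fun e he => card_bool_coloring_ne (mem_dartSet.1 he).ne] at h1
  simp [mul_comm] at h1

theorem Hgraph_adj {s t : ℕ} {x y : (Fin s ⊕ Fin t) × Bool} : (Hgraph s t).Adj x y ↔
    (x.2 = y.2 ∧ (completeBipartiteGraph (Fin s) (Fin t)).Adj x.1 y.1) ∨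
      (x.2 ≠ y.2 ∧ x.1 = y.1) := by
  rw [Hgraph, SimpleGraph.fromRel_adj]
  constructor
  · rintro ⟨-, h | h⟩
    · exact h
    · exact h.imp (fun h => ⟨h.1.symm, h.2.symm⟩) fun h => ⟨h.1.symm, h.2.symm⟩
  · intro h
    refine ⟨?_, Or.inl h⟩
    rintro rfl
    rcases h with h | h
    · exact h.2.ne rfl
    · exact h.1 rfl

theorem HFree.of_not_contains {V : Type*} {G G' : SimpleGraph V} {s t : ℕ} (hs : 1 ≤ s)
    (ht : 1 ≤ t) (hG : ¬ G.Contains (Hgraph s t)) (hle : G' ≤ G) {χ : V → Bool}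
    (hχ : ∀ u v, G'.Adj u v → χ u ≠ χ v) : HFree G' s t := by
  intro a b c d ha hb hc hd hac hbd hab hcd had hbc
  have hne : ∀ {x y : Bool}, x ≠ y → y = !x := by decide
  have hd' : ∀ j, χ (d j) = !χ (c j) := fun j => hne (hχ _ _ (hcd j))
  have hb' : ∀ i, χ (b i) = !χ (a i) := fun i => hne (hχ _ _ (hab i))
  have hac' : ∀ i j, χ (c j) = χ (a i) := fun i j => by
    have := hne (hχ _ _ (hbc i j))
    rw [this, hb', Bool.not_not]
  let f : (Fin s ⊕ Fin t) × Bool → V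
    | (Sum.inl i, false) => a i
    | (Sum.inl i, true) => b i
    | (Sum.inr j, false) => d j
    | (Sum.inr j, true) => c j
  apply hG
  refine ⟨⟨f, ?_⟩, ?_⟩
  · rintro ⟨i | j, x⟩ ⟨i' | j', y⟩ h <;> rw [Hgraph_adj] at h <;>
      simp only [completeBipartiteGraph_adj] at h <;> cases x <;> cases y <;> simp at h
    · exact h ▸ hle (hab i)
    · exact h ▸ hle (hab i).symm
    · exact hle (had i j')
    · exact hle (hbc i j')
    · exact hle (had i' j).symm
    · exact hle (hbc i' j).symm
    · exact h ▸ hle (hcd j).symm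
    · exact h ▸ hle (hcd j)
  · obtain ⟨κ, hκ⟩ : ∃ κ, κ = χ (c ⟨0, ht⟩) := ⟨_, rfl⟩
    have ka : ∀ i, χ (a i) = κ := fun i => by rw [hκ, hac' i]
    have kc : ∀ j, χ (c j) = κ := fun j => by rw [hac' ⟨0, hs⟩, ka]
    have kb : ∀ i, χ (b i) = !κ := fun i => by rw [hb', ka]
    have kd : ∀ j, χ (d j) = !κ := fun j => by rw [hd', kc]
    have hsep : ∀ {x y : V}, χ x = κ → χ y = !κ → x ≠ y := by
      rintro x y hx hy rfl
      rw [hx] at hy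
      exact absurd hy (by cases κ <;> simp)
    rintro ⟨i | j, x⟩ ⟨i' | j', y⟩ h <;> cases x <;> cases y <;>
      simp only [RelHom.coeFn_mk, f] at h
    · rw [ha h]
    · exact absurd h (hsep (ka _) (kb _))
    · exact absurd h.symm (hsep (ka _) (kb _))
    · rw [hb h]
    · exact absurd h (hsep (ka _) (kd _))
    · exact absurd h (hac _ _)
    · exact absurd h (hbd _ _)
    · exact absurd h.symm (hsep (kc _) (kb _))
    · exact absurd h.symm (hsep (ka _) (kd _))
    · exact absurd h.symm (hbd _ _)
    · exact absurd h.symm (hac _ _)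
    · exact absurd h (hsep (kc _) (kb _))
    · rw [hd h]
    · exact absurd h.symm (hsep (kc _) (kd _))
    · exact absurd h (hsep (kc _) (kd _))
    · rw [hc h]

theorem card_dartSet_eq_two_mul_ncard {V : Type*} [Fintype V] (G : SimpleGraph V) :
    #(dartSet G) = 2 * G.edgeSet.ncard := by
  rw [card_dartSet, ← SimpleGraph.coe_edgeFinset, Set.ncard_coe_finset,
    ← SimpleGraph.sum_degrees_eq_twice_card_edges]
  refine sum_congr rfl fun x _ => ?_
  rw [← SimpleGraph.card_neighborFinset_eq_degree]
  congr 1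
  ext y
  simp

theorem exists_exNum_le (s t : ℕ) (hs : 2 ≤ s) (ht : 1 ≤ t) :
    ∃ c : ℝ, 0 < c ∧ ∀ n : ℕ,
      (exNum n (Hgraph s t) : ℝ) ≤ c * (n : ℝ) ^ ((2 : ℝ) - 2 / (2 * s + 1)) := by
  have hs0 : (0 : ℝ) < 2 * s + 1 := by positivity
  obtain ⟨C, hC, hmain⟩ := exists_const_card_dartSet_le s t hs
    (σ := (2 * s - 1) / (2 * s + 1)) (by field_simp)
  have hθ : 1 + (2 * s - 1) / (2 * s + 1) = (2 : ℝ) - 2 / (2 * s + 1) := by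
    field_simp; ring
  rw [hθ] at hmain
  refine ⟨C, by linarith, fun n => ?_⟩
  have key : ∀ G : SimpleGraph (Fin n), ¬ G.Contains (Hgraph s t) →
      (G.edgeSet.ncard : ℝ) ≤ C * (n : ℝ) ^ ((2 : ℝ) - 2 / (2 * s + 1)) := by
    intro G hG
    obtain ⟨χ, hχ⟩ := exists_bool_coloring G
    let G' : SimpleGraph (Fin n) :=
      { Adj := fun u v => G.Adj u v ∧ χ u ≠ χ v
        symm := ⟨fun u v h => ⟨h.1.symm, h.2.symm⟩⟩
        loopless := ⟨fun u h => h.2 rfl⟩ }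
    have hfree : HFree G' s t :=
      HFree.of_not_contains (by omega) ht hG (fun u v h => h.1) fun u v h => h.2
    have h1 := hmain (Fin n) G' hfree
    have h2 : dartSet G' = {e ∈ dartSet G | χ e.1 ≠ χ e.2} := by
      ext e
      rw [mem_dartSet, mem_filter, mem_dartSet]
    rw [← h2, card_dartSet_eq_two_mul_ncard] at hχ
    have h3 : (G.edgeSet.ncard : ℝ) ≤ #(dartSet G') := by
      exact_mod_cast Nat.le_of_mul_le_mul_left hχ two_pos
    simpa using h3.trans h1
  rw [exNum]
  rcases Set.eq_empty_or_nonempty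
    {N : ℕ | ∃ G : SimpleGraph (Fin n), ¬ G.Contains (Hgraph s t) ∧ G.edgeSet.ncard = N}
    with h0 | hne
  · rw [h0, csSup_empty]
    have : (0 : ℝ) ≤ C * (n : ℝ) ^ ((2 : ℝ) - 2 / (2 * s + 1)) := by positivity
    simpa using this
  · have hbdd : BddAbove
        {N : ℕ | ∃ G : SimpleGraph (Fin n), ¬ G.Contains (Hgraph s t) ∧ G.edgeSet.ncard = N} := by
      refine ⟨⌊C * (n : ℝ) ^ ((2 : ℝ) - 2 / (2 * s + 1))⌋₊, ?_⟩
      rintro N ⟨G, hG, rfl⟩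
      exact Nat.le_floor (key G hG)
    obtain ⟨G, hG, hN⟩ := Nat.sSup_mem hne hbdd
    rw [← hN]
    exact key G hG

end UpperBound

section Interpolation

open Finset

/-- The monomial with exponents `e`, evaluated at the point `P`. -/
def monomialValue {ι K : Type*} [Fintype ι] [CommRing K] {m : ℕ} (P : ι → K) (e : ι → Fin m) : K :=
  ∏ i, P i ^ (e i : ℕ)

open scoped Classical in
/-- Distinct points impose independent conditions on polynomials of large degree. -/
theorem linearIndependent_monomialValue {ι J K : Type*} [Fintype ι] [Nonempty ι] [Fintype J]
    [Field K] {m : ℕ} (hJ : Fintype.card J ≤ m) {P : J → ι → K} (hP : Function.Injective P) :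
    LinearIndependent K fun j => (monomialValue (P j) : (ι → Fin m) → K) := by
  rw [Fintype.linearIndependent_iff]
  intro c hc j₀
  have hsep : ∀ j, ∃ i, j ≠ j₀ → P j i ≠ P j₀ i := fun j => by
    by_cases h : j = j₀
    · exact ⟨Classical.arbitrary ι, fun h' => absurd h h'⟩
    · obtain ⟨i, hi⟩ := Function.ne_iff.1 (hP.ne h)
      exact ⟨i, fun _ => hi⟩
  choose ι₀ hι₀ using hsep
  let p : MvPolynomial ι K :=
    ∏ j ∈ univ.erase j₀, (MvPolynomial.X (ι₀ j) - MvPolynomial.C (P j (ι₀ j)))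
  have hdeg : ∀ i, p.degreeOf i < m := fun i => by
    calc p.degreeOf i ≤ ∑ j ∈ univ.erase j₀,
          (MvPolynomial.X (ι₀ j) - MvPolynomial.C (P j (ι₀ j)) : MvPolynomial ι K).degreeOf i :=
          MvPolynomial.degreeOf_prod_le _ _ _
      _ ≤ ∑ j ∈ univ.erase j₀, 1 := by
          refine sum_le_sum fun j _ => (MvPolynomial.degreeOf_sub_le _ _ _).trans ?_
          rw [MvPolynomial.degreeOf_C, MvPolynomial.degreeOf_X]
          split_ifs <;> simp
      _ < m := by
          rw [sum_const, smul_eq_mul, mul_one]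
          exact (card_lt_card (erase_ssubset (mem_univ j₀))).trans_le (by simpa using hJ)
  have hsum : ∑ j, c j * MvPolynomial.eval (P j) p = 0 := by
    simp_rw [MvPolynomial.eval_eq', mul_sum]
    rw [sum_comm]
    refine sum_eq_zero fun d hd => ?_
    have hd' : ∀ i, d i < m := fun i => (MvPolynomial.monomial_le_degreeOf i hd).trans_lt (hdeg i)
    have := congrFun hc fun i => ⟨d i, hd' i⟩
    simp only [Finset.sum_apply, Pi.smul_apply, smul_eq_mul, monomialValue, Pi.zero_apply] at this
    calc _ = MvPolynomial.coeff d p * ∑ j, c j * ∏ i, P j i ^ d i := by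
          rw [mul_sum]; exact sum_congr rfl fun j _ => by ring
      _ = 0 := by rw [this, mul_zero]
  have heval : ∀ x, MvPolynomial.eval x p = ∏ j ∈ univ.erase j₀, (x (ι₀ j) - P j (ι₀ j)) :=
    fun x => by
    simp [p, map_prod]
  rw [sum_eq_single j₀] at hsum
  · refine (mul_eq_zero.1 hsum).resolve_right ?_
    rw [heval]
    exact prod_ne_zero_iff.2 fun j hj => sub_ne_zero.2 (hι₀ j (ne_of_mem_erase hj)).symm
  · intro j _ hj
    rw [heval, prod_eq_zero (mem_erase.2 ⟨hj, mem_univ j⟩) (sub_self _), mul_zero]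
  · simp

/-- A system of `card J` independent linear equations over `K` expresses all coordinates of any
solution through all but `card J` of them. -/
theorem exists_finset_forall_mem_span {J M K L : Type*} [Fintype J] [Fintype M] [DecidableEq M]
    [Field K] [Field L] [Algebra K L] {Φ : J → M → K} (hΦ : LinearIndependent K Φ) :
    ∃ B : Finset M, #B + Fintype.card J = Fintype.card M ∧
      ∀ u : M → L, (∀ j, ∑ e, Φ j e • u e = 0) → ∀ e, u e ∈ Submodule.span K (u '' B) := by
  let W : Submodule K (M → K) := Submodule.span K (Set.range Φ)
  let q : M → ((M → K) ⧸ W) := fun e => W.mkQ (Pi.single e 1)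
  have hspan : Submodule.span K (Set.range q) = ⊤ := by
    have : Set.range q = W.mkQ '' Set.range fun e : M => (Pi.single e 1 : M → K) := by
      rw [← Set.range_comp]; rfl
    rw [this, Submodule.span_image]
    have h2 : Submodule.span K (Set.range fun e : M => (Pi.single e 1 : M → K)) = ⊤ := by
      rw [← (Pi.basisFun K M).span_eq]
      congr 1
      ext; simp
    rw [h2, Submodule.map_top, Submodule.range_mkQ]
  obtain ⟨κ, a, ha, hspan', hli⟩ := exists_linearIndependent' K q
  have : Finite κ := Finite.of_injective a ha
  have := Fintype.ofFinite κ
  have hcard : Fintype.card κ + Fintype.card J = Fintype.card M := by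
    have h1 : Module.finrank K ((M → K) ⧸ W) = Fintype.card κ :=
      Module.finrank_eq_card_basis (Module.Basis.mk hli (by rw [hspan', hspan]))
    have h2 : Module.finrank K W = Fintype.card J := finrank_span_eq_card hΦ
    have h3 := W.finrank_quotient_add_finrank
    rw [Module.finrank_fintype_fun_eq_card] at h3
    omega
  refine ⟨univ.map ⟨a, ha⟩, by simpa using hcard, fun u hu e => ?_⟩
  let ψ : (M → K) →ₗ[K] L := Fintype.linearCombination K u
  have hψ : ∀ v, ψ v = ∑ e, v e • u e := fun v => Fintype.linearCombination_apply K u v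
  have hψe : ∀ e, ψ (Pi.single e 1) = u e := fun e => by
    rw [hψ]
    simp [Pi.single_apply]
  have hW : W ≤ LinearMap.ker ψ := by
    rw [Submodule.span_le]
    rintro _ ⟨j, rfl⟩
    rw [SetLike.mem_coe, LinearMap.mem_ker, hψ, hu]
  let ψ' : ((M → K) ⧸ W) →ₗ[K] L := W.liftQ ψ hW
  have hψ' : ∀ e, ψ' (q e) = u e := fun e => by
    rw [← hψe]; exact W.liftQ_apply ψ _
  have hmem : q e ∈ Submodule.span K (Set.range (q ∘ a)) := by
    rw [hspan', hspan]; trivial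
  have := Submodule.mem_map_of_mem (f := ψ') hmem
  rw [Submodule.map_span, hψ', ← Set.range_comp] at this
  have himg : Set.range (ψ' ∘ q ∘ a) = u '' (univ.map (⟨a, ha⟩ : κ ↪ M) : Finset M) := by
    ext x
    simp [hψ']
  rwa [himg] at this

end Interpolation

section LimitField

/-- A sequence of fields has a limit field, in which eventually vanishing sequences vanish. -/
theorem exists_limit_field (F : ℕ → Type) [∀ l, Field (F l)] [∀ l, Algebra (ZMod 2) (F l)] :
    ∃ (L : Type) (_ : Field L) (_ : Algebra (ZMod 2) L) (π : (∀ l, F l) →+* L),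
      Function.Surjective π ∧ ∀ x, (∀ᶠ l in atTop, x l = 0) → π x = 0 := by
  let I : Ideal (∀ l, F l) :=
    { carrier := {x | ∀ᶠ l in atTop, x l = 0}
      add_mem' := fun {x y} hx hy => by
        filter_upwards [hx, hy] with l h1 h2
        simp [h1, h2]
      zero_mem' := by simp
      smul_mem' := fun c x hx => by
        filter_upwards [hx] with l h1
        simp [h1] }
  have hI : I ≠ ⊤ := by
    rw [Ne, Ideal.eq_top_iff_one]
    intro h
    obtain ⟨l, hl⟩ := Filter.Eventually.exists h
    exact one_ne_zero hl
  obtain ⟨𝔪, h𝔪, hle⟩ := Ideal.exists_le_maximal I hI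
  exact ⟨(∀ l, F l) ⧸ 𝔪, Ideal.Quotient.field 𝔪, inferInstance, Ideal.Quotient.mk 𝔪,
    Ideal.Quotient.mk_surjective, fun x hx => Ideal.Quotient.eq_zero_iff_mem.2 (hle hx)⟩

variable {F : ℕ → Type} [∀ l, Field (F l)] {L : Type} [Field L] {π : (∀ l, F l) →+* L}

theorem exists_limit_ne_zero (hπ : ∀ x, (∀ᶠ l in atTop, x l = 0) → π x = 0) {ι : Type*} [Fintype ι]
    {x : ι → ∀ l, F l} (hx : ∀ᶠ l in atTop, ∃ i, x i l ≠ 0) : ∃ i, π (x i) ≠ 0 := by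
  classical
  by_contra! h
  let y : ι → ∀ l, F l := fun i l =>
    if hl : ∃ i, x i l ≠ 0 then (if i = hl.choose then (x i l)⁻¹ else 0) else 0
  have h1 : π (1 - ∑ i, y i * x i) = 0 := by
    refine hπ _ ?_
    filter_upwards [hx] with l hl
    rw [Pi.sub_apply, Finset.sum_apply, Finset.sum_eq_single hl.choose]
    · simp only [Pi.mul_apply, y, dif_pos hl, if_true]
      rw [inv_mul_cancel₀ hl.choose_spec, Pi.one_apply, sub_self]
    · intro i _ hi
      simp [y, dif_pos hl, hi]
    · simp
  rw [map_sub, map_one, map_sum, Finset.sum_eq_zero fun i _ => by rw [map_mul, h i, mul_zero],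
    sub_zero] at h1
  exact one_ne_zero h1

/-- From families of distinct points of growing size one can choose a sequence of points whose
limit avoids a given countable set. -/
theorem exists_limit_notMem_countable (hsurj : Function.Surjective π)
    (hπ : ∀ x, (∀ᶠ l in atTop, x l = 0) → π x = 0) {ι : Type*} [Fintype ι]
    {c : ∀ l, Fin (l + 1) → ι → F l} (hc : ∀ l, Function.Injective (c l))
    {S : Set (ι → L)} (hS : S.Countable) :
    ∃ j : ∀ l, Fin (l + 1), (fun i => π fun l => c l (j l) i) ∉ S := by
  classical
  obtain ⟨σ, hσ⟩ := Set.countable_iff_exists_subset_range.1 hS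
  choose x hx using fun n i => hsurj (σ n i)
  have hex : ∀ l, ∃ j : Fin (l + 1), ∀ n < l, c l j ≠ fun i => x n i l := by
    intro l
    by_contra! h
    choose n hn hcn using h
    have hinj : Function.Injective fun j => (⟨n j, hn j⟩ : Fin l) := by
      intro j j' hj
      apply hc l
      rw [hcn, hcn, Fin.mk.inj_iff.1 hj]
    simpa using Fintype.card_le_of_injective _ hinj
  choose j hj using hex
  refine ⟨j, fun hmem => ?_⟩
  obtain ⟨n, hn⟩ := hσ hmem
  obtain ⟨i, hi⟩ := exists_limit_ne_zero hπ (x := fun i => (fun l => c l (j l) i) - x n i) (by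
    filter_upwards [eventually_gt_atTop n] with l hl
    obtain ⟨i, hi⟩ := Function.ne_iff.1 (hj l n hl)
    exact ⟨i, sub_ne_zero.2 hi⟩)
  rw [map_sub, hx, hn, sub_self] at hi
  exact hi rfl

theorem countable_matroid_closure {K L : Type} [Field K] [Countable K] [Field L] [Algebra K L]
    {S : Set L} (hS : S.Countable) : ((AlgebraicIndependent.matroid K L).closure S).Countable := by
  rw [AlgebraicIndependent.matroid_closure_eq]
  have : Countable (Algebra.adjoin K S) := by
    rw [← Cardinal.mk_le_aleph0_iff]
    refine (Algebra.cardinalMk_adjoin_le K S).trans ?_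
    have := hS.to_subtype
    simp [Cardinal.mk_le_aleph0]
  exact Algebraic.countable (Algebra.adjoin K S) L

theorem countable_pi_of_forall_mem {ι α : Type*} [Finite ι] {S : Set α} (hS : S.Countable) :
    {x : ι → α | ∀ i, x i ∈ S}.Countable := by
  have := Set.countable_univ_pi (s := fun _ : ι => S) fun _ => hS
  simpa [Set.pi] using this

end LimitField

section RankBound

/-- The value at `P` of the polynomial with coefficients `u`. -/
def polyValue {ι K : Type*} [Fintype ι] [DecidableEq ι] [CommRing K] {m : ℕ}
    (u : (ι → Fin m) → K) (P : ι → K) : K :=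
  ∑ e, u e * monomialValue P e

theorem mem_matroid_closure_of_mem_adjoin {K L : Type*} [Field K] [Field L] [Algebra K L]
    {S : Set L} {x : L} (hx : x ∈ IntermediateField.adjoin K S) :
    x ∈ (AlgebraicIndependent.matroid K L).closure S := by
  rw [AlgebraicIndependent.matroid_closure_eq, SetLike.mem_coe, Subalgebra.mem_algebraicClosure]
  induction hx using IntermediateField.adjoin_induction with
  | mem x hx =>
    exact isAlgebraic_algebraMap (⟨x, Algebra.subset_adjoin hx⟩ : Algebra.adjoin K S)
  | algebraMap x => exact isAlgebraic_algebraMap (algebraMap K (Algebra.adjoin K S) x)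
  | add x y _ _ hx hy => exact hx.add hy
  | inv x _ hx => exact hx.inv
  | mul x y _ _ hx hy => exact hx.mul hy

/-- The points at which a copy of `H_{s,r}` forces the defining polynomials to vanish. -/
def configPoint {s r : ℕ} {X : Type*} {N : ℕ} (a b : Fin s → Fin N → X) (c d : Fin r → Fin N → X) :
    (Fin s × Fin r) ⊕ ((Fin r × Fin s) ⊕ Fin r) → Fin N ⊕ Fin N → X
  | Sum.inl p => Sum.elim (a p.1) (d p.2)
  | Sum.inr (Sum.inl p) => Sum.elim (c p.1) (b p.2)
  | Sum.inr (Sum.inr j) => Sum.elim (c j) (d j)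

theorem sumElim_inj {α β γ : Type*} {f f' : α → γ} {g g' : β → γ} :
    Sum.elim f g = Sum.elim f' g' ↔ f = f' ∧ g = g' := by
  refine ⟨fun h => ⟨?_, ?_⟩, fun h => by rw [h.1, h.2]⟩
  · simpa using congrArg (· ∘ Sum.inl) h
  · simpa using congrArg (· ∘ Sum.inr) h

theorem configPoint_injective {s r : ℕ} {X : Type*} {N : ℕ} {a b : Fin s → Fin N → X}
    {c d : Fin r → Fin N → X} (ha : Function.Injective a) (hb : Function.Injective b)
    (hc : Function.Injective c) (hd : Function.Injective d) (hac : ∀ i j, a i ≠ c j)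
    (hbd : ∀ i j, b i ≠ d j) : Function.Injective (configPoint a b c d) := by
  rintro (⟨i, j⟩ | ⟨j, i⟩ | j) (⟨i', j'⟩ | ⟨j', i'⟩ | j') h <;>
    simp only [configPoint, sumElim_inj] at h
  · rw [ha h.1, hd h.2]
  · exact absurd h.1 (hac _ _)
  · exact absurd h.1 (hac _ _)
  · exact absurd h.1.symm (hac _ _)
  · rw [hc h.1, hb h.2]
  · exact absurd h.2 (hbd _ _)
  · exact absurd h.1.symm (hac _ _)
  · exact absurd h.2.symm (hbd _ _)
  · rw [hc h.1]

/-- The set of all coordinates of a configuration. -/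
def configCoords {s r : ℕ} {X : Type*} {N : ℕ} (a b : Fin s → Fin N → X)
    (c d : Fin r → Fin N → X) : Set X :=
  Set.range fun p : ((Fin s ⊕ Fin s) ⊕ (Fin r ⊕ Fin r)) × Fin N =>
    Sum.elim (Sum.elim a b) (Sum.elim c d) p.1 p.2

theorem configPoint_mem_configCoords {s r : ℕ} {X : Type*} {N : ℕ} (a b : Fin s → Fin N → X)
    (c d : Fin r → Fin N → X) (j) (i) : configPoint a b c d j i ∈ configCoords a b c d := by
  rcases j with ⟨p, q⟩ | ⟨p, q⟩ | q <;> rcases i with i | i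
  · exact ⟨(Sum.inl (Sum.inl p), i), rfl⟩
  · exact ⟨(Sum.inr (Sum.inr q), i), rfl⟩
  · exact ⟨(Sum.inr (Sum.inl p), i), rfl⟩
  · exact ⟨(Sum.inl (Sum.inr q), i), rfl⟩
  · exact ⟨(Sum.inr (Sum.inl q), i), rfl⟩
  · exact ⟨(Sum.inr (Sum.inr q), i), rfl⟩

/-- Two polynomials vanishing on a configuration depend algebraically, together with the
configuration, on few parameters. -/
theorem eRk_config_add_le {K L : Type*} [Field K] [Field L] [Algebra K L] {s r N m : ℕ}
    (hN : 0 < N) (hm : m = (2 * s + 1) * r) {a b : Fin s → Fin N → L}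
    {c d : Fin r → Fin N → L} (ha : Function.Injective a) (hb : Function.Injective b)
    (hc : Function.Injective c) (hd : Function.Injective d) (hac : ∀ i j, a i ≠ c j)
    (hbd : ∀ i j, b i ≠ d j) {u : Fin 2 → (Fin N ⊕ Fin N → Fin m) → L}
    (hu : ∀ h j, polyValue (u h) (configPoint a b c d j) = 0) :
    (AlgebraicIndependent.matroid K L).eRk
      (configCoords a b c d ∪ Set.range fun p : Fin 2 × (Fin N ⊕ Fin N → Fin m) => u p.1 p.2) +
        (2 * m : ℕ) ≤
      ((2 * (s + r) * N + 2 * Fintype.card (Fin N ⊕ Fin N → Fin m) : ℕ) : ℕ∞) := by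
  classical
  let E := IntermediateField.adjoin K (configCoords a b c d)
  let P : (Fin s × Fin r) ⊕ ((Fin r × Fin s) ⊕ Fin r) → Fin N ⊕ Fin N → E := fun j i =>
    ⟨configPoint a b c d j i,
      IntermediateField.subset_adjoin K _ (configPoint_mem_configCoords a b c d j i)⟩
  have hP : Function.Injective P := by
    intro j j' h
    apply configPoint_injective ha hb hc hd hac hbd
    funext i
    exact congrArg Subtype.val (congrFun h i)
  have : Nonempty (Fin N ⊕ Fin N) := ⟨Sum.inl ⟨0, hN⟩⟩
  have hJ : Fintype.card ((Fin s × Fin r) ⊕ ((Fin r × Fin s) ⊕ Fin r)) = m := by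
    simp only [Fintype.card_sum, Fintype.card_prod, Fintype.card_fin, hm]; ring
  obtain ⟨B, hB, hspan⟩ := exists_finset_forall_mem_span (L := L)
    (linearIndependent_monomialValue (m := m) hJ.le hP)
  have hval : ∀ j (e : Fin N ⊕ Fin N → Fin m),
      ((monomialValue (P j) e : E) : L) = monomialValue (configPoint a b c d j) e := by
    intro j e
    simp [monomialValue, P]
  let S : Set L := configCoords a b c d ∪ (u 0 '' B ∪ u 1 '' B)
  have hE : ∀ x : E, (x : L) ∈ IntermediateField.adjoin K S := fun x =>
    IntermediateField.adjoin.mono K _ _ Set.subset_union_left x.2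
  have hmem : ∀ h e, u h e ∈ IntermediateField.adjoin K S := by
    intro h e
    have h1 : ∀ j, ∑ e, (monomialValue (P j) e : E) • u h e = 0 := fun j => by
      rw [← hu h j, polyValue]
      refine Finset.sum_congr rfl fun e _ => ?_
      rw [IntermediateField.smul_def, hval, smul_eq_mul, mul_comm]
    have h2 : u h '' B ⊆ S := by
      fin_cases h
      · exact fun x hx => Or.inr (Or.inl hx)
      · exact fun x hx => Or.inr (Or.inr hx)
    have h3 := hspan (u h) h1 e
    generalize u h e = y at h3 ⊢
    induction h3 using Submodule.span_induction with
    | mem x hx => exact IntermediateField.subset_adjoin K S (h2 hx)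
    | zero => exact zero_mem _
    | add x y _ _ hx hy => exact add_mem hx hy
    | smul x y _ hy =>
      rw [IntermediateField.smul_def, smul_eq_mul]
      exact mul_mem (hE x) hy
  have hsub : (configCoords a b c d ∪
      Set.range fun p : Fin 2 × (Fin N ⊕ Fin N → Fin m) => u p.1 p.2) ⊆
      (AlgebraicIndependent.matroid K L).closure S := by
    rintro x (hx | ⟨p, rfl⟩)
    · exact mem_matroid_closure_of_mem_adjoin
        (IntermediateField.subset_adjoin K S (Or.inl hx))
    · exact mem_matroid_closure_of_mem_adjoin (hmem p.1 p.2)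
  have hcoords : (configCoords a b c d).encard ≤ (2 * (s + r) * N : ℕ) := by
    rw [configCoords, ← Set.image_univ]
    refine (Set.encard_image_le _ _).trans ?_
    rw [Set.encard_univ, ENat.card_eq_coe_fintype_card]
    simp only [Fintype.card_sum, Fintype.card_prod, Fintype.card_fin]
    exact_mod_cast (by ring_nf; rfl)
  have himg : ∀ h, (u h '' B).encard ≤ (B.card : ℕ∞) := fun h =>
    (Set.encard_image_le _ _).trans (Set.encard_coe_eq_coe_finsetCard B).le
  have hrk : (AlgebraicIndependent.matroid K L).eRk (configCoords a b c d ∪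
      Set.range fun p : Fin 2 × (Fin N ⊕ Fin N → Fin m) => u p.1 p.2) ≤
      ((2 * (s + r) * N + 2 * B.card : ℕ) : ℕ∞) := by
    refine ((AlgebraicIndependent.matroid K L).eRk_mono hsub).trans ?_
    rw [Matroid.eRk_closure_eq]
    refine (Matroid.eRk_le_encard _ _).trans ((Set.encard_union_le _ _).trans ?_)
    rw [Nat.cast_add]
    refine add_le_add hcoords ((Set.encard_union_le _ _).trans ?_)
    refine (add_le_add (himg 0) (himg 1)).trans ?_
    rw [two_mul, Nat.cast_add]
  refine (add_le_add_left hrk _).trans ?_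
  rw [← Nat.cast_add, Nat.cast_le, ← hB, hJ]
  omega

end RankBound

section LimitConfiguration

theorem map_polyValue {ι K L : Type*} [Fintype ι] [DecidableEq ι] [CommRing K] [CommRing L] {m : ℕ}
    (φ : K →+* L) (u : (ι → Fin m) → K) (P : ι → K) :
    φ (polyValue u P) = polyValue (fun e => φ (u e)) fun i => φ (P i) := by
  simp [polyValue, monomialValue, map_sum, map_mul, map_prod, map_pow]

theorem configPoint_map {s r N : ℕ} {X Y : Type*} (φ : X → Y) (a b : Fin s → Fin N → X)
    (c d : Fin r → Fin N → X) (j) (i) :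
    configPoint (fun i k => φ (a i k)) (fun i k => φ (b i k)) (fun i k => φ (c i k))
      (fun i k => φ (d i k)) j i = φ (configPoint a b c d j i) := by
  rcases j with ⟨p, q⟩ | ⟨p, q⟩ | q <;> rcases i with i | i <;> rfl

theorem finite_configCoords {s r N : ℕ} {X : Type*} (a b : Fin s → Fin N → X)
    (c d : Fin r → Fin N → X) : (configCoords a b c d).Finite :=
  Set.finite_range _

theorem exists_le_eRk_range {L : Type} [Field L] [Algebra (ZMod 2) L]
    (hL : ∀ S : Set L, S.Countable → ∃ x, x ∉ S) (κ : Type*) [Fintype κ] :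
    ∃ v : κ → L, (Fintype.card κ : ℕ∞) ≤
      (AlgebraicIndependent.matroid (ZMod 2) L).eRk (Set.range v) := by
  have hfin : ∀ n : ℕ, ∃ v : Fin n → L, (n : ℕ∞) ≤
      (AlgebraicIndependent.matroid (ZMod 2) L).eRk (Set.range v) := by
    intro n
    induction n with
    | zero => exact ⟨Fin.elim0, by simp⟩
    | succ n ih =>
      obtain ⟨v, hv⟩ := ih
      obtain ⟨x, hx⟩ := hL _ (countable_matroid_closure (K := ZMod 2)
        (Set.finite_range v).countable)
      refine ⟨Fin.cons x v, ?_⟩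
      rw [Fin.range_cons, Matroid.eRk_insert_eq_add_one ⟨Set.mem_univ x, hx⟩, Nat.cast_add,
        Nat.cast_one]
      exact add_le_add_left hv 1
  obtain ⟨v, hv⟩ := hfin (Fintype.card κ)
  refine ⟨v ∘ Fintype.equivFin κ, ?_⟩
  rwa [(Fintype.equivFin κ).surjective.range_comp]

variable {F : ℕ → Type} [∀ l, Field (F l)] {L : Type} [Field L] {π : (∀ l, F l) →+* L}

theorem limit_ne (hπ : ∀ x, (∀ᶠ l in atTop, x l = 0) → π x = 0) {ι : Type*} [Fintype ι]
    {x y : ι → ∀ l, F l} (h : ∀ l, (fun i => x i l) ≠ fun i => y i l) :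
    (fun i => π (x i)) ≠ fun i => π (y i) := by
  obtain ⟨i, hi⟩ := exists_limit_ne_zero hπ (x := fun i => x i - y i) (Eventually.of_forall fun l =>
    (Function.ne_iff.1 (h l)).imp fun i hi => sub_ne_zero.2 hi)
  rw [map_sub] at hi
  exact Function.ne_iff.2 ⟨i, sub_ne_zero.1 hi⟩

theorem limit_eq_of_limit_eq (hπ : ∀ x, (∀ᶠ l in atTop, x l = 0) → π x = 0) {ι : Type*} [Fintype ι]
    (c : ∀ l, Fin (l + 1) → ι → F l) {d : ∀ l, Fin (l + 1) → ι → F l}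
    (hd : ∀ l, Function.Injective (d l)) {j j' : ∀ l, Fin (l + 1)}
    (h : (fun i => π fun l => d l (j l) i) = fun i => π fun l => d l (j' l) i) :
    (fun i => π fun l => c l (j l) i) = fun i => π fun l => c l (j' l) i := by
  classical
  let x : Option ι → ∀ l, F l := fun o => o.elim (fun l => if j l = j' l then 1 else 0)
    fun i => (fun l => d l (j l) i) - fun l => d l (j' l) i
  obtain ⟨o, ho⟩ := exists_limit_ne_zero hπ (x := x) (Eventually.of_forall fun l => by
    by_cases hl : j l = j' l
    · exact ⟨none, by simp [x, hl]⟩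
    · obtain ⟨i, hi⟩ := Function.ne_iff.1 ((hd l).ne hl)
      exact ⟨some i, sub_ne_zero.2 hi⟩)
  rcases o with - | i
  · funext i
    have h1 : π (x none * ((fun l => c l (j l) i) - fun l => c l (j' l) i)) = 0 := by
      refine hπ _ (Eventually.of_forall fun l => ?_)
      by_cases hl : j l = j' l <;> simp [x, hl]
    rw [map_mul, map_sub] at h1
    exact sub_eq_zero.1 ((mul_eq_zero.1 h1).resolve_left ho)
  · refine absurd ?_ ho
    simp only [x, Option.elim, map_sub]
    exact sub_eq_zero.2 (congrFun h i)

/-- Over a sequence of fields of growing size, generic pairs of polynomials cannot, for all choices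
of the constant terms, vanish on growing configurations. -/
theorem false_of_growing_configurations {F : ℕ → Type} [∀ l, Field (F l)]
    [∀ l, Algebra (ZMod 2) (F l)]
    (emb : ∀ l, Fin (l + 1) ↪ F l) {s N r m : ℕ} (hN : N = 2 * s + 1) (hr : r = 2 * s * N + 3)
    (hm : m = N * r) (e₀ : Fin N ⊕ Fin N → Fin m)
    (hbad : ∀ l, ∀ u : Fin 2 → (Fin N ⊕ Fin N → Fin m) → F l,
      ∃ u' : Fin 2 → (Fin N ⊕ Fin N → Fin m) → F l, (∀ h e, e ≠ e₀ → u' h e = u h e) ∧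
      ∃ (a b : Fin s → Fin N → F l) (c d : Fin (l + 1) → Fin N → F l),
        Function.Injective a ∧ Function.Injective b ∧ Function.Injective c ∧
        Function.Injective d ∧ (∀ i j, a i ≠ c j) ∧ (∀ i j, b i ≠ d j) ∧
        ∀ h j, polyValue (u' h) (configPoint a b c d j) = 0) : False := by
  classical
  obtain ⟨L, _, _, π, hsurj, hπ⟩ := exists_limit_field F
  let M := AlgebraicIndependent.matroid (ZMod 2) L
  have hL : ∀ S : Set L, S.Countable → ∃ x, x ∉ S := fun S hS => by
    obtain ⟨j, hj⟩ := exists_limit_notMem_countable (ι := Unit) (c := fun l j _ => emb l j) hsurj hπ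
      (fun l j j' h => (emb l).injective (congrFun h ()))
      (countable_pi_of_forall_mem hS)
    simp only [Set.mem_ofPred_eq, not_forall] at hj
    exact ⟨_, hj.choose_spec⟩
  obtain ⟨v, hv⟩ := exists_le_eRk_range hL (Fin 2 × {e : Fin N ⊕ Fin N → Fin m // e ≠ e₀})
  choose v' hv' using fun p => hsurj (v p)
  choose u huv a b c d ha hb hc hd hac hbd hu using fun l =>
    hbad l fun h e => if he : e = e₀ then 0 else v' (h, ⟨e, he⟩) l
  let w : Fin 2 → (Fin N ⊕ Fin N → Fin m) → L := fun h e => π fun l => u l h e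
  have hvw : ∀ p, v p = w p.1 p.2 := by
    rintro ⟨h, e, he⟩
    rw [← hv']
    refine congrArg π (funext fun l => ?_)
    rw [huv l h e he, dif_neg he]
  let A : Fin s → Fin N → L := fun i k => π fun l => a l i k
  let B : Fin s → Fin N → L := fun i k => π fun l => b l i k
  let C : (∀ l, Fin (l + 1)) → Fin N → L := fun j k => π fun l => c l (j l) k
  let D : (∀ l, Fin (l + 1)) → Fin N → L := fun j k => π fun l => d l (j l) k
  let R : Set L := Set.range fun p : Fin 2 × (Fin N ⊕ Fin N → Fin m) => w p.1 p.2
  have hchoose : ∀ n : ℕ, ∃ J : Fin n → ∀ l, Fin (l + 1),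
      Function.Injective (fun j => C (J j)) ∧
      ((Fintype.card (Fin 2 × {e : Fin N ⊕ Fin N → Fin m // e ≠ e₀}) + n : ℕ) : ℕ∞) ≤
        M.eRk (configCoords A B (fun j => C (J j)) (fun j => D (J j)) ∪ R) := by
    intro n
    induction n with
    | zero =>
      refine ⟨Fin.elim0, fun j => j.elim0, hv.trans (M.eRk_mono ?_)⟩
      rintro _ ⟨p, rfl⟩
      exact Or.inr ⟨(p.1, p.2), (hvw p).symm⟩
    | succ n ih =>
      obtain ⟨J, hJ, hrk⟩ := ih
      have hS : (configCoords A B (fun j => C (J j)) (fun j => D (J j)) ∪ R).Countable :=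
        ((finite_configCoords _ _ _ _).union (Set.finite_range _)).countable
      obtain ⟨j, hj⟩ := exists_limit_notMem_countable hsurj hπ hc
        (countable_pi_of_forall_mem (ι := Fin N) (countable_matroid_closure (K := ZMod 2) hS))
      simp only [Set.mem_ofPred_eq, not_forall] at hj
      obtain ⟨k, hk⟩ := hj
      refine ⟨Fin.cons j J, ?_, ?_⟩
      · have : (fun i => C ((Fin.cons j J : Fin (n + 1) → ∀ l, Fin (l + 1)) i)) =
            Fin.cons (C j) fun i => C (J i) := by
          funext i
          refine Fin.cases rfl (fun i => rfl) i
        rw [this, Fin.cons_injective_iff]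
        refine ⟨?_, hJ⟩
        rintro ⟨i, hi⟩
        apply hk
        refine M.mem_closure_of_mem' (Or.inl ⟨(Sum.inr (Sum.inl i), k), ?_⟩) (Set.mem_univ _)
        exact congrFun hi k
      · rw [← add_assoc, Nat.cast_add, Nat.cast_one]
        refine (add_le_add_left hrk 1).trans ?_
        rw [← Matroid.eRk_insert_eq_add_one (M := M) ⟨Set.mem_univ _, hk⟩]
        refine M.eRk_mono ?_
        rintro x (rfl | ⟨⟨(i | i) | (i | i), k'⟩, rfl⟩ | hx)
        · exact Or.inl ⟨(Sum.inr (Sum.inl 0), k), rfl⟩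
        · exact Or.inl ⟨(Sum.inl (Sum.inl i), k'), rfl⟩
        · exact Or.inl ⟨(Sum.inl (Sum.inr i), k'), rfl⟩
        · exact Or.inl ⟨(Sum.inr (Sum.inl i.succ), k'), rfl⟩
        · exact Or.inl ⟨(Sum.inr (Sum.inr i.succ), k'), rfl⟩
        · exact Or.inr hx
  obtain ⟨J, hJ, hrk⟩ := hchoose r
  have hA : Function.Injective A := fun i i' h => by
    by_contra hne
    exact limit_ne hπ (x := fun k l => a l i k) (y := fun k l => a l i' k)
      (fun l => (ha l).ne hne) h
  have hB : Function.Injective B := fun i i' h => by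
    by_contra hne
    exact limit_ne hπ (x := fun k l => b l i k) (y := fun k l => b l i' k)
      (fun l => (hb l).ne hne) h
  have hD : Function.Injective fun j => D (J j) := fun i i' h =>
    hJ (limit_eq_of_limit_eq hπ c hd h)
  have hAC : ∀ i j, A i ≠ C (J j) := fun i j =>
    limit_ne hπ (x := fun k l => a l i k) (y := fun k l => c l (J j l) k) fun l => hac l i (J j l)
  have hBD : ∀ i j, B i ≠ D (J j) := fun i j =>
    limit_ne hπ (x := fun k l => b l i k) (y := fun k l => d l (J j l) k) fun l => hbd l i (J j l)
  have hvanish : ∀ h j, polyValue (w h)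
      (configPoint A B (fun j => C (J j)) (fun j => D (J j)) j) = 0 := by
    intro h j
    have h1 : configPoint A B (fun j => C (J j)) (fun j => D (J j)) j = fun i =>
        π (configPoint (fun i k l => a l i k) (fun i k l => b l i k) (fun j k l => c l (J j l) k)
          (fun j k l => d l (J j l) k) j i) :=
      funext fun i => configPoint_map π _ _ _ _ j i
    rw [h1, ← map_polyValue π fun e l => u l h e]
    refine hπ _ (Eventually.of_forall fun l => ?_)
    have h2 := map_polyValue (Pi.evalRingHom F l) (fun e l => u l h e)
      (configPoint (fun i k l => a l i k) (fun i k l => b l i k) (fun j k l => c l (J j l) k)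
          (fun j k l => d l (J j l) k) j)
    simp only [Pi.evalRingHom_apply] at h2
    rw [h2]
    rcases j with ⟨p, q⟩ | ⟨p, q⟩ | q
    · convert hu l h (Sum.inl (p, J q l)) using 2
      funext i; rcases i with i | i <;> rfl
    · convert hu l h (Sum.inr (Sum.inl (J p l, q))) using 2
      funext i; rcases i with i | i <;> rfl
    · convert hu l h (Sum.inr (Sum.inr (J q l))) using 2
      funext i; rcases i with i | i <;> rfl
  have hfinal := eRk_config_add_le (K := ZMod 2) (by omega) (by rw [hm, hN]) hA hB hJ hD hAC hBD
    hvanish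
  have hcomb := (add_le_add_left hrk _).trans hfinal
  rw [← Nat.cast_add, Nat.cast_le, Fintype.card_prod, Fintype.card_fin] at hcomb
  have hcard : Fintype.card {e : Fin N ⊕ Fin N → Fin m // e ≠ e₀} =
      Fintype.card (Fin N ⊕ Fin N → Fin m) - 1 := Set.card_ne_eq e₀
  have hpos : 0 < Fintype.card (Fin N ⊕ Fin N → Fin m) := Fintype.card_pos_iff.2 ⟨e₀⟩
  rw [hcard, hm] at hcomb
  have e1 : 2 * (s + r) * N = 2 * s * N + 2 * (N * r) := by ring
  rw [e1] at hcomb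
  rw [hm] at hpos
  omega

end LimitConfiguration

section GenericPolynomials

/-- Adjusting the constant terms makes the common zero set of two polynomials large. -/
theorem exists_constant_terms {ι K : Type*} [Fintype ι] [DecidableEq ι] [Field K] [Finite K]
    {m n : ℕ} (hι : Fintype.card ι = n + 2) (u : Fin 2 → (ι → Fin m) → K) {e₀ : ι → Fin m}
    (he₀ : ∀ i, (e₀ i : ℕ) = 0) :
    ∃ u' : Fin 2 → (ι → Fin m) → K, (∀ h e, e ≠ e₀ → u' h e = u h e) ∧
      Nat.card K ^ n ≤ {P : ι → K | ∀ h, polyValue (u' h) P = 0}.ncard := by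
  classical
  have := Fintype.ofFinite K
  let v : (Fin 2 → K) → Fin 2 → (ι → Fin m) → K := fun w h => Function.update (u h) e₀ (w h)
  have hv : ∀ w h P, polyValue (v w h) P = w h + polyValue (v 0 h) P := by
    intro w h P
    have hrest : ∀ w, polyValue (v w h) P =
        w h + ∑ e ∈ Finset.univ.erase e₀, u h e * monomialValue P e := by
      intro w
      rw [polyValue, ← Finset.add_sum_erase _ _ (Finset.mem_univ e₀)]
      congr 1
      · simp [v, monomialValue, he₀]
      · refine Finset.sum_congr rfl fun e he => ?_
        simp [v, Function.update_of_ne (Finset.ne_of_mem_erase he)]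
    rw [hrest w, hrest 0]
    simp
  obtain ⟨w, -, hw⟩ := Finset.exists_le_card_fiber_of_mul_le_card_of_maps_to
    (s := (Finset.univ : Finset (ι → K))) (t := (Finset.univ : Finset (Fin 2 → K)))
    (f := fun P h => -polyValue (v 0 h) P)
    (n := Nat.card K ^ n) (fun _ _ => Finset.mem_univ _)
    Finset.univ_nonempty (by simp [hι, pow_add, mul_comm])
  refine ⟨v w, fun h e he => Function.update_of_ne he _ _, hw.trans (le_of_eq ?_)⟩
  rw [← Set.ncard_coe_finset]
  congr 1
  ext P
  simp only [Finset.coe_filter, Finset.mem_univ, true_and, Set.mem_ofPred_eq, funext_iff]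
  refine forall_congr' fun h => ?_
  rw [hv w, neg_eq_iff_add_eq_zero, add_comm]

/-- Over all large fields of characteristic two there are two polynomials with many common zeros
but without large configurations. -/
theorem exists_polynomials (s : ℕ) : ∃ l m : ℕ, ∀ᶠ k : ℕ in atTop,
    ∃ u : Fin 2 → (Fin (2 * s + 1) ⊕ Fin (2 * s + 1) → Fin m) → GaloisField 2 k,
      (2 ^ k) ^ (4 * s) ≤
        {P : Fin (2 * s + 1) ⊕ Fin (2 * s + 1) → GaloisField 2 k |
          ∀ h, polyValue (u h) P = 0}.ncard ∧
      ¬ ∃ (a b : Fin s → Fin (2 * s + 1) → GaloisField 2 k)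
          (c d : Fin (l + 1) → Fin (2 * s + 1) → GaloisField 2 k),
        Function.Injective a ∧ Function.Injective b ∧ Function.Injective c ∧
        Function.Injective d ∧ (∀ i j, a i ≠ c j) ∧ (∀ i j, b i ≠ d j) ∧
        ∀ h j, polyValue (u h) (configPoint a b c d j) = 0 := by
  by_contra! hcon
  obtain ⟨r, hr⟩ : ∃ r, r = 2 * s * (2 * s + 1) + 3 := ⟨_, rfl⟩
  obtain ⟨m, hm⟩ : ∃ m, m = (2 * s + 1) * r := ⟨_, rfl⟩
  have hm0 : 0 < m := by rw [hm, hr]; positivity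
  choose k hk hbad using fun l => (frequently_atTop.1 (hcon l m)) (l + 1)
  have hcard : ∀ l, Nat.card (GaloisField 2 (k l)) = 2 ^ k l := fun l =>
    GaloisField.card 2 (k l) (by have := hk l; omega)
  have hfin : ∀ l, Finite (GaloisField 2 (k l)) := fun l =>
    Nat.finite_of_card_ne_zero (by rw [hcard]; positivity)
  have emb : ∀ l, Nonempty (Fin (l + 1) ↪ GaloisField 2 (k l)) := fun l => by
    have := Fintype.ofFinite (GaloisField 2 (k l))
    refine Function.Embedding.nonempty_of_card_le ?_
    rw [Fintype.card_fin, ← Nat.card_eq_fintype_card, hcard]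
    exact (hk l).trans (Nat.lt_two_pow_self).le
  refine false_of_growing_configurations (F := fun l => GaloisField 2 (k l))
    (fun l => (emb l).some) rfl hr hm (fun _ => ⟨0, hm0⟩) fun l u => ?_
  obtain ⟨u', hu', hcount⟩ := exists_constant_terms (n := 4 * s)
    (by simp only [Fintype.card_sum, Fintype.card_fin]; omega) u
    (e₀ := fun _ => ⟨0, hm0⟩) fun _ => rfl
  rw [hcard] at hcount
  exact ⟨u', hu', hbad l u' hcount⟩

end GenericPolynomials

section LowerBound

/-- The graph joining the left copy of `x` to the right copy of `y` whenever `R x y`, where both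
copies of `X` are embedded in `V` by `e`. -/
def relGraph {X V : Type*} (e : X ⊕ X ↪ V) (R : X → X → Prop) : SimpleGraph V where
  Adj v w := ∃ x y, R x y ∧
    ((v = e (Sum.inl x) ∧ w = e (Sum.inr y)) ∨ (v = e (Sum.inr y) ∧ w = e (Sum.inl x)))
  symm := ⟨fun _ _ ⟨x, y, h, h'⟩ => ⟨x, y, h, h'.symm.imp And.symm And.symm⟩⟩
  loopless := ⟨fun v ⟨x, y, _, h'⟩ => by
    rcases h' with ⟨h₁, h₂⟩ | ⟨h₁, h₂⟩ <;> simpa using e.injective (h₁.symm.trans h₂)⟩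

variable {X V : Type*} {e : X ⊕ X ↪ V} {R : X → X → Prop}

theorem relGraph_adj_inl {x : X} {w : V} (h : (relGraph e R).Adj (e (Sum.inl x)) w) :
    ∃ y, e (Sum.inr y) = w ∧ R x y := by
  obtain ⟨x', y, hR, ⟨h₁, h₂⟩ | ⟨h₁, h₂⟩⟩ := h
  · obtain rfl : x = x' := by simpa using h₁
    exact ⟨y, h₂.symm, hR⟩
  · simp at h₁

theorem relGraph_adj_inr {y : X} {w : V} (h : (relGraph e R).Adj (e (Sum.inr y)) w) :
    ∃ x, e (Sum.inl x) = w ∧ R x y := by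
  obtain ⟨x, y', hR, ⟨h₁, h₂⟩ | ⟨h₁, h₂⟩⟩ := h
  · simp at h₁
  · obtain rfl : y = y' := by simpa using h₁
    exact ⟨x, h₂.symm, hR⟩

theorem ncard_le_ncard_edgeSet_relGraph [Finite V] :
    {p : X × X | R p.1 p.2}.ncard ≤ (relGraph e R).edgeSet.ncard := by
  refine Set.ncard_le_ncard_of_injOn (fun p => s(e (Sum.inl p.1), e (Sum.inr p.2))) ?_ ?_
    (Set.toFinite _)
  · rintro p hp
    exact ⟨p.1, p.2, hp, Or.inl ⟨rfl, rfl⟩⟩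
  · rintro ⟨x, y⟩ - ⟨x', y'⟩ - h
    simpa using h

/-- Exchanging the two copies of `K_{s,t}` is an automorphism of `H_{s,t}`. -/
def HgraphSwap (s t : ℕ) : Hgraph s t →g Hgraph s t where
  toFun p := (p.1, !p.2)
  map_rel' {p q} h := by
    rw [Hgraph_adj] at h ⊢
    simpa using h

theorem HgraphSwap_injective (s t : ℕ) : Function.Injective (HgraphSwap s t) := by
  rintro ⟨p, i⟩ ⟨q, j⟩ h
  simpa [HgraphSwap] using h

/-- A copy of `H_{s,t}` in a bipartite graph gives configurations of any size up to `t`. -/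
theorem exists_configuration_of_contains {s t r : ℕ} (hs : 0 < s) (ht : 0 < t) (hr : r ≤ t)
    (h : (relGraph e R).Contains (Hgraph s t)) :
    ∃ (a b : Fin s → X) (c d : Fin r → X),
      Function.Injective a ∧ Function.Injective b ∧ Function.Injective c ∧
      Function.Injective d ∧ (∀ i j, a i ≠ c j) ∧ (∀ i j, b i ≠ d j) ∧
      (∀ i j, R (a i) (d j)) ∧ (∀ i j, R (c j) (b i)) ∧ ∀ j, R (c j) (d j) := by
  obtain ⟨f, hf, x₀, hx₀⟩ : ∃ f : Hgraph s t →g relGraph e R, Function.Injective f ∧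
      ∃ x, e (Sum.inl x) = f (Sum.inl ⟨0, hs⟩, false) := by
    obtain ⟨f, hf⟩ := h
    obtain ⟨x, y, -, ⟨h₁, h₂⟩ | ⟨h₁, h₂⟩⟩ := f.map_adj
      (show (Hgraph s t).Adj (Sum.inl ⟨0, hs⟩, false) (Sum.inl ⟨0, hs⟩, true) by simp [Hgraph_adj])
    · exact ⟨f, hf, x, h₁.symm⟩
    · exact ⟨f.comp (HgraphSwap s t), hf.comp (HgraphSwap_injective s t), x, h₂.symm⟩
  have had : ∀ i j, (relGraph e R).Adj (f (Sum.inl i, false)) (f (Sum.inr j, false)) :=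
    fun i j => f.map_adj (by simp [Hgraph_adj])
  have hbc : ∀ i j, (relGraph e R).Adj (f (Sum.inl i, true)) (f (Sum.inr j, true)) :=
    fun i j => f.map_adj (by simp [Hgraph_adj])
  have hab : ∀ i, (relGraph e R).Adj (f (Sum.inl i, false)) (f (Sum.inl i, true)) :=
    fun i => f.map_adj (by simp [Hgraph_adj])
  have hdc : ∀ j, (relGraph e R).Adj (f (Sum.inr j, false)) (f (Sum.inr j, true)) :=
    fun j => f.map_adj (by simp [Hgraph_adj])
  have hd : ∀ j, ∃ y, e (Sum.inr y) = f (Sum.inr j, false) := fun j => by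
    have h := had ⟨0, hs⟩ j
    rw [← hx₀] at h
    exact (relGraph_adj_inl h).imp fun _ h => h.1
  choose d hd using hd
  have ha : ∀ i, ∃ x, e (Sum.inl x) = f (Sum.inl i, false) := fun i => by
    have h := (had i ⟨0, ht⟩).symm
    rw [← hd] at h
    exact (relGraph_adj_inr h).imp fun _ h => h.1
  choose a ha using ha
  have hb : ∀ i, ∃ y, e (Sum.inr y) = f (Sum.inl i, true) := fun i => by
    have h := hab i
    rw [← ha] at h
    exact (relGraph_adj_inl h).imp fun _ h => h.1
  choose b hb using hb
  have hc : ∀ j, ∃ x, e (Sum.inl x) = f (Sum.inr j, true) := fun j => by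
    have h := hdc j
    rw [← hd] at h
    exact (relGraph_adj_inr h).imp fun _ h => h.1
  choose c hc using hc
  have hadj : ∀ x y, (relGraph e R).Adj (e (Sum.inl x)) (e (Sum.inr y)) → R x y := by
    intro x y h
    obtain ⟨y', hy, hR⟩ := relGraph_adj_inl h
    obtain rfl : y' = y := by simpa using hy
    exact hR
  have hι := Fin.castLE_injective hr
  refine ⟨a, b, c ∘ Fin.castLE hr, d ∘ Fin.castLE hr, fun i j h => ?_, fun i j h => ?_,
    Function.Injective.comp (fun i j h => ?_) hι, Function.Injective.comp (fun i j h => ?_) hι,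
    fun i j h => ?_, fun i j h => ?_, fun i j => hadj _ _ ?_, fun i j => hadj _ _ ?_,
    fun j => hadj _ _ ?_⟩
  · exact Sum.inl.inj (congrArg Prod.fst (hf ((ha i).symm.trans (h ▸ ha j))))
  · exact Sum.inl.inj (congrArg Prod.fst (hf ((hb i).symm.trans (h ▸ hb j))))
  · exact Sum.inr.inj (congrArg Prod.fst (hf ((hc i).symm.trans (h ▸ hc j))))
  · exact Sum.inr.inj (congrArg Prod.fst (hf ((hd i).symm.trans (h ▸ hd j))))
  · exact Sum.inl_ne_inr (congrArg Prod.fst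
      (hf ((ha i).symm.trans ((congrArg (e ∘ Sum.inl) h).trans (hc _)))))
  · exact Sum.inl_ne_inr (congrArg Prod.fst
      (hf ((hb i).symm.trans ((congrArg (e ∘ Sum.inr) h).trans (hd _)))))
  · simpa [ha, hd] using had i _
  · simpa [hb, hc] using (hbc i _).symm
  · simpa [hc, hd] using (hdc _).symm

theorem ncard_edgeSet_le_exNum {β : Type*} {n : ℕ} {H : SimpleGraph β} {G : SimpleGraph (Fin n)}
    (hG : ¬ G.Contains H) : G.edgeSet.ncard ≤ exNum n H := by
  refine le_csSup ⟨Nat.card (Sym2 (Fin n)), ?_⟩ ⟨G, hG, rfl⟩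
  rintro N ⟨G', -, rfl⟩
  exact Set.ncard_le_card _

theorem eventually_exists_pow_le (N k₀ : ℕ) (hN : 0 < N) : ∀ᶠ n : ℕ in atTop,
    ∃ k, k₀ ≤ k ∧ 2 * (2 ^ k) ^ N ≤ n ∧ n ≤ 2 * (2 ^ (k + 1)) ^ N := by
  filter_upwards [eventually_ge_atTop (2 * (2 ^ N) ^ k₀)] with n hn
  have hpos : 0 < (2 ^ N) ^ k₀ := by positivity
  have hN2 : 1 < 2 ^ N := Nat.one_lt_two_pow hN.ne'
  have h₁ := Nat.pow_log_le_self (2 ^ N) (x := n / 2) (by omega)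
  have h₂ := Nat.lt_pow_succ_log_self hN2 (n / 2)
  rw [Nat.succ_eq_add_one] at h₂
  refine ⟨Nat.log (2 ^ N) (n / 2), Nat.le_log_of_pow_le hN2 (by omega), ?_, ?_⟩
  · rw [pow_right_comm]
    omega
  · rw [pow_right_comm]
    omega

theorem mul_rpow_le_pow {s k n : ℕ} (hn : n ≤ 2 * (2 ^ (k + 1)) ^ (2 * s + 1)) :
    (1 / (4 * 2 ^ (4 * s))) * (n : ℝ) ^ ((2 : ℝ) - 2 / (2 * s + 1)) ≤ (2 ^ k) ^ (4 * s) := by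
  have hs : (0 : ℝ) < 2 * s + 1 := by positivity
  have hθ : (2 : ℝ) - 2 / (2 * s + 1) = 4 * s / (2 * s + 1) := by field_simp; ring
  have hθ2 : (2 : ℝ) - 2 / (2 * s + 1) ≤ 2 := sub_le_self _ (by positivity)
  have hθ0 : (0 : ℝ) ≤ 2 - 2 / (2 * s + 1) := by rw [hθ]; positivity
  have hn' : (n : ℝ) ≤ 2 * (2 ^ (k + 1)) ^ (2 * s + 1) := by exact_mod_cast hn
  have h₁ : (n : ℝ) ^ ((2 : ℝ) - 2 / (2 * s + 1)) ≤ 4 * (2 ^ (k + 1)) ^ (4 * s) := by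
    refine (Real.rpow_le_rpow (by positivity) hn' hθ0).trans ?_
    rw [Real.mul_rpow (by norm_num) (by positivity)]
    refine mul_le_mul ?_ (le_of_eq ?_) (by positivity) (by norm_num)
    · refine (Real.rpow_le_rpow_of_exponent_le (by norm_num) hθ2).trans ?_
      norm_num
    · rw [← Real.rpow_natCast _ (2 * s + 1), ← Real.rpow_mul (by positivity), hθ,
        ← Real.rpow_natCast _ (4 * s)]
      congr 1
      push_cast
      field_simp
  rw [one_div, inv_mul_le_iff₀ (by positivity)]
  refine h₁.trans (le_of_eq ?_)
  rw [pow_succ, mul_pow]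
  ring

/-- The algebraic lower bound for the Turán number of `H_{s,t}`. -/
theorem exists_le_exNum (s : ℕ) (hs : 0 < s) : ∃ l : ℕ, 1 ≤ l ∧ ∀ t, l ≤ t →
    ∃ c : ℝ, 0 < c ∧ ∀ᶠ n : ℕ in atTop,
      c * (n : ℝ) ^ ((2 : ℝ) - 2 / (2 * s + 1)) ≤ (exNum n (Hgraph s t) : ℝ) := by
  obtain ⟨l, m, hlm⟩ := exists_polynomials s
  obtain ⟨k₀, hk₀⟩ := eventually_atTop.1 hlm
  refine ⟨l + 1, by omega, fun t ht => ⟨1 / (4 * 2 ^ (4 * s)), by positivity, ?_⟩⟩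
  filter_upwards [eventually_exists_pow_le (2 * s + 1) (k₀ + 1) (by omega)] with n hn
  obtain ⟨k, hk, hkn, hnk⟩ := hn
  obtain ⟨u, hcount, hfree⟩ := hk₀ k (by omega)
  have hcard : Nat.card (GaloisField 2 k) = 2 ^ k := GaloisField.card 2 k (by omega)
  have : Finite (GaloisField 2 k) := Nat.finite_of_card_ne_zero (by rw [hcard]; positivity)
  obtain ⟨e⟩ : Nonempty ((Fin (2 * s + 1) → GaloisField 2 k) ⊕
      (Fin (2 * s + 1) → GaloisField 2 k) ↪ Fin n) := by
    have := Fintype.ofFinite (GaloisField 2 k)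
    refine Function.Embedding.nonempty_of_card_le ?_
    rw [Fintype.card_sum, Fintype.card_fun, Fintype.card_fin, Fintype.card_fin,
      ← Nat.card_eq_fintype_card, hcard]
    omega
  let R : (Fin (2 * s + 1) → GaloisField 2 k) → (Fin (2 * s + 1) → GaloisField 2 k) → Prop :=
    fun x y => ∀ h, polyValue (u h) (Sum.elim x y) = 0
  have hG : ¬ (relGraph e R).Contains (Hgraph s t) := by
    intro h
    obtain ⟨a, b, c, d, ha, hb, hc, hd, hac, hbd, had, hcb, hcd⟩ :=
      exists_configuration_of_contains hs (by omega) ht h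
    refine hfree ⟨a, b, c, d, ha, hb, hc, hd, hac, hbd, ?_⟩
    rintro h (⟨i, j⟩ | ⟨j, i⟩ | j)
    · exact had i j h
    · exact hcb i j h
    · exact hcd j h
  have hzeros : {P : Fin (2 * s + 1) ⊕ Fin (2 * s + 1) → GaloisField 2 k |
      ∀ h, polyValue (u h) P = 0}.ncard ≤ {p : _ × _ | R p.1 p.2}.ncard := by
    refine Set.ncard_le_ncard_of_injOn (fun P => (P ∘ Sum.inl, P ∘ Sum.inr)) ?_ ?_
      (Set.toFinite _)
    · intro P hP h
      simpa using hP h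
    · intro P _ Q _ h
      simpa [Function.comp_def, funext_iff] using h
  refine (mul_rpow_le_pow hnk).trans ?_
  exact_mod_cast hcount.trans
    (hzeros.trans (ncard_le_ncard_edgeSet_relGraph.trans (ncard_edgeSet_le_exNum hG)))

end LowerBound

/-- There is $ℓ : ℕ → ℕ$ such that for all $s ≥ 2$ and $t ≥ ℓ(s)$,
$ex(n, H_{s,t}) = Θ(n^{2-2/(2s+1)})$. -/
theorem ex_Hst_theta :
    ∃ ℓ : ℕ → ℕ, ∀ s t : ℕ, 2 ≤ s → ℓ s ≤ t →
      ∃ c₁ c₂ : ℝ, 0 < c₁ ∧ 0 < c₂ ∧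
        ∀ᶠ n : ℕ in atTop,
          c₁ * (n : ℝ) ^ ((2 : ℝ) - 2 / (2 * s + 1)) ≤ (exNum n (Hgraph s t) : ℝ) ∧
          (exNum n (Hgraph s t) : ℝ) ≤ c₂ * (n : ℝ) ^ ((2 : ℝ) - 2 / (2 * s + 1)) := by
  choose! ℓ hℓ hlow using exists_le_exNum
  refine ⟨ℓ, fun s t hs ht => ?_⟩
  have hs0 : 0 < s := by omega
  obtain ⟨c₁, hc₁, h₁⟩ := hlow s hs0 t ht
  obtain ⟨c₂, hc₂, h₂⟩ := exists_exNum_le s t hs ((hℓ s hs0).trans ht)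
  exact ⟨c₁, c₂, hc₁, hc₂, h₁.mono fun n hn => ⟨hn, h₂ n⟩⟩
end

section
/- For every integer p ≥ 2 there exists a constant c > 0 such that for all n, ex(n, S_p) ≤ c · n^{7/5}. -/
open SimpleGraph Filter

/-- The 3-comb-pasting `S_p`: `p` disjoint copies of the 3-comb `T₃` (a path `a b c` plus
pendant vertices attached to `a`, `b`, `c`), with the `p` images of the pendant vertex at `a`
identified into the single vertex `Sum.inl 0`, those at `b` into `Sum.inl 1`, and those at `c`
into `Sum.inl 2`; the `i`-th copy of the path is `(i,0) (i,1) (i,2)`. -/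
def combPasting (p : ℕ) : SimpleGraph (Fin 3 ⊕ (Fin p × Fin 3)) :=
  SimpleGraph.fromRel fun x y =>
    match x, y with
    | Sum.inl j, Sum.inr (_, jj) => j = jj
    | Sum.inr (i, j), Sum.inr (ii, jj) => i = ii ∧ (jj : ℕ) = (j : ℕ) + 1
    | _, _ => False

namespace CombPasting

/-! ### Embedding the comb-pasting -/

/-- Rows `t i` of paths attached to the roots `r`, all vertices distinct, form a comb-pasting. -/
lemma contains_of_rows {V : Type*} {G : SimpleGraph V} {p : ℕ} (r : Fin 3 → V)
    (t : Fin p → Fin 3 → V)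
    (hinj : Function.Injective (Sum.elim r fun q : Fin p × Fin 3 => t q.1 q.2))
    (hr : ∀ i j, G.Adj (r j) (t i j)) (h01 : ∀ i, G.Adj (t i 0) (t i 1))
    (h12 : ∀ i, G.Adj (t i 1) (t i 2)) : G.Contains (combPasting p) := by
  have hpath : ∀ i (j k : Fin 3), (k : ℕ) = (j : ℕ) + 1 → G.Adj (t i j) (t i k) := by
    intro i j k hjk
    fin_cases j <;> fin_cases k <;> simp at hjk
    · exact h01 i
    · exact h12 i
  refine ⟨⟨Sum.elim r fun q => t q.1 q.2, ?_⟩, hinj⟩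
  rintro (j | ⟨i, j⟩) (k | ⟨i', k⟩) h
  · simp [combPasting] at h
  · simp only [combPasting, fromRel_adj, or_false] at h
    obtain ⟨-, rfl⟩ := h
    exact hr _ _
  · simp only [combPasting, fromRel_adj, false_or] at h
    obtain ⟨-, rfl⟩ := h
    exact (hr _ _).symm
  · simp only [combPasting, fromRel_adj] at h
    obtain ⟨-, ⟨rfl, h⟩ | ⟨rfl, h⟩⟩ := h
    · exact hpath _ _ _ h
    · exact (hpath _ _ _ h).symm

/-- If every vertex lies in few members of a large family of triples, then the family contains
`k` pairwise disjoint triples that avoid a given small set. -/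
lemma exists_disjoint_triples {V α : Type*} [DecidableEq V] [DecidableEq α] (Q : Finset α)
    (coord : α → Fin 3 → V) (M m : ℕ) (hM : ∀ v j, (Q.filter fun t => coord t j = v).card ≤ M)
    (hQ : 3 * M * m < Q.card) (k : ℕ) :
    ∀ F : Finset V, F.card + 3 * k ≤ m → ∃ T : Fin k → α, (∀ i, T i ∈ Q) ∧
      (∀ i j, coord (T i) j ∉ F) ∧
      ∀ i i', i ≠ i' → ∀ j j', coord (T i) j ≠ coord (T i') j' := by
  induction k with
  | zero => exact fun F _ => ⟨Fin.elim0, fun i => i.elim0, fun i => i.elim0, fun i => i.elim0⟩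
  | succ k ih =>
    intro F hF
    obtain ⟨t, htQ, htF⟩ : ∃ t ∈ Q, ∀ j, coord t j ∉ F := by
      by_contra! hcon
      have hsub : Q ⊆ (F ×ˢ (Finset.univ : Finset (Fin 3))).biUnion
          fun q => Q.filter fun t => coord t q.2 = q.1 := by
        intro t ht
        obtain ⟨j, hj⟩ := hcon t ht
        simp only [Finset.mem_biUnion, Finset.mem_product, Finset.mem_filter]
        exact ⟨(coord t j, j), ⟨hj, Finset.mem_univ _⟩, ht, rfl⟩
      have h1 := (Finset.card_le_card hsub).trans
        (Finset.card_biUnion_le_card_mul _ _ M fun q _ => hM q.1 q.2)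
      rw [Finset.card_product, Finset.card_univ, Fintype.card_fin] at h1
      have : F.card * 3 * M ≤ 3 * M * m := by
        calc F.card * 3 * M = 3 * M * F.card := by ring
          _ ≤ 3 * M * m := Nat.mul_le_mul_left _ (by omega)
      omega
    have hcard : (F ∪ Finset.univ.image (coord t)).card + 3 * k ≤ m := by
      have h1 := Finset.card_union_le F (Finset.univ.image (coord t))
      have h2 := Finset.card_image_le (s := Finset.univ) (f := coord t)
      rw [Finset.card_univ, Fintype.card_fin] at h2
      omega
    obtain ⟨T, hTQ, hTF, hT⟩ := ih _ hcard
    have hne : ∀ i j j', coord (T i) j ≠ coord t j' := fun i j j' h =>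
      hTF i j (Finset.mem_union_right _ (Finset.mem_image.2 ⟨j', Finset.mem_univ _, h.symm⟩))
    refine ⟨Fin.cons t T, fun i => ?_, fun i => ?_, fun i i' => ?_⟩
    · cases i using Fin.cases with
      | zero => exact htQ
      | succ i => exact hTQ i
    · cases i using Fin.cases with
      | zero => exact htF
      | succ i => exact fun j h => hTF i j (Finset.mem_union_left _ h)
    · cases i using Fin.cases with
      | zero =>
        cases i' using Fin.cases with
        | zero => exact fun h => absurd rfl h
        | succ i' => exact fun _ j j' => (hne i' j' j).symm
      | succ i =>
        cases i' using Fin.cases with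
        | zero => exact fun _ => hne i
        | succ i' => exact fun h => hT i i' fun h' => h (h' ▸ rfl)

lemma card_le_sq_of_two_coordinates {V α : Type*} [DecidableEq V] (s : Finset α)
    (f g : α → V) (L : ℕ) (A : Finset V) (B : V → Finset V)
    (hinj : ∀ t ∈ s, ∀ t' ∈ s, f t = f t' → g t = g t' → t = t')
    (hA : ∀ t ∈ s, f t ∈ A ∧ A.card ≤ L)
    (hB : ∀ t ∈ s, g t ∈ B (f t) ∧ (B (f t)).card ≤ L) : s.card ≤ L * L := by
  rcases s.eq_empty_or_nonempty with rfl | ⟨t₀, ht₀⟩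
  · simp
  refine (Finset.card_le_mul_card_image (f := f) s L ?_).trans (Nat.mul_le_mul_left _ ?_)
  · intro v hv
    obtain ⟨t, ht, rfl⟩ := Finset.mem_image.1 hv
    refine (Finset.card_le_card_of_injOn g ?_ ?_).trans (hB t ht).2
    · intro t' ht'
      simp only [Finset.coe_filter, Set.mem_ofPred_eq] at ht'
      exact ht'.2 ▸ (hB t' ht'.1).1
    · intro t₁ h₁ t₂ h₂ h
      simp only [Finset.coe_filter, Set.mem_ofPred_eq] at h₁ h₂
      exact hinj _ h₁.1 _ h₂.1 (h₁.2.trans h₂.2.symm) h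
  · exact (Finset.card_le_card (Finset.image_subset_iff.2 fun t ht => (hA t ht).1)).trans
      (hA t₀ ht₀).2

variable {V : Type*} [Fintype V] [DecidableEq V] (G : SimpleGraph V) [DecidableRel G.Adj]

/-- The pair `x, y` has at least `L` common neighbours. -/
def Heavy (L : ℕ) (x y : V) : Prop :=
  L ≤ (G.neighborFinset x ∩ G.neighborFinset y).card

instance (L : ℕ) : DecidableRel (Heavy G L) := fun _ _ => Nat.decLe _ _

variable {G}

lemma Heavy.symm {L : ℕ} {x y : V} (h : Heavy G L x y) : Heavy G L y x := by
  rwa [Heavy, Finset.inter_comm]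

/-- Two vertices `y, z` and `p` further vertices in a common neighbourhood, with all `2p` pairs
between them heavy, extend to a comb-pasting. -/
lemma contains_of_heavy {p : ℕ} {u y z : V} (hyz : y ≠ z) (hy : G.Adj u y) (hz : G.Adj u z)
    (b : Fin p → V) (hb : Function.Injective b) (hub : ∀ i, G.Adj u (b i))
    (hby : ∀ i, b i ≠ y) (hbz : ∀ i, b i ≠ z)
    (hhy : ∀ i, Heavy G (3 * p + 3) y (b i)) (hhz : ∀ i, Heavy G (3 * p + 3) z (b i)) :
    G.Contains (combPasting p) := by
  set F : Finset V := {u, y, z} ∪ Finset.univ.image b with hF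
  have hFcard : F.card ≤ p + 3 := by
    have h1 : F.card ≤ _ := Finset.card_union_le {u, y, z} (Finset.univ.image b)
    have h2 := Finset.card_image_le (s := Finset.univ) (f := b)
    have h3 : ({u, y, z} : Finset V).card ≤ 3 := Finset.card_le_three
    rw [Finset.card_univ, Fintype.card_fin] at h2
    omega
  let S : Fin p × Bool → Finset V := fun q =>
    (G.neighborFinset (if q.2 then z else y) ∩ G.neighborFinset (b q.1)) \ F
  have hS : ∀ q, 2 * p ≤ (S q).card := by
    rintro ⟨i, e⟩
    have h1 := Finset.le_card_sdiff F
      (G.neighborFinset (if e then z else y) ∩ G.neighborFinset (b i))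
    have h2 : 3 * p + 3 ≤
        (G.neighborFinset (if e then z else y) ∩ G.neighborFinset (b i)).card := by
      cases e
      · exact hhy i
      · exact hhz i
    change 2 * p ≤ ((G.neighborFinset (if e then z else y) ∩ G.neighborFinset (b i)) \ F).card
    omega
  obtain ⟨f, hf, hfS⟩ := (Finset.all_card_le_biUnion_card_iff_exists_injective S).1 (by
    intro s
    rcases s.eq_empty_or_nonempty with rfl | ⟨q, hq⟩
    · simp
    · have h1 := Finset.card_le_univ s
      have h2 := Finset.card_le_card (Finset.subset_biUnion_of_mem S hq)
      have h3 := hS q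
      simp only [Fintype.card_prod, Fintype.card_fin, Fintype.card_bool] at h1
      omega)
  have hmem : ∀ q, f q ∉ F ∧ G.Adj (if q.2 then z else y) (f q) ∧ G.Adj (b q.1) (f q) := by
    intro q
    have := hfS q
    simp only [S, Finset.mem_sdiff, Finset.mem_inter, mem_neighborFinset] at this
    tauto
  have hfu : ∀ q, f q ≠ u := fun q h => (hmem q).1 (by simp [hF, h])
  have hfy : ∀ q, f q ≠ y := fun q h => (hmem q).1 (by simp [hF, h])
  have hfz : ∀ q, f q ≠ z := fun q h => (hmem q).1 (by simp [hF, h])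
  have hfb : ∀ q i, f q ≠ b i := fun q i h => (hmem q).1 (by simp [hF, h])
  have hbu : ∀ i, b i ≠ u := fun i => (hub i).ne'
  refine contains_of_rows ![y, u, z] (fun i => ![f (i, false), b i, f (i, true)]) ?_ ?_ ?_ ?_
  · refine Function.Injective.sumElim ?_ ?_ ?_
    · intro j k h
      fin_cases j <;> fin_cases k <;> simp_all [hy.ne, hy.ne', hz.ne, hz.ne', hyz.symm]
    · rintro ⟨i, j⟩ ⟨i', k⟩ h
      have hfb' : ∀ q i, b i ≠ f q := fun q i => (hfb q i).symm
      fin_cases j <;> fin_cases k <;> simp [hf.eq_iff, hb.eq_iff, hfb, hfb'] at h ⊢ <;> exact h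
    · rintro j ⟨i, k⟩
      fin_cases j <;> fin_cases k <;>
        simp [(hfu _).symm, (hfy _).symm, (hfz _).symm, (hbu _).symm, (hby _).symm, (hbz _).symm]
  · intro i j
    have h0 := (hmem (i, false)).2.1
    have h2 := (hmem (i, true)).2.1
    fin_cases j
    · simpa using h0
    · simpa using hub i
    · simpa using h2
  · intro i
    simpa using (hmem (i, false)).2.2.symm
  · intro i
    simpa using (hmem (i, true)).2.2

/-- In a graph without a comb-pasting, few pairs inside a large neighbourhood are heavy. -/
lemma card_heavy_pairs_le {p : ℕ} (hG : ¬ G.Contains (combPasting p)) (u : V)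
    (hu : 100 * (p + 3) ≤ G.degree u) :
    10 * ((G.neighborFinset u ×ˢ G.neighborFinset u).filter
      fun q => Heavy G (3 * p + 3) q.1 q.2).card ≤ G.degree u ^ 2 := by
  set N := G.neighborFinset u with hN
  set D := G.degree u with hD
  have hND : N.card = D := G.card_neighborFinset_eq_degree u
  set h : V → ℕ := fun x => (N.filter fun y => Heavy G (3 * p + 3) x y).card with hh
  have hM : ((N ×ˢ N).filter fun q => Heavy G (3 * p + 3) q.1 q.2).card = ∑ x ∈ N, h x := by
    rw [Finset.card_filter, Finset.sum_product]
    simp only [hh, Finset.card_filter]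
  have hco : ∀ y ∈ N, ∀ z ∈ N, y ≠ z → (N.filter fun x => Heavy G (3 * p + 3) x y ∧
      Heavy G (3 * p + 3) x z).card < p + 2 := by
    intro y hy z hz hyz
    by_contra! hcon
    set C := N.filter fun x => Heavy G (3 * p + 3) x y ∧ Heavy G (3 * p + 3) x z with hC
    have h1 : p ≤ (C \ {y, z}).card := by
      have h2 := Finset.le_card_sdiff {y, z} C
      have h3 : ({y, z} : Finset V).card ≤ 2 := Finset.card_le_two
      omega
    obtain ⟨C', hC', hcard⟩ := Finset.exists_subset_card_eq h1
    let e := C'.equivFinOfCardEq hcard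
    have hb : ∀ i, ((e.symm i : C') : V) ∈ C \ {y, z} := fun i => hC' (e.symm i).2
    simp only [hC, hN, Finset.mem_sdiff, Finset.mem_filter, mem_neighborFinset, Finset.mem_insert,
      Finset.mem_singleton, not_or] at hb
    rw [hN, mem_neighborFinset] at hy hz
    exact hG (contains_of_heavy hyz hy hz (fun i => ((e.symm i : C') : V))
      (Subtype.val_injective.comp e.symm.injective) (fun i => (hb i).1.1) (fun i => (hb i).2.1)
      (fun i => (hb i).2.2) (fun i => (hb i).1.2.1.symm) (fun i => (hb i).1.2.2.symm))
  have hsq : ∑ x ∈ N, h x ^ 2 ≤ D ^ 2 * (p + 3) := by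
    have h1 : ∑ x ∈ N, h x ^ 2 = ∑ y ∈ N, ∑ z ∈ N, (N.filter fun x =>
        Heavy G (3 * p + 3) x y ∧ Heavy G (3 * p + 3) x z).card := by
      simp only [hh, Finset.card_filter, sq, Finset.sum_mul_sum]
      rw [Finset.sum_comm]
      refine Finset.sum_congr rfl fun y _ => ?_
      rw [Finset.sum_comm]
      refine Finset.sum_congr rfl fun z _ => Finset.sum_congr rfl fun x _ => ?_
      by_cases h1 : Heavy G (3 * p + 3) x y <;> by_cases h2 : Heavy G (3 * p + 3) x z <;>
        simp [h1, h2]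
    have h2 : ∀ y ∈ N, ∑ z ∈ N, (N.filter fun x =>
        Heavy G (3 * p + 3) x y ∧ Heavy G (3 * p + 3) x z).card ≤ D * (p + 3) := by
      intro y hy
      have h3 : ∀ z ∈ N, (N.filter fun x => Heavy G (3 * p + 3) x y ∧
          Heavy G (3 * p + 3) x z).card ≤ (if y = z then D else 0) + (p + 2) := by
        intro z hz
        split_ifs with hyz
        · exact le_add_right (hND ▸ Finset.card_filter_le _ _)
        · have := hco y hy z hz hyz
          omega
      refine (Finset.sum_le_sum h3).trans ?_
      rw [Finset.sum_add_distrib, Finset.sum_ite_eq, if_pos hy, Finset.sum_const, hND, smul_eq_mul]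
      exact le_of_eq (by ring)
    rw [h1]
    refine (Finset.sum_le_sum h2).trans ?_
    rw [Finset.sum_const, hND, smul_eq_mul]
    exact le_of_eq (by ring)
  have hcs : (∑ x ∈ N, h x) ^ 2 ≤ D * ∑ x ∈ N, h x ^ 2 := hND ▸ sq_sum_le_card_mul_sum_sq
  rw [hM]
  refine (Nat.pow_le_pow_iff_left two_ne_zero).1 ?_
  calc (10 * ∑ x ∈ N, h x) ^ 2 = 100 * (∑ x ∈ N, h x) ^ 2 := by ring
    _ ≤ 100 * (D * (D ^ 2 * (p + 3))) := by gcongr; exact hcs.trans (by gcongr)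
    _ = D ^ 3 * (100 * (p + 3)) := by ring
    _ ≤ D ^ 3 * D := by gcongr
    _ = (D ^ 2) ^ 2 := by ring

/-! ### Averages over neighbourhoods -/

section Average

variable {V : Type*} [Fintype V] {G : SimpleGraph V} [DecidableRel G.Adj]

variable (G) in
/-- The average of `f` over the neighbours of `u`. -/
noncomputable def nbrAvg (u : V) (f : V → ℝ) : ℝ :=
  (∑ x, if G.Adj u x then f x else 0) / G.degree u

lemma nbrAvg_add (u : V) (f g : V → ℝ) :
    nbrAvg G u (fun x => f x + g x) = nbrAvg G u f + nbrAvg G u g := by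
  simp only [nbrAvg, ← Finset.sum_filter, Finset.sum_add_distrib, add_div]

lemma nbrAvg_mono (u : V) {f g : V → ℝ} (h : ∀ x, f x ≤ g x) : nbrAvg G u f ≤ nbrAvg G u g := by
  simp only [nbrAvg, ← Finset.sum_filter]
  gcongr
  exact h _

lemma nbrAvg_const {u : V} (hu : 0 < G.degree u) (c : ℝ) : nbrAvg G u (fun _ => c) = c := by
  rw [nbrAvg, ← Finset.sum_filter, ← neighborFinset_eq_filter, Finset.sum_const,
    card_neighborFinset_eq_degree, nsmul_eq_mul]
  field_simp

lemma degree_mul_nbrAvg {u : V} (hu : 0 < G.degree u) (f : V → ℝ) :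
    G.degree u * nbrAvg G u f = ∑ x, if G.Adj u x then f x else 0 := by
  rw [nbrAvg]
  field_simp

/-- The degree distribution is stationary: a uniform random oriented edge can be reversed. -/
lemma sum_degree_mul_nbrAvg_comm (hpos : ∀ u, 0 < G.degree u) (g : V → V → ℝ) :
    ∑ b, G.degree b * nbrAvg G b (fun a => g b a) =
      ∑ b, G.degree b * nbrAvg G b (fun a => g a b) := by
  simp only [degree_mul_nbrAvg (hpos _)]
  rw [Finset.sum_comm]
  simp only [G.adj_comm]

lemma sum_ite_adj_nonneg (u : V) {f : V → ℝ} (hf : ∀ x, 0 ≤ f x) :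
    0 ≤ ∑ x, if G.Adj u x then f x else 0 :=
  Finset.sum_nonneg fun x _ => by split_ifs <;> simp [hf]

lemma nbrAvg_le {d k : ℕ} (hd : 0 < d) {u : V} (hu : d ≤ G.degree u) {f g : V → ℝ}
    (hg : ∀ x, 0 ≤ g x) (hfg : ∀ x, f x ≤ g x / d ^ k) :
    nbrAvg G u f ≤ (∑ x, if G.Adj u x then g x else 0) / d ^ (k + 1) := by
  refine (nbrAvg_mono u hfg).trans ?_
  have h := sum_ite_adj_nonneg (G := G) u hg
  have h1 : nbrAvg G u (fun x => g x / d ^ k) =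
      (∑ x, if G.Adj u x then g x else 0) / d ^ k / G.degree u := by
    simp only [nbrAvg, ← Finset.sum_filter, Finset.sum_div]
  rw [h1, pow_succ, ← div_div]
  gcongr

/-- Homomorphic copies of the 3-comb, listed as `(b, a, c, y, x, z)` with path `a b c` and pendant
vertices `x`, `y`, `z` at `a`, `b`, `c`, none of whose relevant pairs satisfies `H`. -/
def combs (G : SimpleGraph V) [DecidableRel G.Adj] (H : V → V → Prop) [DecidableRel H] :
    Finset (V × V × V × V × V × V) :=
  Finset.univ.filter fun q => match q with
    | (b, a, c, y, x, z) => G.Adj b a ∧ G.Adj b c ∧ G.Adj b y ∧ G.Adj a x ∧ G.Adj c z ∧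
        ¬ H x b ∧ ¬ H z b ∧ ¬ H a y ∧ ¬ H c y ∧ ¬ H a c

/-- If few pairs in each neighbourhood satisfy `H`, then there are many combs avoiding `H`. -/
lemma le_card_combs (H : V → V → Prop) [DecidableRel H] (hsymm : ∀ x y, H x y → H y x)
    {d : ℕ} (hd : 0 < d) (hdeg : ∀ u, d ≤ G.degree u)
    (hH : ∀ u, 10 * ((G.neighborFinset u ×ˢ G.neighborFinset u).filter
      fun q => H q.1 q.2).card ≤ G.degree u ^ 2) :
    Fintype.card V * d ^ 5 ≤ 2 * (combs G H).card := by
  have hpos : ∀ u, 0 < G.degree u := fun u => hd.trans_le (hdeg u)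
  let h : V → V → ℝ := fun x y => if H x y then 1 else 0
  have hh : ∀ x y, h x y = h y x := fun x y => by
    simp only [h, show H x y ↔ H y x from ⟨hsymm x y, hsymm y x⟩]
  let good : V → V → V → V → V → V → ℝ := fun b a c y x z =>
    if ¬ H x b ∧ ¬ H z b ∧ ¬ H a y ∧ ¬ H c y ∧ ¬ H a c then 1 else 0
  have hgood0 : ∀ b a c y x z, 0 ≤ good b a c y x z := fun b a c y x z => by
    simp only [good]; split_ifs <;> norm_num
  have hone : ∀ b a c y x z, (1 : ℝ) ≤
      good b a c y x z + h x b + h z b + h a y + h c y + h a c := by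
    intro b a c y x z
    by_cases h1 : H x b <;> by_cases h2 : H z b <;> by_cases h3 : H a y <;>
      by_cases h4 : H c y <;> by_cases h5 : H a c <;> simp [good, h, h1, h2, h3, h4, h5] <;>
      norm_num
  have hpair : ∑ b, G.degree b * nbrAvg G b (fun a => nbrAvg G b fun y => h a y) ≤
      ∑ b, (G.degree b : ℝ) / 10 := by
    refine Finset.sum_le_sum fun b _ => ?_
    rw [degree_mul_nbrAvg (hpos b)]
    have h0 : (0 : ℝ) < G.degree b := by exact_mod_cast hpos b
    have h1 : (∑ a, if G.Adj b a then nbrAvg G b (fun y => h a y) else 0) =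
        (((G.neighborFinset b ×ˢ G.neighborFinset b).filter
          fun q => H q.1 q.2).card : ℝ) / G.degree b := by
      rw [Finset.card_filter, Finset.sum_product]
      push_cast
      simp only [nbrAvg, neighborFinset_eq_filter, Finset.sum_filter, Finset.sum_div, h]
      refine Finset.sum_congr rfl fun a _ => ?_
      split_ifs
      · rw [Finset.sum_div]
      · simp
    have h2 : (10 : ℝ) * ((G.neighborFinset b ×ˢ G.neighborFinset b).filter
      fun q => H q.1 q.2).card ≤ (G.degree b : ℝ) ^ 2 := by exact_mod_cast hH b
    rw [h1, div_le_div_iff₀ h0 (by norm_num)]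
    linarith
  have hswap : ∑ b, G.degree b * nbrAvg G b (fun a => nbrAvg G a fun x => h x b) ≤
      ∑ b, (G.degree b : ℝ) / 10 := by
    rw [sum_degree_mul_nbrAvg_comm hpos fun b a => nbrAvg G a fun x => h x b]
    refine (Finset.sum_congr rfl fun b _ => ?_).trans_le hpair
    congr 2
    funext a
    congr 1
    funext x
    exact hh x a
  have htotal : ∑ b, (G.degree b : ℝ) ≤
      ∑ b, G.degree b * nbrAvg G b (fun a => nbrAvg G b fun c => nbrAvg G b fun y =>
        nbrAvg G a fun x => nbrAvg G c fun z => good b a c y x z) +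
      5 * ∑ b, (G.degree b : ℝ) / 10 := by
    have h1 : ∀ b, (G.degree b : ℝ) ≤ G.degree b * nbrAvg G b (fun a => nbrAvg G b fun c =>
        nbrAvg G b fun y => nbrAvg G a fun x => nbrAvg G c fun z =>
        good b a c y x z + h x b + h z b + h a y + h c y + h a c) := by
      intro b
      refine le_mul_of_one_le_right (by positivity) ?_
      calc (1 : ℝ) = nbrAvg G b (fun a => nbrAvg G b fun c =>
            nbrAvg G b fun y => nbrAvg G a fun x => nbrAvg G c fun z => 1) := by
            simp only [nbrAvg_const (hpos _)]
        _ ≤ _ := nbrAvg_mono _ fun a => nbrAvg_mono _ fun c => nbrAvg_mono _ fun y =>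
            nbrAvg_mono _ fun x => nbrAvg_mono _ fun z => hone b a c y x z
    refine (Finset.sum_le_sum fun b _ => h1 b).trans ?_
    simp only [nbrAvg_add, nbrAvg_const (hpos _), mul_add, Finset.sum_add_distrib]
    linarith
  have hupper : ∑ b, G.degree b * nbrAvg G b (fun a => nbrAvg G b fun c => nbrAvg G b fun y =>
        nbrAvg G a fun x => nbrAvg G c fun z => good b a c y x z) ≤
      ((combs G H).card : ℝ) / d ^ 4 := by
    have hcard : ((combs G H).card : ℝ) = ∑ b, ∑ a, if G.Adj b a then ∑ c, if G.Adj b c then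
        ∑ y, if G.Adj b y then ∑ x, if G.Adj a x then ∑ z, if G.Adj c z then good b a c y x z
        else 0 else 0 else 0 else 0 else 0 := by
      rw [combs, Finset.card_filter]
      push_cast
      simp only [Fintype.sum_prod_type, good, ite_and]
      simp only [Finset.sum_ite_irrel, Finset.sum_const_zero]
    rw [hcard, Finset.sum_div]
    refine Finset.sum_le_sum fun b _ => ?_
    rw [degree_mul_nbrAvg (hpos b), Finset.sum_div]
    refine Finset.sum_le_sum fun a _ => ?_
    split_ifs
    · refine nbrAvg_le (k := 3) hd (hdeg b) (fun c => ?_) fun c =>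
        nbrAvg_le (k := 2) hd (hdeg b) (fun y => ?_) fun y =>
        nbrAvg_le (k := 1) hd (hdeg a) (fun x => ?_) fun x => ?_
      · exact sum_ite_adj_nonneg _ fun y => sum_ite_adj_nonneg _ fun x =>
          sum_ite_adj_nonneg _ fun z => hgood0 ..
      · exact sum_ite_adj_nonneg _ fun x => sum_ite_adj_nonneg _ fun z => hgood0 ..
      · exact sum_ite_adj_nonneg _ fun z => hgood0 ..
      · exact nbrAvg_le (k := 0) hd (hdeg c) (fun z => hgood0 ..) fun z => by simp
    · simp
  have hsum : (Fintype.card V : ℝ) * d ≤ ∑ b, (G.degree b : ℝ) := by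
    rw [← nsmul_eq_mul, ← Finset.card_univ]
    exact Finset.card_nsmul_le_sum _ _ _ fun b _ => by exact_mod_cast hdeg b
  rw [← Finset.sum_div] at htotal
  have hd0 : (0 : ℝ) < (d : ℝ) ^ 4 := by positivity
  have hfin : (Fintype.card V : ℝ) * d / 2 ≤ ((combs G H).card : ℝ) / d ^ 4 := by linarith
  rw [div_le_div_iff₀ (by norm_num) hd0] at hfin
  have : (Fintype.card V : ℝ) * d ^ 5 ≤ 2 * (combs G H).card := by
    calc (Fintype.card V : ℝ) * d ^ 5 = Fintype.card V * d * d ^ 4 := by ring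
      _ ≤ _ := by linarith
  exact_mod_cast this

end Average

/-! ### Counting combs without heavy pairs -/

/-- The pendant vertices of a comb in `combs`. -/
def pendants (q : V × V × V × V × V × V) : V × V × V :=
  (q.2.2.2.2.1, q.2.2.2.1, q.2.2.2.2.2)

/-- The path of a comb in `combs`. -/
def spine (q : V × V × V × V × V × V) : Fin 3 → V := ![q.2.1, q.1, q.2.2.1]

lemma card_combs_through_le (L : ℕ) (r : V × V × V) (v : V) (j : Fin 3) :
    (((combs G (Heavy G L)).filter fun q => pendants q = r).filter
      fun q => spine q j = v).card ≤ L * L := by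
  obtain ⟨x, y, z⟩ := r
  fin_cases j
  · refine card_le_sq_of_two_coordinates _ (fun q => q.1) (fun q => q.2.2.1) L
      (G.neighborFinset v ∩ G.neighborFinset y)
      (fun b => G.neighborFinset z ∩ G.neighborFinset b) ?_ ?_ ?_
    · rintro ⟨b, a, c, y', x', z'⟩ ht ⟨b₁, a₁, c₁, y₁, x₁, z₁⟩ ht'
      simp [pendants, spine] at ht ht' ⊢
      grind
    all_goals
      rintro ⟨b, a, c, y', x', z'⟩ ht
      simp [pendants, spine, combs, Heavy] at ht ⊢
      obtain ⟨⟨⟨h1, h2, h3, h4, h5, h6, h7, h8, h9, h10⟩, rfl, rfl, rfl⟩, rfl⟩ := ht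
    · exact ⟨⟨h1.symm, h3.symm⟩, h8.le⟩
    · exact ⟨⟨h5.symm, h2⟩, h7.le⟩
  · refine card_le_sq_of_two_coordinates _ (fun q => q.2.1) (fun q => q.2.2.1) L
      (G.neighborFinset x ∩ G.neighborFinset v)
      (fun _ => G.neighborFinset z ∩ G.neighborFinset v) ?_ ?_ ?_
    · rintro ⟨b, a, c, y', x', z'⟩ ht ⟨b₁, a₁, c₁, y₁, x₁, z₁⟩ ht'
      simp [pendants, spine] at ht ht' ⊢
      grind
    all_goals
      rintro ⟨b, a, c, y', x', z'⟩ ht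
      simp [pendants, spine, combs, Heavy] at ht ⊢
      obtain ⟨⟨⟨h1, h2, h3, h4, h5, h6, h7, h8, h9, h10⟩, rfl, rfl, rfl⟩, rfl⟩ := ht
    · exact ⟨⟨h4.symm, h1⟩, h6.le⟩
    · exact ⟨⟨h5.symm, h2⟩, h7.le⟩
  · refine card_le_sq_of_two_coordinates _ (fun q => q.1) (fun q => q.2.1) L
      (G.neighborFinset v ∩ G.neighborFinset y)
      (fun b => G.neighborFinset x ∩ G.neighborFinset b) ?_ ?_ ?_
    · rintro ⟨b, a, c, y', x', z'⟩ ht ⟨b₁, a₁, c₁, y₁, x₁, z₁⟩ ht'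
      simp [pendants, spine] at ht ht' ⊢
      grind
    all_goals
      rintro ⟨b, a, c, y', x', z'⟩ ht
      simp [pendants, spine, combs, Heavy] at ht ⊢
      obtain ⟨⟨⟨h1, h2, h3, h4, h5, h6, h7, h8, h9, h10⟩, rfl, rfl, rfl⟩, rfl⟩ := ht
    · exact ⟨⟨h2.symm, h3.symm⟩, h9.le⟩
    · exact ⟨⟨h4.symm, h1⟩, h6.le⟩

lemma card_combs_fiber_le (L : ℕ) (r : V × V × V) :
    ((combs G (Heavy G L)).filter fun q => pendants q = r).card ≤ L * L * Fintype.card V :=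
  (Finset.card_le_mul_card_image (f := fun q => spine q 0) _ (L * L)
    fun v _ => card_combs_through_le L r v 0).trans
      (Nat.mul_le_mul_left _ (Finset.card_le_univ _))

/-- In a graph without a comb-pasting, three distinct vertices are the pendant vertices of boundedly
many combs without heavy pairs. -/
lemma card_combs_fiber_le_of_distinct {p L : ℕ} (hG : ¬ G.Contains (combPasting p))
    (hdeg : ∀ u, L ≤ G.degree u) {x y z : V} (hxy : x ≠ y) (hyz : y ≠ z) (hxz : x ≠ z) :
    ((combs G (Heavy G L)).filter fun q => pendants q = (x, y, z)).card ≤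
      3 * (L * L) * (3 * p + 3) := by
  by_contra! hcon
  obtain ⟨T, hTQ, hTF, hT⟩ := exists_disjoint_triples _ spine (L * L) (3 * p + 3)
    (card_combs_through_le L (x, y, z)) hcon p {x, y, z} (by
      have : ({x, y, z} : Finset V).card ≤ 3 := Finset.card_le_three
      omega)
  have hprop : ∀ i, (∀ j, G.Adj (![x, y, z] j) (spine (T i) j)) ∧
      G.Adj (spine (T i) 0) (spine (T i) 1) ∧ G.Adj (spine (T i) 1) (spine (T i) 2) ∧
      spine (T i) 0 ≠ spine (T i) 2 := by
    intro i
    have hi := hTQ i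
    generalize T i = q at hi ⊢
    obtain ⟨b, a, c, y', x', z'⟩ := q
    simp only [pendants, combs, Finset.mem_filter, Finset.mem_univ, true_and,
      Prod.mk.injEq] at hi
    obtain ⟨⟨h1, h2, h3, h4, h5, h6, h7, h8, h9, h10⟩, rfl, rfl, rfl⟩ := hi
    refine ⟨fun j => ?_, h1.symm, h2, fun hac => h10 ?_⟩
    · fin_cases j
      · exact h4.symm
      · exact h3.symm
      · exact h5.symm
    · obtain rfl : a = c := hac
      simpa [Heavy] using hdeg a
  refine hG (contains_of_rows ![x, y, z] (fun i => spine (T i)) ?_ (fun i => (hprop i).1)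
    (fun i => (hprop i).2.1) fun i => (hprop i).2.2.1)
  refine Function.Injective.sumElim ?_ ?_ ?_
  · intro j k h
    fin_cases j <;> fin_cases k <;> simp_all
  · rintro ⟨i, j⟩ ⟨i', k⟩ h
    obtain rfl : i = i' := by
      by_contra hne
      exact hT i i' hne j k h
    obtain ⟨-, h01, h12, h02⟩ := hprop i
    have h01 := h01.ne
    have h12 := h12.ne
    fin_cases j <;> fin_cases k <;> simp_all [eq_comm]
  · rintro j ⟨i, k⟩ h
    refine hTF i k (h ▸ ?_)
    fin_cases j <;> simp

lemma card_combs_le {p L : ℕ} (hG : ¬ G.Contains (combPasting p))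
    (hdeg : ∀ u, L ≤ G.degree u) :
    (combs G (Heavy G L)).card ≤ 3 * (L * L) * (3 * p + 4) * Fintype.card V ^ 3 := by
  set n := Fintype.card V with hn
  set K := 3 * (L * L) * (3 * p + 3) with hK
  set M := L * L * n with hM
  have hfib : ∀ x y z : V, ((combs G (Heavy G L)).filter fun q => pendants q = (x, y, z)).card ≤
      K + (if x = y then M else 0) + (if y = z then M else 0) + (if x = z then M else 0) := by
    intro x y z
    have h := card_combs_fiber_le (G := G) L (x, y, z)
    rw [← hn, ← hM] at h
    by_cases hxy : x = y
    · rw [if_pos hxy]; omega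
    by_cases hyz : y = z
    · rw [if_pos hyz]; omega
    by_cases hxz : x = z
    · rw [if_pos hxz]; omega
    have := card_combs_fiber_le_of_distinct hG hdeg hxy hyz hxz
    omega
  rw [Finset.card_eq_sum_card_fiberwise (f := pendants) (t := Finset.univ)
    fun _ _ => Finset.mem_coe.2 (Finset.mem_univ _)]
  simp only [Fintype.sum_prod_type]
  refine (Finset.sum_le_sum fun x _ => Finset.sum_le_sum fun y _ => Finset.sum_le_sum fun z _ =>
    hfib x y z).trans ?_
  simp only [Finset.sum_add_distrib, Finset.sum_const, Finset.card_univ, Finset.sum_ite_eq,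
    Finset.mem_univ, if_true, smul_eq_mul, ← hn, mul_ite, mul_zero]
  exact le_of_eq (by rw [hM, hK]; ring)

/-- The minimum degree `d` of an `n`-vertex graph without a comb-pasting is `O(n ^ (2 / 5))`. -/
lemma pow_five_le {p d : ℕ} [Nonempty V] (hG : ¬ G.Contains (combPasting p))
    (hd : 100 * (p + 3) ≤ d) (hdeg : ∀ u, d ≤ G.degree u) :
    d ^ 5 ≤ 6 * ((3 * p + 3) * (3 * p + 3)) * (3 * p + 4) * Fintype.card V ^ 2 := by
  have h1 := le_card_combs (G := G) (Heavy G (3 * p + 3)) (fun _ _ h => h.symm) (by omega) hdeg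
    fun u => card_heavy_pairs_le hG u (hd.trans (hdeg u))
  have h2 := card_combs_le (L := 3 * p + 3) hG fun u => le_trans (by omega) (hdeg u)
  refine Nat.le_of_mul_le_mul_left ?_ (Fintype.card_pos (α := V))
  calc Fintype.card V * d ^ 5
      ≤ 2 * (3 * ((3 * p + 3) * (3 * p + 3)) * (3 * p + 4) * Fintype.card V ^ 3) := by omega
    _ = _ := by ring

lemma contains_iff_isContained {V W : Type*} {G : SimpleGraph V} {H : SimpleGraph W} : G.Contains H ↔ H ⊑ G :=
  ⟨fun ⟨f, hf⟩ => ⟨⟨f, hf⟩⟩, fun ⟨f⟩ => ⟨f.toHom, f.injective⟩⟩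

lemma exNum_le_extremalNumber {W : Type*} (n : ℕ) (H : SimpleGraph W) :
    exNum n H ≤ extremalNumber n H := by
  classical
  refine csSup_le' ?_
  rintro N ⟨G, hG, rfl⟩
  have h := card_edgeFinset_le_extremalNumber (G := G) (H := H)
    (mt contains_iff_isContained.2 hG)
  rwa [Fintype.card_fin, ← Set.ncard_coe_finset, coe_edgeFinset] at h

/-- A bound `c * n ^ (2 / 5)` on the minimum degree of `H`-free graphs on `n` vertices gives the
bound `c * n ^ (7 / 5)` on the number of edges. -/
lemma extremalNumber_le_of_minDegree {W : Type*} (H : SimpleGraph W) {c : ℝ} (hc : 0 ≤ c)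
    (h : ∀ (n : ℕ) (G : SimpleGraph (Fin (n + 1))) [DecidableRel G.Adj], ¬ G.Contains H →
      ∃ v, (G.degree v : ℝ) ≤ c * ((n + 1 : ℕ) : ℝ) ^ ((2 : ℝ) / 5)) (n : ℕ) :
    (extremalNumber n H : ℝ) ≤ c * (n : ℝ) ^ ((7 : ℝ) / 5) := by
  induction n with
  | zero =>
    rw [← Fintype.card_fin 0, extremalNumber_le_iff_of_nonneg H (by positivity)]
    intro G _ _
    have : G.edgeFinset = ∅ := by
      rw [edgeFinset_eq_empty]
      exact Subsingleton.elim _ _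
    rw [this]
    simp only [Finset.card_empty, Nat.cast_zero]
    positivity
  | succ n ih =>
    have hpos : 0 ≤ c * ((n + 1 : ℕ) : ℝ) ^ ((7 : ℝ) / 5) := by positivity
    have key := extremalNumber_le_iff_of_nonneg (V := Fin (n + 1)) H hpos
    rw [Fintype.card_fin] at key
    rw [key]
    intro G _ hG
    obtain ⟨v, hv⟩ := h n G (mt contains_iff_isContained.1 hG)
    have h1 := card_edgeFinset_deleteIncidenceSet_le_extremalNumber hG v
    rw [card_edgeFinset_deleteIncidenceSet, Fintype.card_fin, Nat.add_sub_cancel,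
      Nat.sub_le_iff_le_add] at h1
    have h2 : (G.edgeFinset.card : ℝ) ≤ extremalNumber n H + G.degree v := by exact_mod_cast h1
    have hsplit : ∀ m : ℕ, (m : ℝ) ^ ((7 : ℝ) / 5) = m * (m : ℝ) ^ ((2 : ℝ) / 5) := by
      intro m
      rw [show (7 : ℝ) / 5 = 1 + 2 / 5 by norm_num,
        Real.rpow_add_of_nonneg (by positivity) (by norm_num) (by norm_num), Real.rpow_one]
    have hmono : (n : ℝ) ^ ((2 : ℝ) / 5) ≤ ((n + 1 : ℕ) : ℝ) ^ ((2 : ℝ) / 5) := by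
      gcongr
      omega
    rw [hsplit] at ih ⊢
    calc (G.edgeFinset.card : ℝ)
        ≤ c * (n * (n : ℝ) ^ ((2 : ℝ) / 5)) + c * ((n + 1 : ℕ) : ℝ) ^ ((2 : ℝ) / 5) := by linarith
      _ ≤ c * (n * ((n + 1 : ℕ) : ℝ) ^ ((2 : ℝ) / 5)) +
          c * ((n + 1 : ℕ) : ℝ) ^ ((2 : ℝ) / 5) := by gcongr
      _ = _ := by push_cast; ring

end CombPasting

/-- For every $p ≥ 2$ there is $c > 0$ with $ex(n, S_p) ≤ c · n^{7/5}$ for all $n$. -/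
theorem ex_combPasting_upper (p : ℕ) (hp : 2 ≤ p) :
    ∃ c : ℝ, 0 < c ∧ ∀ n : ℕ,
      (exNum n (combPasting p) : ℝ) ≤ c * (n : ℝ) ^ ((7 : ℝ) / 5) := by
  set K : ℕ := 6 * ((3 * p + 3) * (3 * p + 3)) * (3 * p + 4) with hK
  refine ⟨100 * (p + 3) + K, by positivity, fun n =>
    (Nat.cast_le.2 (CombPasting.exNum_le_extremalNumber n _)).trans
      (CombPasting.extremalNumber_le_of_minDegree _ (by positivity) ?_ n)⟩
  intro n G _ hG
  by_contra! hcon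
  set N : ℝ := ((n + 1 : ℕ) : ℝ) with hN
  have hN1 : 1 ≤ N ^ ((2 : ℝ) / 5) := Real.one_le_rpow (by simp [hN]) (by norm_num)
  obtain ⟨v, hv⟩ := G.exists_minimal_degree_vertex
  have hlt := hv ▸ hcon v
  have hd : 100 * (p + 3) ≤ G.minDegree := by
    have h1 : (100 * (p + 3) : ℝ) ≤ (100 * (p + 3) + K) * N ^ ((2 : ℝ) / 5) :=
      le_trans (by simp) (le_mul_of_one_le_right (by positivity) hN1)
    exact_mod_cast (h1.trans_lt hlt).le
  have hle := CombPasting.pow_five_le hG hd G.minDegree_le_degree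
  rw [← hK, Fintype.card_fin] at hle
  have hleR : (G.minDegree : ℝ) ^ 5 ≤ K * N ^ 2 := by
    rw [hN]
    exact_mod_cast hle
  have hpow : (N ^ ((2 : ℝ) / 5)) ^ 5 = N ^ 2 := by
    rw [← Real.rpow_natCast, ← Real.rpow_mul (by positivity)]
    norm_num
  have hK1 : (1 : ℝ) ≤ 100 * (p + 3) + K := by
    have : (0 : ℝ) ≤ K := by positivity
    have : (0 : ℝ) ≤ p := by positivity
    linarith
  have hbig : (K : ℝ) * N ^ 2 ≤ (((100 * (p + 3) + K) * N ^ ((2 : ℝ) / 5)) : ℝ) ^ 5 := by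
    rw [mul_pow, hpow]
    gcongr
    refine le_trans ?_ (le_self_pow₀ hK1 (by norm_num))
    have : (0 : ℝ) ≤ 100 * (p + 3) := by positivity
    linarith
  have hlt5 := pow_lt_pow_left₀ hlt (by positivity) (by norm_num : (5 : ℕ) ≠ 0)
  linarith
end
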